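/- arXiv:1803.06263 — 4 statements merged into one kernel-verified Lean document; each statement's English description precedes it below -/
import Mathlib

section
/- Let M ∈ GL(2,ℤ) be a matrix of infinite order (Mⁿ ≠ I for all integers n ≠ 0). Then the centraliser of M in GL(2,ℤ), namely {G ∈ GL(2,ℤ) : GM = MG}, is isomorphic as a group to C₂ × ℤ, where the C₂ factor is generated by −I. -/
/-- abstract gluing lemma -/
theorem aux_iso {C : Type*} [Group C] (z c : C) (hz : z * z = 1) (hz1 : z ≠ 1)
    (hcomm : ∀ g, z * g = g * z)
    (hgen : ∀ g, ∃ n : ℤ, g = c ^ n ∨ g = z * c ^ n)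
    (hinf : ∀ n : ℤ, n ≠ 0 → c ^ n ≠ 1 ∧ c ^ n ≠ z) :
    ∃ φ : C ≃* Multiplicative (ZMod 2) × Multiplicative ℤ,
      φ z = (Multiplicative.ofAdd (1 : ZMod 2), 1) := by
  let e : Multiplicative (ZMod 2) →* C :=
    { toFun := fun x => if x = 1 then 1 else z
      map_one' := by simp
      map_mul' := by
        intro x y
        have h2 : ∀ x : Multiplicative (ZMod 2), x = 1 ∨ x = Multiplicative.ofAdd (1 : ZMod 2) := by
          decide
        have h3 : Multiplicative.ofAdd (1 : ZMod 2) ≠ 1 := by decide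
        have h4 : Multiplicative.ofAdd (1 : ZMod 2) * Multiplicative.ofAdd (1 : ZMod 2) = 1 := by
          decide
        rcases h2 x with rfl | rfl <;> rcases h2 y with rfl | rfl <;> simp only [h3, h4, if_true,
          if_false, one_mul, mul_one, hz] }
  have he1 : e (Multiplicative.ofAdd (1 : ZMod 2)) = z := by
    have h3 : Multiplicative.ofAdd (1 : ZMod 2) ≠ 1 := by decide
    change (if Multiplicative.ofAdd (1 : ZMod 2) = 1 then 1 else z) = z
    rw [if_neg h3]
  have h2 : ∀ x : Multiplicative (ZMod 2), x = 1 ∨ x = Multiplicative.ofAdd (1 : ZMod 2) := by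
    decide
  have hcm : ∀ m n, Commute (e m) (zpowersHom C c n) := by
    intro m n
    rcases h2 m with rfl | rfl
    · rw [map_one]; exact Commute.one_left _
    · rw [he1]; exact hcomm _
  let ψ := MonoidHom.noncommCoprod e (zpowersHom C c) hcm
  have hψ : ∀ x, ψ x = e x.1 * c ^ (x.2.toAdd) := fun x => rfl
  have hbij : Function.Bijective ψ := by
    constructor
    · rw [injective_iff_map_eq_one]
      rintro ⟨m, n⟩ h
      rw [hψ] at h
      simp only at h
      have hn : n.toAdd = 0 := by
        by_contra hn
        rcases h2 m with rfl | rfl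
        · rw [map_one, one_mul] at h; exact (hinf _ hn).1 h
        · rw [he1] at h
          refine (hinf _ hn).2 ?_
          rw [eq_comm, ← mul_left_cancel_iff (a := z), h, hz]
      have hn' : n = 1 := hn
      subst hn'
      rcases h2 m with rfl | rfl
      · rfl
      · rw [he1] at h; simp at h; exact absurd h hz1
    · intro g
      obtain ⟨n, rfl | rfl⟩ := hgen g
      · exact ⟨(1, Multiplicative.ofAdd n), by rw [hψ]; simp⟩
      · exact ⟨(Multiplicative.ofAdd 1, Multiplicative.ofAdd n), by rw [hψ]; simp [he1]⟩
  refine ⟨(MulEquiv.ofBijective ψ hbij).symm, ?_⟩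
  rw [MulEquiv.symm_apply_eq]
  change z = ψ _
  rw [hψ]; simp [he1]

theorem aux_gen {C : Type*} [Group C] (z : C) (f : C → ℝ) (hf : ∀ g h, f (g * h) = f g + f h)
    (hker : ∀ g, f g = 0 → g = 1 ∨ g = z) (ε : ℝ) (hε : 0 < ε) (hgap : ∀ g, 0 < f g → ε ≤ f g) :
    ∃ c : C, ∀ g, ∃ n : ℤ, g = c ^ n ∨ g = z * c ^ n := by
  let F : Additive C →+ ℝ := AddMonoidHom.mk' (fun x => f x.toMul) (fun x y => hf _ _)
  obtain ⟨b, hb⟩ := AddSubgroup.cyclic_of_isolated_zero (H := F.range) hε (by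
    rw [Set.disjoint_left]
    rintro _ ⟨x, rfl⟩ ⟨h1, h2⟩
    exact absurd (hgap x.toMul h1) (not_le.mpr h2))
  have hb' : b ∈ F.range := by rw [hb]; exact AddSubgroup.subset_closure rfl
  obtain ⟨c, hc⟩ := hb'
  refine ⟨c.toMul, fun g => ?_⟩
  have hg : F (Additive.ofMul g) ∈ F.range := ⟨_, rfl⟩
  rw [hb, AddSubgroup.mem_closure_singleton] at hg
  obtain ⟨n, hn⟩ := hg
  refine ⟨n, ?_⟩
  have h0 : F (Additive.ofMul g - n • c) = 0 := by
    rw [map_sub, map_zsmul, hc, hn, sub_self]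
  have := hker (g * (c.toMul ^ n)⁻¹) (by rw [← h0, sub_eq_add_neg]; rfl)
  rcases this with h | h
  · left; rwa [mul_inv_eq_one] at h
  · right; rwa [mul_inv_eq_iff_eq_mul] at h

theorem aux_sq (x y : ℤ) (h : x ^ 2 = y ^ 2 + 4) : y = 0 := by
  rw [← sq_abs x, ← sq_abs y] at h
  rw [← abs_eq_zero]
  have hx := abs_nonneg x
  have hy := abs_nonneg y
  generalize |x| = x at *
  generalize |y| = y at *
  have h1 : y < x := by nlinarith
  have h2 : x ≠ y + 1 := by rintro rfl; ring_nf at h; omega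
  have h3 : y + 2 ≤ x := by omega
  nlinarith

theorem aux_det (G : GL (Fin 2) ℤ) :
    G.1 0 0 * G.1 1 1 - G.1 0 1 * G.1 1 0 = 1 ∨ G.1 0 0 * G.1 1 1 - G.1 0 1 * G.1 1 0 = -1 := by
  have := (Matrix.isUnit_iff_isUnit_det _).1 G.isUnit
  rw [Matrix.det_fin_two] at this
  exact Int.isUnit_iff.1 this

theorem aux_comm (M G : GL (Fin 2) ℤ) (h : G * M = M * G) :
    G.1 0 1 * M.1 1 0 = M.1 0 1 * G.1 1 0 ∧
    M.1 0 1 * (G.1 0 0 - G.1 1 1) = G.1 0 1 * (M.1 0 0 - M.1 1 1) ∧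
    M.1 1 0 * (G.1 0 0 - G.1 1 1) = G.1 1 0 * (M.1 0 0 - M.1 1 1) := by
  have h' : G.1 * M.1 = M.1 * G.1 := congrArg Units.val h
  have h00 := congrFun (congrFun h' 0) 0
  have h01 := congrFun (congrFun h' 0) 1
  have h10 := congrFun (congrFun h' 1) 0
  simp only [Matrix.mul_apply, Fin.sum_univ_two] at h00 h01 h10
  refine ⟨?_, ?_, ?_⟩ <;> linarith

theorem aux_scalar (G : GL (Fin 2) ℤ) (hq : G.1 0 1 = 0) (hr : G.1 1 0 = 0)
    (hps : G.1 0 0 = G.1 1 1) : G = 1 ∨ G = -1 := by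
  have hd := aux_det G
  rw [hq, hr, ← hps] at hd
  have : G.1 0 0 = 1 ∨ G.1 0 0 = -1 := by
    apply Int.isUnit_iff.1
    rcases hd with h | h
    · exact IsUnit.of_mul_eq_one (G.1 0 0) (by linarith)
    · nlinarith [mul_self_nonneg (G.1 0 0)]
  rcases this with h | h
  · left
    ext i j
    fin_cases i <;> fin_cases j <;> simp_all
  · right
    ext i j
    fin_cases i <;> fin_cases j <;> simp_all

theorem aux_mul (G H : GL (Fin 2) ℤ) (i j : Fin 2) :
    (G * H).1 i j = G.1 i 0 * H.1 0 j + G.1 i 1 * H.1 1 j := by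
  rw [Units.val_mul, Matrix.mul_apply, Fin.sum_univ_two]

/-- Cayley-Hamilton, concretely -/
theorem aux_ch (A : Matrix (Fin 2) (Fin 2) ℤ) (t δ : ℤ) (ht : A 0 0 + A 1 1 = t)
    (hδ : A 0 0 * A 1 1 - A 0 1 * A 1 0 = δ) : A * A = t • A - δ • 1 := by
  subst ht hδ
  ext i j
  fin_cases i <;> fin_cases j <;> simp [-zsmul_eq_mul, -Int.smul_one_eq_cast, -zsmul_one, Matrix.mul_apply, Fin.sum_univ_two] <;> ring

theorem aux_elliptic (M : GL (Fin 2) ℤ) (hM : ∀ n : ℤ, n ≠ 0 → M ^ n ≠ 1) :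
    0 ≤ (M.1 0 0 + M.1 1 1) ^ 2 - 4 * (M.1 0 0 * M.1 1 1 - M.1 0 1 * M.1 1 0) ∧
    ¬ (M.1 0 0 + M.1 1 1 = 0 ∧ M.1 0 0 * M.1 1 1 - M.1 0 1 * M.1 1 0 = -1) := by
  have key : ∀ n : ℕ, n ≠ 0 → M.1 ^ n ≠ 1 := by
    intro n hn h
    apply hM n (by exact_mod_cast hn)
    rw [zpow_natCast]
    apply Units.ext
    rw [Units.val_pow_eq_pow_val, h, Units.val_one]
  constructor
  · by_contra hneg
    push Not at hneg
    have hd := aux_det M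
    have hch := aux_ch M.1 _ _ rfl rfl
    generalize M.1 0 0 * M.1 1 1 - M.1 0 1 * M.1 1 0 = δ at *
    generalize M.1 0 0 + M.1 1 1 = t at *
    have hδ : δ = 1 := by
      rcases hd with h | h
      · exact h
      · subst h; nlinarith [sq_nonneg t]
    subst hδ
    have h1 : t < 2 := by nlinarith
    have h2 : -2 < t := by nlinarith
    generalize M.1 = A at *
    have : t = -1 ∨ t = 0 ∨ t = 1 := by omega
    rcases this with rfl | rfl | rfl
    · simp at hch
      apply key 3 (by norm_num)
      have : A ^ 3 = A * (A * A) := by noncomm_ring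
      rw [this, hch, mul_sub, mul_neg, hch]; noncomm_ring
    · simp at hch
      apply key 4 (by norm_num)
      have : A ^ 4 = (A * A) * (A * A) := by noncomm_ring
      rw [this, hch]; noncomm_ring
    · simp at hch
      apply key 6 (by norm_num)
      have h3 : A * (A * A) = -1 := by
        rw [hch, mul_sub, hch]; noncomm_ring
      have : A ^ 6 = (A * (A * A)) * (A * (A * A)) := by noncomm_ring
      rw [this, h3]; noncomm_ring
  · rintro ⟨h1, h2⟩
    have hch := aux_ch M.1 _ _ h1 h2
    apply key 2 (by norm_num)
    rw [sq, hch]; simp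

theorem aux_par (M : GL (Fin 2) ℤ) (hM : ¬ (M = 1 ∨ M = -1))
    (hD : (M.1 0 0 + M.1 1 1) ^ 2 - 4 * (M.1 0 0 * M.1 1 1 - M.1 0 1 * M.1 1 0) = 0) :
    ∃ f : Subgroup.centralizer ({M} : Set (GL (Fin 2) ℤ)) → ℝ,
      (∀ g h, f (g * h) = f g + f h) ∧ (∀ g, f g = 0 → g.1 = 1 ∨ g.1 = -1) ∧
      ∃ ε > 0, ∀ g, 0 < f g → ε ≤ f g := by
  have hbc : M.1 0 1 - M.1 1 0 ≠ 0 := by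
    intro h
    apply hM
    have h1 : M.1 0 1 = M.1 1 0 := by linarith
    rw [h1] at hD
    have h2 : (M.1 0 0 - M.1 1 1) ^ 2 + 4 * (M.1 1 0) ^ 2 = 0 := by linarith
    have h3 : M.1 1 0 = 0 := by nlinarith [sq_nonneg (M.1 0 0 - M.1 1 1), sq_nonneg (M.1 1 0)]
    have h4 : M.1 0 0 - M.1 1 1 = 0 := by
      nlinarith [sq_nonneg (M.1 0 0 - M.1 1 1), sq_nonneg (M.1 1 0)]
    exact aux_scalar M (h1.trans h3) h3 (by linarith)
  have hcm : ∀ g : Subgroup.centralizer ({M} : Set (GL (Fin 2) ℤ)), g.1 * M = M * g.1 := fun g =>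
    (Subgroup.mem_centralizer_iff.1 g.2 M rfl).symm
  -- proportionality
  have hdisc : ∀ g : Subgroup.centralizer ({M} : Set (GL (Fin 2) ℤ)),
      (g.1.1 0 0 + g.1.1 1 1) ^ 2 = 4 := by
    intro g
    obtain ⟨e1, e2, e3⟩ := aux_comm M g.1 (hcm g)
    have hd := aux_det g.1
    generalize g.1.1 0 0 = p at *
    generalize g.1.1 0 1 = q at *
    generalize g.1.1 1 0 = r at *
    generalize g.1.1 1 1 = s at *
    generalize M.1 0 0 = a at *
    generalize M.1 0 1 = b at *
    generalize M.1 1 0 = c at *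
    generalize M.1 1 1 = d at *
    have h0 : (b - c) ^ 2 * ((p - s) ^ 2 + 4 * q * r) = 0 := by
      have e4 : (b - c) * (p - s) = (q - r) * (a - d) := by linarith
      have e5 : (b - c) * q = (q - r) * b := by linarith
      have e6 : (b - c) * r = (q - r) * c := by linarith
      calc _ = ((b - c) * (p - s)) ^ 2 + 4 * ((b - c) * q) * ((b - c) * r) := by ring
        _ = (q - r) ^ 2 * ((a + d) ^ 2 - 4 * (a * d - b * c)) := by rw [e4, e5, e6]; ring
        _ = 0 := by rw [hD, mul_zero]
    have h1 : (p - s) ^ 2 + 4 * q * r = 0 := by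
      rcases mul_eq_zero.1 h0 with h | h
      · exact absurd (pow_eq_zero_iff (two_ne_zero) |>.1 h) hbc
      · exact h
    rcases hd with h | h <;> nlinarith [sq_nonneg (p + s)]
  refine ⟨fun g => (((g.1.1 0 1 - g.1.1 1 0) * (g.1.1 0 0 + g.1.1 1 1) : ℤ) : ℝ), ?_, ?_, 1,
    one_pos, ?_⟩
  · intro g h
    have := hdisc g
    have := hdisc h
    obtain ⟨e1, e2, e3⟩ := aux_comm M g.1 (hcm g)
    obtain ⟨e1', e2', e3'⟩ := aux_comm M h.1 (hcm h)
    beta_reduce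
    norm_cast
    have m00 : (g * h).1.1 0 0 = _ := aux_mul g.1 h.1 0 0
    have m01 : (g * h).1.1 0 1 = _ := aux_mul g.1 h.1 0 1
    have m10 : (g * h).1.1 1 0 = _ := aux_mul g.1 h.1 1 0
    have m11 : (g * h).1.1 1 1 = _ := aux_mul g.1 h.1 1 1
    rw [m00, m01, m10, m11]
    generalize g.1.1 0 0 = p at *
    generalize g.1.1 0 1 = q at *
    generalize g.1.1 1 0 = r at *
    generalize g.1.1 1 1 = s at *
    generalize h.1.1 0 0 = p' at *
    generalize h.1.1 0 1 = q' at *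
    generalize h.1.1 1 0 = r' at *
    generalize h.1.1 1 1 = s' at *
    generalize M.1 0 0 = a at *
    generalize M.1 0 1 = b at *
    generalize M.1 1 0 = c at *
    generalize M.1 1 1 = d at *
    have e4 : (b - c) * (p - s) = (q - r) * (a - d) := by linarith
    have e5 : (b - c) * q = (q - r) * b := by linarith
    have e6 : (b - c) * r = (q - r) * c := by linarith
    have e4' : (b - c) * (p' - s') = (q' - r') * (a - d) := by linarith
    have e5' : (b - c) * q' = (q' - r') * b := by linarith
    have e6' : (b - c) * r' = (q' - r') * c := by linarith
    -- twice trace and off-diagonal of the product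
    have k1 : 2 * (p * p' + q * r' + (r * q' + s * s')) = (p + s) * (p' + s') := by
      have : (b - c) ^ 2 * ((p - s) * (p' - s') + 2 * q * r' + 2 * r * q') = 0 := by
        calc _ = ((b - c) * (p - s)) * ((b - c) * (p' - s')) + 2 * ((b - c) * q) * ((b - c) * r')
              + 2 * ((b - c) * r) * ((b - c) * q') := by ring
          _ = (q - r) * (q' - r') * ((a + d) ^ 2 - 4 * (a * d - b * c)) := by
            rw [e4, e5, e6, e4', e5', e6']; ring
          _ = 0 := by rw [hD, mul_zero]
      have : (p - s) * (p' - s') + 2 * q * r' + 2 * r * q' = 0 := by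
        rcases mul_eq_zero.1 this with h | h
        · exact absurd (pow_eq_zero_iff (two_ne_zero) |>.1 h) hbc
        · exact h
      linarith
    have k2 : 2 * (p * q' + q * s' - (r * p' + s * r')) =
        (p + s) * (q' - r') + (q - r) * (p' + s') := by
      have : (b - c) * ((p - s) * (q' + r') - (q + r) * (p' - s')) = 0 := by
        have : (b - c) * ((b - c) * ((p - s) * (q' + r') - (q + r) * (p' - s'))) = 0 := by
          calc _ = ((b - c) * (p - s)) * ((b - c) * q' + (b - c) * r')
                - ((b - c) * q + (b - c) * r) * ((b - c) * (p' - s')) := by ring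
            _ = 0 := by rw [e4, e5, e6, e4', e5', e6']; ring
        exact (mul_eq_zero.1 this).resolve_left hbc
      have := (mul_eq_zero.1 this).resolve_left hbc
      linarith
    have : 4 * ((p * q' + q * s' - (r * p' + s * r')) * (p * p' + q * r' + (r * q' + s * s')))
        = 4 * ((q - r) * (p + s) + (q' - r') * (p' + s')) := by
      calc _ = (2 * (p * q' + q * s' - (r * p' + s * r'))) *
            (2 * (p * p' + q * r' + (r * q' + s * s'))) := by ring
        _ = (p + s) ^ 2 * ((q' - r') * (p' + s')) + (p' + s') ^ 2 * ((q - r) * (p + s)) := by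
          rw [k1, k2]; ring
        _ = _ := by simp only [*]; ring
    linarith
  · intro g hg
    have h1 := hdisc g
    obtain ⟨e1, e2, e3⟩ := aux_comm M g.1 (hcm g)
    beta_reduce at hg
    have hg' : (g.1.1 0 1 - g.1.1 1 0) * (g.1.1 0 0 + g.1.1 1 1) = 0 := by exact_mod_cast hg
    have h2 : g.1.1 0 1 - g.1.1 1 0 = 0 := by
      rcases mul_eq_zero.1 hg' with h | h
      · exact h
      · rw [h] at h1; norm_num at h1
    have h3 : g.1.1 0 1 = g.1.1 1 0 := by linarith
    have h4 : g.1.1 1 0 = 0 := by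
      rw [h3] at e1
      have : (M.1 0 1 - M.1 1 0) * g.1.1 1 0 = 0 := by linarith
      exact (mul_eq_zero.1 this).resolve_left hbc
    have h5 : (M.1 0 1 - M.1 1 0) * (g.1.1 0 0 - g.1.1 1 1) = 0 := by
      rw [h4] at e3; rw [h3, h4] at e2; linarith
    exact aux_scalar _ (h3.trans h4) h4 (by
      have := (mul_eq_zero.1 h5).resolve_left hbc; linarith)
  · intro g hg
    beta_reduce at hg ⊢
    exact_mod_cast hg

theorem aux_gap (x y : ℝ) (T : ℤ) (hxy : x * y = 1 ∨ x * y = -1) (hT : x + y = T)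
    (h1 : 1 < |x|) : 6 / 5 ≤ |x| := by
  by_contra h2
  push Not at h2
  have hX : x ^ 2 = |x| ^ 2 := (sq_abs x).symm
  have hX1 : 1 < x ^ 2 := by rw [hX]; nlinarith
  have hX2 : x ^ 2 < 3 / 2 := by rw [hX]; nlinarith
  have hXY : x ^ 2 * y ^ 2 = 1 := by
    rw [← mul_pow]; rcases hxy with h | h <;> rw [h] <;> norm_num
  have hT2 : ((T ^ 2 : ℤ) : ℝ) = x ^ 2 + y ^ 2 + 2 * (x * y) := by
    push_cast; rw [← hT]; ring
  have hs1 : 2 < x ^ 2 + y ^ 2 := by nlinarith [sq_nonneg (x ^ 2 - 1)]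
  have hs2 : x ^ 2 + y ^ 2 < 3 := by nlinarith [sq_nonneg (x ^ 2 - 1), sq_nonneg y]
  rcases hxy with h | h <;> rw [h] at hT2
  · have a1 : ((4 : ℤ) : ℝ) < ((T ^ 2 : ℤ) : ℝ) := by rw [hT2]; push_cast; linarith
    have a2 : ((T ^ 2 : ℤ) : ℝ) < ((5 : ℤ) : ℝ) := by rw [hT2]; push_cast; linarith
    rw [Int.cast_lt] at a1 a2
    omega
  · have a1 : ((0 : ℤ) : ℝ) < ((T ^ 2 : ℤ) : ℝ) := by rw [hT2]; push_cast; linarith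
    have a2 : ((T ^ 2 : ℤ) : ℝ) < ((1 : ℤ) : ℝ) := by rw [hT2]; push_cast; linarith
    rw [Int.cast_lt] at a1 a2
    omega

theorem aux_hyp (M : GL (Fin 2) ℤ)
    (hM : ¬ (M.1 0 0 + M.1 1 1 = 0 ∧ M.1 0 0 * M.1 1 1 - M.1 0 1 * M.1 1 0 = -1))
    (hD : 0 < (M.1 0 0 + M.1 1 1) ^ 2 - 4 * (M.1 0 0 * M.1 1 1 - M.1 0 1 * M.1 1 0)) :
    ∃ f : Subgroup.centralizer ({M} : Set (GL (Fin 2) ℤ)) → ℝ,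
      (∀ g h, f (g * h) = f g + f h) ∧ (∀ g, f g = 0 → g.1 = 1 ∨ g.1 = -1) ∧
      ∃ ε > 0, ∀ g, 0 < f g → ε ≤ f g := by
  have hcm : ∀ g : Subgroup.centralizer ({M} : Set (GL (Fin 2) ℤ)), g.1 * M = M * g.1 := fun g =>
    (Subgroup.mem_centralizer_iff.1 g.2 M rfl).symm
  have hc := fun g => aux_comm M _ (hcm g)
  have hdM := aux_det M
  generalize M.1 0 0 = a at *
  generalize M.1 0 1 = b at *
  generalize M.1 1 0 = c at *
  generalize M.1 1 1 = d at *
  have hns : ∀ k : ℤ, (a + d) ^ 2 - 4 * (a * d - b * c) ≠ k ^ 2 := by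
    intro k hk
    rcases hdM with h | h
    · have := aux_sq (a + d) k (by rw [h] at hk; linarith)
      subst this
      rw [hk] at hD; norm_num at hD
    · exact hM ⟨aux_sq k (a + d) (by rw [h] at hk; linarith), h⟩
  have hb : b ≠ 0 := by
    rintro rfl
    exact hns (a - d) (by ring)
  have hbR : (b : ℝ) ≠ 0 := by exact_mod_cast hb
  obtain ⟨w, hw0, hw⟩ : ∃ w : ℝ, 0 < w ∧ w ^ 2 = (a + d) ^ 2 - 4 * (a * d - b * c) := by
    have : (0 : ℝ) < (a + d) ^ 2 - 4 * (a * d - b * c) := by exact_mod_cast hD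
    exact ⟨_, Real.sqrt_pos.2 this, Real.sq_sqrt this.le⟩
  obtain ⟨β, hβ⟩ : ∃ β : ℝ, β * (2 * b) = d - a + w := ⟨(d - a + w) / (2 * b), by field_simp⟩
  obtain ⟨β', hβ'⟩ : ∃ β : ℝ, β * (2 * b) = d - a - w := ⟨(d - a - w) / (2 * b), by field_simp⟩
  have hsum : b * (β + β') = d - a := by linarith
  have hprod : b * (β * β') = -c := by
    have : (4 * b : ℝ) * (b * (β * β')) = (4 * b) * (-c) := by
      calc _ = (β * (2 * b)) * (β' * (2 * b)) := by ring
        _ = (d - a) ^ 2 - w ^ 2 := by rw [hβ, hβ']; ring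
        _ = _ := by rw [hw]; ring
    exact mul_left_cancel₀ (by simpa using hb) this
  have hne : β - β' ≠ 0 := by
    intro h
    have : (β - β') * (2 * b) = 2 * w := by linarith
    rw [h] at this
    linarith
  have hβ2 : b * β ^ 2 = c + (d - a) * β := by
    calc (b * β ^ 2 : ℝ) = (b * (β + β')) * β - b * (β * β') := by ring
      _ = _ := by rw [hsum, hprod]; ring
  have htr : ∀ g : Subgroup.centralizer ({M} : Set (GL (Fin 2) ℤ)),
      (g.1.1 0 0 + g.1.1 0 1 * β) + (g.1.1 0 0 + g.1.1 0 1 * β') =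
        ((g.1.1 0 0 + g.1.1 1 1 : ℤ) : ℝ) := by
    intro g
    obtain ⟨e1, e2, e3⟩ := hc g
    have e2R : (b : ℝ) * (g.1.1 0 0 - g.1.1 1 1) = g.1.1 0 1 * (a - d) := by exact_mod_cast e2
    apply mul_left_cancel₀ hbR
    push_cast
    linear_combination (g.1.1 0 1 : ℝ) * hsum + e2R
  have hdt : ∀ g : Subgroup.centralizer ({M} : Set (GL (Fin 2) ℤ)),
      (g.1.1 0 0 + g.1.1 0 1 * β) * (g.1.1 0 0 + g.1.1 0 1 * β') =
        ((g.1.1 0 0 * g.1.1 1 1 - g.1.1 0 1 * g.1.1 1 0 : ℤ) : ℝ) := by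
    intro g
    obtain ⟨e1, e2, e3⟩ := hc g
    have e2R : (b : ℝ) * (g.1.1 0 0 - g.1.1 1 1) = g.1.1 0 1 * (a - d) := by exact_mod_cast e2
    have e1R : (g.1.1 0 1 : ℝ) * c = b * g.1.1 1 0 := by exact_mod_cast e1
    apply mul_left_cancel₀ hbR
    push_cast
    linear_combination (g.1.1 0 1 : ℝ) * g.1.1 0 0 * hsum + (g.1.1 0 1 : ℝ) ^ 2 * hprod
      + (g.1.1 0 0 : ℝ) * e2R - (g.1.1 0 1 : ℝ) * e1R
  have hpm : ∀ g : Subgroup.centralizer ({M} : Set (GL (Fin 2) ℤ)),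
      (g.1.1 0 0 + g.1.1 0 1 * β) * (g.1.1 0 0 + g.1.1 0 1 * β') = 1 ∨
      (g.1.1 0 0 + g.1.1 0 1 * β) * (g.1.1 0 0 + g.1.1 0 1 * β') = -1 := by
    intro g
    rw [hdt g]
    rcases aux_det g.1 with h | h <;> rw [h] <;> simp
  have hnz : ∀ g : Subgroup.centralizer ({M} : Set (GL (Fin 2) ℤ)),
      (g.1.1 0 0 + g.1.1 0 1 * β) ≠ 0 := by
    intro g h
    have := hpm g
    rw [h] at this
    norm_num at this
  refine ⟨fun g => Real.log |g.1.1 0 0 + g.1.1 0 1 * β|, ?_, ?_, Real.log (6 / 5),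
    Real.log_pos (by norm_num), ?_⟩
  · intro g h
    simp only
    rw [← Real.log_mul (abs_ne_zero.2 (hnz g)) (abs_ne_zero.2 (hnz h)), ← abs_mul]
    congr 2
    have m00 : (g * h).1.1 0 0 = _ := aux_mul g.1 h.1 0 0
    have m01 : (g * h).1.1 0 1 = _ := aux_mul g.1 h.1 0 1
    rw [m00, m01]
    obtain ⟨e1, e2, e3⟩ := hc h
    have e2R : (b : ℝ) * (h.1.1 0 0 - h.1.1 1 1) = h.1.1 0 1 * (a - d) := by exact_mod_cast e2
    have e1R : (h.1.1 0 1 : ℝ) * c = b * h.1.1 1 0 := by exact_mod_cast e1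
    apply mul_left_cancel₀ hbR
    push_cast
    linear_combination -(g.1.1 0 1 : ℝ) * h.1.1 0 1 * hβ2 - (g.1.1 0 1 : ℝ) * β * e2R
      - (g.1.1 0 1 : ℝ) * e1R
  · intro g hg
    simp only at hg
    have h1 : |(g.1.1 0 0 : ℝ) + g.1.1 0 1 * β| = 1 :=
      Real.eq_one_of_pos_of_log_eq_zero (abs_pos.2 (hnz g)) hg
    obtain ⟨e1, e2, e3⟩ := hc g
    have h2 : ((g.1.1 0 0 : ℝ) + g.1.1 0 1 * β) ^ 2 = 1 := by rw [← sq_abs, h1]; norm_num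
    have hT := htr g
    have hDt := hdt g
    rcases aux_det g.1 with hd | hd
    · have h3 : (g.1.1 0 1 : ℝ) * (β - β') = 0 := by
        rw [hd] at hDt
        have : ((g.1.1 0 0 : ℝ) + g.1.1 0 1 * β) * (g.1.1 0 1 * (β - β')) = 0 := by
          push_cast at hDt
          linear_combination h2 - hDt
        exact (mul_eq_zero.1 this).resolve_left (hnz g)
      have h4 : g.1.1 0 1 = 0 := by exact_mod_cast (mul_eq_zero.1 h3).resolve_right hne
      rw [h4] at e1 e2
      exact aux_scalar _ h4 (by
        have : b * g.1.1 1 0 = 0 := by linarith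
        exact (mul_eq_zero.1 this).resolve_left hb) (by
        have : b * (g.1.1 0 0 - g.1.1 1 1) = 0 := by linarith
        have := (mul_eq_zero.1 this).resolve_left hb
        linarith)
    · exfalso
      have h3 : ((g.1.1 0 0 + g.1.1 1 1 : ℤ) : ℝ) = 0 := by
        rw [hd] at hDt
        rw [← hT]
        have : ((g.1.1 0 0 : ℝ) + g.1.1 0 1 * β) *
          ((g.1.1 0 0 + g.1.1 0 1 * β) + (g.1.1 0 0 + g.1.1 0 1 * β')) = 0 := by
          push_cast at hDt
          linear_combination h2 + hDt
        exact (mul_eq_zero.1 this).resolve_left (hnz g)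
      have h4 : g.1.1 0 0 + g.1.1 1 1 = 0 := by exact_mod_cast h3
      generalize g.1.1 0 0 = p at *
      generalize g.1.1 0 1 = q at *
      generalize g.1.1 1 0 = r at *
      generalize g.1.1 1 1 = s at *
      obtain rfl : s = -p := by linarith
      have h5 : (2 * b) ^ 2 = q ^ 2 * ((a + d) ^ 2 - 4 * (a * d - b * c)) := by
        linear_combination (4 * b ^ 2) * hd + (b * 2 * p + q * (a - d)) * e2 - 4 * b * q * e1
      have h6 : q ∣ 2 * b := (Int.pow_dvd_pow_iff two_ne_zero).1 ⟨_, h5⟩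
      obtain ⟨k, hk⟩ := h6
      have hq : q ≠ 0 := by rintro rfl; simp at hk; exact hb hk
      apply hns k
      rw [hk, mul_pow] at h5
      exact (mul_left_cancel₀ (pow_ne_zero 2 hq) h5).symm
  · intro g hg
    simp only at hg ⊢
    have h1 : 1 < |(g.1.1 0 0 : ℝ) + g.1.1 0 1 * β| := by
      rwa [Real.log_pos_iff (abs_nonneg _)] at hg
    exact Real.log_le_log (by norm_num) (aux_gap _ _ _ (hpm g) (htr g) h1)

/-- For `M ∈ GL(2,ℤ)` of infinite order, the centraliser of `M` in `GL(2,ℤ)`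
is isomorphic to `C₂ × ℤ`, with the `C₂` factor generated by `-I`. -/
theorem stmt7 (M : GL (Fin 2) ℤ) (hM : ∀ n : ℤ, n ≠ 0 → M ^ n ≠ 1) :
    ∃ φ : Subgroup.centralizer ({M} : Set (GL (Fin 2) ℤ)) ≃*
        Multiplicative (ZMod 2) × Multiplicative ℤ,
      φ ⟨-1, Subgroup.mem_centralizer_iff.mpr fun g _ => (Commute.neg_one_right g).eq⟩ =
        (Multiplicative.ofAdd (1 : ZMod 2), 1) := by
  obtain ⟨hD, hne⟩ := aux_elliptic M hM
  have hpm : ¬ (M = 1 ∨ M = -1) := by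
    rintro (h | h)
    · exact hM 1 one_ne_zero (by rw [h]; simp)
    · exact hM 2 two_ne_zero (by rw [h]; exact Even.neg_one_zpow (by decide))
  obtain ⟨f, hf, hker, ε, hε, hgap⟩ : ∃ f : Subgroup.centralizer ({M} : Set (GL (Fin 2) ℤ)) → ℝ,
      (∀ g h, f (g * h) = f g + f h) ∧ (∀ g, f g = 0 → g.1 = 1 ∨ g.1 = -1) ∧
      ∃ ε > 0, ∀ g, 0 < f g → ε ≤ f g := by
    rcases hD.eq_or_lt with h | h
    · exact aux_par M hpm h.symm
    · exact aux_hyp M hne h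
  generalize hz : (⟨-1, Subgroup.mem_centralizer_iff.mpr fun g _ =>
    (Commute.neg_one_right g).eq⟩ : Subgroup.centralizer ({M} : Set (GL (Fin 2) ℤ))) = z
  have hz1 : z.1 = -1 := by rw [← hz]
  obtain ⟨c, hc⟩ := aux_gen z f hf (fun g hg => by
    rcases hker g hg with h | h
    · left; exact Subtype.ext h
    · right; exact Subtype.ext (h.trans hz1.symm)) ε hε hgap
  have hzz : z * z = 1 := Subtype.ext (by rw [Subgroup.coe_mul, hz1]; simp)
  have hzc : ∀ g, z * g = g * z := fun g =>
    Subtype.ext (by rw [Subgroup.coe_mul, Subgroup.coe_mul, hz1]; simp)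
  have hinf : ∀ n : ℤ, n ≠ 0 → c ^ n ≠ 1 := by
    intro n hn h
    let m : Subgroup.centralizer ({M} : Set (GL (Fin 2) ℤ)) :=
      ⟨M, Subgroup.mem_centralizer_iff.mpr fun g hg => by rw [Set.mem_singleton_iff.1 hg]⟩
    have hm : m ^ (2 * n) = 1 := by
      obtain ⟨k, hk | hk⟩ := hc m
      · rw [hk, ← zpow_mul, show k * (2 * n) = n * (2 * k) by ring, zpow_mul, h, one_zpow]
      · rw [hk, Commute.mul_zpow (hzc _), ← zpow_mul, show k * (2 * n) = n * (2 * k) by ring,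
          zpow_mul c, h, one_zpow, zpow_mul z, show (2 : ℤ) = 1 + 1 from rfl, zpow_add, zpow_one,
          hzz, one_zpow, one_mul]
    exact hM (2 * n) (by omega) (congrArg Subtype.val hm)
  refine aux_iso z c hzz ?_ hzc hc fun n hn => ⟨hinf n hn, fun h => ?_⟩
  · intro h
    have h1 : (-1 : GL (Fin 2) ℤ) = 1 := by rw [← hz1, h]; rfl
    have h0 : (-1 : Matrix (Fin 2) (Fin 2) ℤ) = 1 := congrArg Units.val h1
    have h2 : (-1 : Matrix (Fin 2) (Fin 2) ℤ) 0 0 = (1 : Matrix (Fin 2) (Fin 2) ℤ) 0 0 := by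
      rw [h0]
    rw [Matrix.neg_apply, Matrix.one_apply_eq] at h2
    norm_num at h2
  · apply hinf (n + n) (by omega)
    rw [zpow_add, h, hzz]
end

section
/- Let M ∈ GL(d,ℤ) have characteristic polynomial P(x) that is irreducible over ℚ, and write d = n₁ + 2n₂ where n₁ is the number of real roots of P and n₂ is the number of pairs of complex conjugate non-real roots of P. Then the centraliser S(M) = {G ∈ GL(d,ℤ) : GM = MG} is isomorphic as a group to T′ × ℤ^(n₁+n₂−1) for some finite cyclic group T′. -/
open NumberField Polynomial

theorem aux_struct {S U T : Type*} [Group S] [CommGroup U] [Group T] [Finite T] [IsCyclic T]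
    (r : ℕ) (ψ : S →* U) (hψ : Function.Injective ψ)
    (f : Additive U →+ (Fin r → ℤ)) (hf : Function.Surjective f)
    (i : T →* U) (hT : ∀ u : U, f (Additive.ofMul u) = 0 → ∃ t, i t = u)
    (hi : Function.Injective i)
    (m : ℕ) (hm : 0 < m) (hmr : ∀ u : U, u ^ m ∈ ψ.range) :
    ∃ k : ℕ, 0 < k ∧ Nonempty (S ≃* Multiplicative (ZMod k) × Multiplicative (Fin r → ℤ)) := by
  let L := Additive ψ.range
  let g : L →ₗ[ℤ] (Fin r → ℤ) := (f.comp (MonoidHom.toAdditive ψ.range.subtype)).toIntLinearMap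
  have hg : ∀ h : ψ.range, g (Additive.ofMul h) = f (Additive.ofMul (h : U)) := fun h => rfl
  -- full rank
  have hmem : ∀ v : Fin r → ℤ, (m : ℤ) • v ∈ LinearMap.range g := by
    intro v
    obtain ⟨u, rfl⟩ := hf v
    refine ⟨Additive.ofMul ⟨u.toMul ^ m, hmr _⟩, ?_⟩
    rw [hg]
    simp
  let j : (Fin r → ℤ) →ₗ[ℤ] LinearMap.range g :=
    LinearMap.codRestrict _ ((m : ℤ) • LinearMap.id) hmem
  have hj : Function.Injective j := by
    intro a b hab
    have : (m : ℤ) • a = (m : ℤ) • b := congrArg Subtype.val hab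
    exact smul_right_injective _ (by exact_mod_cast hm.ne') this
  have hrank : Module.finrank ℤ (LinearMap.range g) = r := by
    apply le_antisymm
    · simpa using Submodule.finrank_le (LinearMap.range g)
    · simpa using LinearMap.finrank_le_finrank_of_injective hj
  let e : LinearMap.range g ≃ₗ[ℤ] (Fin r → ℤ) := LinearEquiv.ofFinrankEq _ _ (by simpa using hrank)
  let p : L →ₗ[ℤ] (Fin r → ℤ) := e.toLinearMap ∘ₗ g.rangeRestrict
  have hp : LinearMap.range p = ⊤ := by
    rw [LinearMap.range_eq_top]
    exact e.surjective.comp g.surjective_rangeRestrict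
  have hpk : ∀ x, p x = 0 → g x = 0 := by
    intro x hx
    have : g.rangeRestrict x = 0 := by simpa [p] using hx
    exact congrArg Subtype.val this
  obtain ⟨s, hs⟩ := Module.projective_lifting_property p LinearMap.id (LinearMap.range_eq_top.1 hp)
  have hs' : ∀ v, p (s v) = v := fun v => LinearMap.congr_fun hs v
  -- kernel
  let N := LinearMap.ker p
  have hker : ∀ n : N, ∃ t : T, i t = ((Additive.toMul (n : L) : ψ.range) : U) := fun n =>
    hT _ (hpk _ n.2)
  choose c hc using hker
  let cc : Multiplicative N →* T := MonoidHom.mk' (fun n => c n.toAdd) (by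
    intro a b
    apply hi
    rw [map_mul i, hc, hc, hc]
    rfl)
  have hcc : Function.Injective cc := by
    intro a b hab
    have h1 : i (c a.toAdd) = i (c b.toAdd) := congrArg i hab
    rw [hc, hc] at h1
    exact Multiplicative.toAdd.injective (Subtype.ext (Additive.toMul.injective (Subtype.ext h1)))
  have : IsCyclic (Multiplicative N) := isCyclic_of_injective cc hcc
  have : Finite (Multiplicative N) := Finite.of_injective cc hcc
  refine ⟨Nat.card (Multiplicative N), Nat.card_pos, ⟨?_⟩⟩
  let E : L ≃+ N × (Fin r → ℤ) :=
    { toFun := fun x => (⟨x - s (p x), by simp [N, hs']⟩, p x)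
      invFun := fun y => y.1 + s y.2
      left_inv := fun x => by simp
      right_inv := fun y => by
        have : p (y.1 : L) = 0 := y.1.2
        ext1
        · apply Subtype.ext; simp [hs', this]
        · simp [hs', this]
      map_add' := fun x y => by
        ext1
        · apply Subtype.ext; simp; abel
        · simp }
  exact (MonoidHom.ofInjective hψ).trans <|
    (AddEquiv.toMultiplicative E : Multiplicative L ≃* _).trans <|
    (MulEquiv.prodMultiplicative _ _).trans <|
    MulEquiv.prodCongr (zmodCyclicMulEquiv inferInstance).symm (MulEquiv.refl _)

theorem aux_real (K : Type*) [Field K] [NumberField K] :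
    InfinitePlace.nrRealPlaces K = Nat.card (K →+* ℝ) := by
  rw [InfinitePlace.nrRealPlaces, Fintype.card_eq_nat_card, ← Nat.card_congr InfinitePlace.mkReal]
  refine Nat.card_congr ?_
  refine Equiv.ofBijective (fun φ => ComplexEmbedding.IsReal.embedding φ.2) ⟨?_, ?_⟩
  · intro a b hab
    apply Subtype.ext
    ext x
    have := DFunLike.congr_fun hab x
    rw [← ComplexEmbedding.IsReal.coe_embedding_apply a.2, ← ComplexEmbedding.IsReal.coe_embedding_apply b.2]
    exact congrArg _ this
  · intro φ
    refine ⟨⟨Complex.ofRealHom.comp φ, ?_⟩, ?_⟩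
    · rw [ComplexEmbedding.isReal_iff]
      ext x
      simp [ComplexEmbedding.conjugate]
    · ext x
      rfl

theorem aux_centr {K : Type*} [Field K] [NumberField K] {d : ℕ} (hd : 0 < d)
    (hK : Module.finrank ℚ K = d)
    (φ : K →ₐ[ℚ] Matrix (Fin d) (Fin d) ℚ) (G : Matrix (Fin d) (Fin d) ℚ)
    (hG : ∀ x, G * φ x = φ x * G) : ∃ x, φ x = G := by
  have : NeZero d := ⟨hd.ne'⟩
  let v : Fin d → ℚ := Pi.single 0 1
  have hv : v ≠ 0 := by simp [v]
  let l : K →ₗ[ℚ] (Fin d → ℚ) :=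
    { toFun := fun x => Matrix.mulVec (φ x) v
      map_add' := fun x y => by simp [Matrix.add_mulVec]
      map_smul' := fun q x => by simp [Matrix.smul_mulVec] }
  have hl : ∀ x, l x = Matrix.mulVec (φ x) v := fun _ => rfl
  have hinj : Function.Injective l := by
    rw [injective_iff_map_eq_zero]
    intro x hx
    by_contra h
    apply hv
    have : Matrix.mulVec (φ x⁻¹) (l x) = v := by
      rw [hl, Matrix.mulVec_mulVec, ← map_mul, inv_mul_cancel₀ h, map_one, Matrix.one_mulVec]
    rw [← this, hx, Matrix.mulVec_zero]
  have hsurj : Function.Surjective l :=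
    (LinearMap.injective_iff_surjective_of_finrank_eq_finrank (by simpa using hK)).1 hinj
  obtain ⟨x, hx⟩ := hsurj (Matrix.mulVec G v)
  refine ⟨x, ?_⟩
  apply Matrix.toLin'.injective
  ext1 w
  ext1
  simp only [LinearMap.comp_apply, Matrix.toLin'_apply]
  obtain ⟨y, hy⟩ := hsurj (LinearMap.single ℚ (fun _ => ℚ) w 1)
  rw [← hy, hl, Matrix.mulVec_mulVec, Matrix.mulVec_mulVec, hG, ← map_mul, mul_comm, map_mul,
    ← Matrix.mulVec_mulVec, ← Matrix.mulVec_mulVec, ← hl x, hx]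

theorem aux_denom {K : Type*} [Field K] [NumberField K] {d : ℕ}
    (φ : K →ₐ[ℚ] Matrix (Fin d) (Fin d) ℚ) : ∃ N : ℕ, 0 < N ∧ ∀ y : 𝓞 K,
      ∃ B : Matrix (Fin d) (Fin d) ℤ, φ ((N : K) * (y : K)) = (Int.castRingHom ℚ).mapMatrix B := by
  let b := RingOfIntegers.basis K
  obtain ⟨z, hz⟩ := IsLocalization.exist_integer_multiples_of_finite (nonZeroDivisors ℤ)
    (fun t : (Module.Free.ChooseBasisIndex ℤ (𝓞 K)) × Fin d × Fin d =>
      φ (b t.1 : K) t.2.1 t.2.2)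
  have hz0 : (z : ℤ) ≠ 0 := nonZeroDivisors.coe_ne_zero z
  choose B hB using hz
  refine ⟨(z : ℤ).natAbs, Int.natAbs_pos.2 hz0, fun y => ?_⟩
  have key : ∃ C : Matrix (Fin d) (Fin d) ℤ, φ ((z : ℤ) * (y : K)) = (Int.castRingHom ℚ).mapMatrix C := by
    refine ⟨∑ i, b.repr y i • Matrix.of (fun p q => B (i, p, q)), ?_⟩
    conv_lhs => rw [← b.sum_repr y]
    change φ (((z : ℤ) : K) * algebraMap (𝓞 K) K (∑ i, b.repr y i • b i)) = _
    rw [map_sum (algebraMap (𝓞 K) K), map_sum (Int.castRingHom ℚ).mapMatrix, Finset.mul_sum, map_sum]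
    refine Finset.sum_congr rfl fun i _ => ?_
    rw [map_zsmul (algebraMap (𝓞 K) K), map_zsmul (Int.castRingHom ℚ).mapMatrix, mul_smul_comm, map_zsmul φ]
    congr 1
    ext p q
    have := hB (i, p, q)
    simp at this
    simp [this, ← zsmul_eq_mul]
  obtain ⟨C, hC⟩ := key
  rcases Int.natAbs_eq (z : ℤ) with h | h
  · refine ⟨C, ?_⟩
    rw [← hC, ← Int.cast_natCast, ← h]
  · refine ⟨-C, ?_⟩
    rw [map_neg, ← hC, ← Int.cast_natCast, eq_neg_iff_add_eq_zero.2 (neg_eq_iff_add_eq_zero.1 h.symm), ← map_neg]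
    simp

theorem aux_int {K : Type*} [Field K] [NumberField K] {d : ℕ} (hd : 0 < d)
    (φ : K →ₐ[ℚ] Matrix (Fin d) (Fin d) ℚ) (x : K) (G : Matrix (Fin d) (Fin d) ℤ)
    (h : φ x = (Int.castRingHom ℚ).mapMatrix G) : IsIntegral ℤ x := by
  have : NeZero d := ⟨hd.ne'⟩
  have hφ : Function.Injective φ := φ.toRingHom.injective
  rw [← isIntegral_algHom_iff (φ.toRingHom.toIntAlgHom) hφ]
  change IsIntegral ℤ (φ x)
  rw [h]
  exact (Matrix.isIntegral G).map ((Int.castRingHom ℚ).mapMatrix.toIntAlgHom)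

theorem aux_unitpow (K : Type*) [Field K] [NumberField K] (N : ℕ) (hN : 0 < N) :
    ∃ m : ℕ, 0 < m ∧ ∀ u : (𝓞 K)ˣ, ∃ y : 𝓞 K, ((u ^ m : (𝓞 K)ˣ) : 𝓞 K) = 1 + N * y := by
  let I : Ideal (𝓞 K) := Ideal.span {(N : 𝓞 K)}
  have hI : I ≠ ⊥ := by
    simp only [I, ne_eq, Ideal.span_singleton_eq_bot]
    exact_mod_cast hN.ne'
  have : Finite (𝓞 K ⧸ I) := I.finiteQuotientOfFreeOfNeBot hI
  refine ⟨Nat.card (𝓞 K ⧸ I)ˣ, Nat.card_pos, fun u => ?_⟩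
  have h := pow_card_eq_one' (x := Units.map (Ideal.Quotient.mk I).toMonoidHom u)
  rw [← map_pow] at h
  have h2 : Ideal.Quotient.mk I ((u ^ Nat.card (𝓞 K ⧸ I)ˣ : (𝓞 K)ˣ) : 𝓞 K) = Ideal.Quotient.mk I 1 := by
    rw [map_one]
    exact congrArg Units.val h
  rw [Ideal.Quotient.eq, Ideal.mem_span_singleton'] at h2
  obtain ⟨y, hy⟩ := h2
  exact ⟨y, by rw [mul_comm, hy]; ring⟩

theorem aux_f {U : Type*} [CommGroup U] (H : Subgroup U) (r : ℕ)
    (b : Module.Basis (Fin r) ℤ (Additive (U ⧸ H))) :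
    ∃ f : Additive U →+ (Fin r → ℤ), Function.Surjective f ∧
      ∀ u : U, f (Additive.ofMul u) = 0 → u ∈ H := by
  let q : Additive U →+ Additive (U ⧸ H) := MonoidHom.toAdditive (QuotientGroup.mk' H)
  have hq : Function.Surjective q := QuotientGroup.mk'_surjective H
  refine ⟨(b.equivFun.toAddEquiv.toAddMonoidHom).comp q, b.equivFun.surjective.comp hq, ?_⟩
  intro u hu
  have h0 : q (Additive.ofMul u) = 0 := b.equivFun.injective (hu.trans (map_zero _).symm)
  have h1 : (QuotientGroup.mk u : U ⧸ H) = 1 := h0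
  exact (QuotientGroup.eq_one_iff u).1 h1

theorem aux_main {K : Type*} [Field K] [NumberField K] {d : ℕ} (hd : 0 < d)
    (hK : Module.finrank ℚ K = d)
    (φ : K →ₐ[ℚ] Matrix (Fin d) (Fin d) ℚ) (M : GL (Fin d) ℤ)
    (hM : ∀ G : Matrix (Fin d) (Fin d) ℚ,
      Commute G ((Int.castRingHom ℚ).mapMatrix (M : Matrix (Fin d) (Fin d) ℤ)) ↔
        ∀ x, G * φ x = φ x * G) :
    ∃ k : ℕ, 0 < k ∧
      Nonempty (Subgroup.centralizer ({M} : Set (GL (Fin d) ℤ)) ≃*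
        Multiplicative (ZMod k) × Multiplicative (Fin (Units.rank K) → ℤ)) := by
  have : NeZero d := ⟨hd.ne'⟩
  have hφ : Function.Injective φ := φ.toRingHom.injective
  let ι : Matrix (Fin d) (Fin d) ℤ →+* Matrix (Fin d) (Fin d) ℚ := (Int.castRingHom ℚ).mapMatrix
  have hι : Function.Injective ι := by
    intro A B hAB
    ext p q
    have := congrFun (congrFun hAB p) q
    simpa [ι] using this
  have hx : ∀ G : Subgroup.centralizer ({M} : Set (GL (Fin d) ℤ)),
      ∃ x : 𝓞 K, φ (x : K) = ι ((G : GL (Fin d) ℤ) : Matrix (Fin d) (Fin d) ℤ) := by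
    intro G
    have hG := Subgroup.mem_centralizer_singleton_iff.1 G.2
    have hG' : Commute (ι ((G : GL (Fin d) ℤ) : Matrix (Fin d) (Fin d) ℤ)) (ι M) := by
      rw [Commute, SemiconjBy, ← map_mul, ← map_mul]
      exact congrArg ι (congrArg Units.val hG)
    obtain ⟨x, hx⟩ := aux_centr hd hK φ _ ((hM _).1 hG')
    exact ⟨⟨x, aux_int hd φ x _ hx⟩, hx⟩
  choose c hc using hx
  have cmul : ∀ G H, c (G * H) = c G * c H := by
    intro G H
    apply RingOfIntegers.coe_injective
    apply hφ
    rw [map_mul (algebraMap (𝓞 K) K), map_mul φ, hc, hc, hc]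
    simp
  have cone : c 1 = 1 := by
    apply RingOfIntegers.coe_injective
    apply hφ
    rw [hc, map_one (algebraMap (𝓞 K) K), map_one φ]
    simp
  let c' : Subgroup.centralizer ({M} : Set (GL (Fin d) ℤ)) →* 𝓞 K :=
    { toFun := c, map_one' := cone, map_mul' := cmul }
  let ψ := c'.toHomUnits
  have hψv : ∀ G, ((ψ G : (𝓞 K)ˣ) : 𝓞 K) = c G := fun G => rfl
  have hψ : Function.Injective ψ := by
    intro G H h
    have h1 : c G = c H := by rw [← hψv, ← hψv, h]
    have h2 := hc G
    rw [h1, hc H] at h2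
    exact (Subtype.ext (Units.ext (hι h2))).symm
  obtain ⟨N, hN, hNy⟩ := aux_denom φ
  obtain ⟨m, hm, hmu⟩ := aux_unitpow K N hN
  have hB : ∀ u : (𝓞 K)ˣ, ∃ B, φ (((u ^ m : (𝓞 K)ˣ) : 𝓞 K) : K) = ι B := by
    intro u
    obtain ⟨y, hy⟩ := hmu u
    obtain ⟨B, hB⟩ := hNy y
    refine ⟨1 + B, ?_⟩
    rw [hy, map_add ι, map_one ι, ← hB]
    simp
  have hrange : ∀ u : (𝓞 K)ˣ, u ^ m ∈ ψ.range := by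
    intro u
    obtain ⟨B, hBu⟩ := hB u
    obtain ⟨C, hCu⟩ := hB u⁻¹
    have h1 : B * C = 1 := by
      apply hι
      rw [map_mul, ← hBu, ← hCu, ← map_mul φ, ← map_mul (algebraMap (𝓞 K) K), ← Units.val_mul,
        ← mul_pow, mul_inv_cancel]
      simp
    have h2 : C * B = 1 := mul_eq_one_comm.1 h1
    have hcomm : (⟨B, C, h1, h2⟩ : GL (Fin d) ℤ) ∈ Subgroup.centralizer ({M} : Set (GL (Fin d) ℤ)) := by
      rw [Subgroup.mem_centralizer_singleton_iff]
      apply Units.ext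
      apply hι
      have := (hM (ι B)).2 (fun x => by rw [← hBu, ← map_mul, ← map_mul, mul_comm])
      rw [Units.val_mul, Units.val_mul, map_mul ι, map_mul ι]
      exact this.eq
    refine ⟨⟨_, hcomm⟩, ?_⟩
    apply Units.ext
    rw [hψv]
    apply RingOfIntegers.coe_injective
    apply hφ
    rw [hc, hBu]
  obtain ⟨f, hf, hf0⟩ := aux_f (Units.torsion K) _ (Units.basisModTorsion K)
  exact aux_struct _ ψ hψ f hf (Units.torsion K).subtype (fun u hu => ⟨⟨u, hf0 u hu⟩, rfl⟩)
    (Units.torsion K).subtype_injective m hm hrange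

/-- If `M ∈ GL(d,ℤ)` has characteristic polynomial `P` irreducible over `ℚ`,
with `n₁` real roots and `n₂` pairs of complex conjugate roots
(`d = n₁ + 2 n₂`), then the centraliser of `M` in `GL(d,ℤ)` is isomorphic to
`T' × ℤ^(n₁+n₂-1)` for some finite cyclic group `T'` (realised as `ZMod k`,
`k > 0`). -/
theorem stmt8 {d : ℕ} (M : GL (Fin d) ℤ)
    (hirr : Irreducible
      (((M : Matrix (Fin d) (Fin d) ℤ).charpoly).map (Int.castRingHom ℚ)))
    (n₁ n₂ : ℕ)
    (hn₁ : (n₁ : ℕ) =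
      Multiset.card (((M : Matrix (Fin d) (Fin d) ℤ).charpoly.map
        (Int.castRingHom ℝ)).roots))
    (hd : d = n₁ + 2 * n₂) :
    ∃ k : ℕ, 0 < k ∧
      Nonempty (Subgroup.centralizer ({M} : Set (GL (Fin d) ℤ)) ≃*
        Multiplicative (ZMod k) × Multiplicative (Fin (n₁ + n₂ - 1) → ℤ)) := by
  have hdeg : (((M : Matrix (Fin d) (Fin d) ℤ).charpoly).map (Int.castRingHom ℚ)).natDegree = d := by
    rw [(Matrix.charpoly_monic _).natDegree_map, Matrix.charpoly_natDegree_eq_dim, Fintype.card_fin]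
  have hmap : ((M : Matrix (Fin d) (Fin d) ℤ).charpoly).map (Int.castRingHom ℝ) =
      (((M : Matrix (Fin d) (Fin d) ℤ).charpoly).map (Int.castRingHom ℚ)).map (algebraMap ℚ ℝ) := by
    rw [Polynomial.map_map]
    congr 1
  rw [hmap] at hn₁
  have hCH : aeval ((Int.castRingHom ℚ).mapMatrix (M : Matrix (Fin d) (Fin d) ℤ))
      (((M : Matrix (Fin d) (Fin d) ℤ).charpoly).map (Int.castRingHom ℚ)) = 0 := by
    rw [RingHom.mapMatrix_apply, ← Matrix.charpoly_map]
    exact Matrix.aeval_self_charpoly _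
  have hmon : (((M : Matrix (Fin d) (Fin d) ℤ).charpoly).map (Int.castRingHom ℚ)).Monic :=
    (Matrix.charpoly_monic _).map _
  generalize ((M : Matrix (Fin d) (Fin d) ℤ).charpoly).map (Int.castRingHom ℚ) = P at *
  have hd0 : 0 < d := hdeg ▸ hirr.natDegree_pos
  have : Fact (Irreducible P) := ⟨hirr⟩
  have : Module.Finite ℚ (AdjoinRoot P) := hmon.finite_adjoinRoot
  have : NumberField (AdjoinRoot P) := { to_charZero := charZero_of_injective_algebraMap (algebraMap ℚ (AdjoinRoot P)).injective, to_finiteDimensional := by convert this }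
  have hK : Module.finrank ℚ (AdjoinRoot P) = d := by
    rw [(AdjoinRoot.powerBasis hirr.ne_zero).finrank, AdjoinRoot.powerBasis_dim, hdeg]
  let φ : AdjoinRoot P →ₐ[ℚ] Matrix (Fin d) (Fin d) ℚ :=
    Ideal.Quotient.liftₐ (Ideal.span {P})
      (aeval ((Int.castRingHom ℚ).mapMatrix (M : Matrix (Fin d) (Fin d) ℤ))) (by
        intro a ha
        obtain ⟨b, rfl⟩ := Ideal.mem_span_singleton'.1 ha
        rw [map_mul, hCH, mul_zero])
  have hφ : ∀ p : ℚ[X], φ (AdjoinRoot.mk P p) =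
      aeval ((Int.castRingHom ℚ).mapMatrix (M : Matrix (Fin d) (Fin d) ℤ)) p := fun p => rfl
  have hr : n₁ + n₂ - 1 = Units.rank (AdjoinRoot P) := by
    have h1 : InfinitePlace.nrRealPlaces (AdjoinRoot P) = n₁ := by
      rw [aux_real, Nat.card_congr (@RingHom.equivRatAlgHom (AdjoinRoot P) ℝ _ _ (AdjoinRoot.instAlgebra P) _),
        Nat.card_congr (AdjoinRoot.equiv ℝ ℚ P hirr.ne_zero), hn₁]
      have hnd : (P.aroots ℝ).Nodup := nodup_roots (hirr.separable.map)
      rw [← aroots_def, ← Multiset.toFinset_card_of_nodup hnd, ← Nat.card_eq_finsetCard]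
      simp only [Multiset.mem_toFinset]
    have h2 := InfinitePlace.card_add_two_mul_card_eq_rank (AdjoinRoot P)
    rw [Units.rank, InfinitePlace.card_eq_nrRealPlaces_add_nrComplexPlaces]
    omega
  rw [hr]
  refine aux_main hd0 hK φ M fun G => ⟨fun h x => ?_, fun h => ?_⟩
  · obtain ⟨p, rfl⟩ := AdjoinRoot.mk_surjective x
    rw [hφ]
    induction p using Polynomial.induction_on' with
    | add p q hp hq => rw [map_add, mul_add, add_mul, hp, hq]
    | monomial n a =>
      rw [aeval_monomial]
      exact (Commute.mul_right (Algebra.commutes a G).symm (h.pow_right n)).eq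
  · have := h (AdjoinRoot.mk P X)
    rw [hφ, aeval_X] at this
    exact this
end

section
/- Let K be a field. The group GA₂(K) of K-algebra automorphisms of the polynomial ring K[x,y] is generated by the affine automorphisms together with the elementary automorphisms; i.e., every K-algebra automorphism of K[x,y] is a finite composition of affine and elementary automorphisms (Jung–van der Kulk theorem). -/
open MvPolynomial

/-- An affine automorphism of `K[x,y]`: it sends `x, y` to linear-plus-constant
polynomials, with invertible linear part. -/
def IsAffineAut (K : Type*) [Field K]
    (σ : MvPolynomial (Fin 2) K ≃ₐ[K] MvPolynomial (Fin 2) K) : Prop :=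
  ∃ a b c d e f : K, a * e - b * d ≠ 0 ∧
    σ (X 0) = C a * X 0 + C b * X 1 + C c ∧
    σ (X 1) = C d * X 0 + C e * X 1 + C f

/-- An elementary automorphism of `K[x,y]`: it sends
`(x, y) ↦ (αx + P(y), βy + v)` with `α β ≠ 0` and `P` a single-variable
polynomial. -/
def IsElementaryAut (K : Type*) [Field K]
    (σ : MvPolynomial (Fin 2) K ≃ₐ[K] MvPolynomial (Fin 2) K) : Prop :=
  ∃ (α β v : K) (p : Polynomial K), α ≠ 0 ∧ β ≠ 0 ∧
    σ (X 0) = C α * X 0 + Polynomial.aeval (X 1) p ∧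
    σ (X 1) = C β * X 1 + C v


namespace JvdK
open scoped Polynomial

section Core
variable {F : Type*} [Field F]

/-- iterated quotient by `h` -/
noncomputable def dv (h : F[X]) (j : ℕ) (q : F[X]) : F[X] := (fun p => p /ₘ h)^[j] q

/-- coefficient of `h ^ j` in the `h`-adic expansion -/
noncomputable def cf (h : F[X]) (j : ℕ) (q : F[X]) : F[X] := dv h j q %ₘ h

lemma dv_succ (h : F[X]) (j : ℕ) (q : F[X]) : dv h (j+1) q = dv h j q /ₘ h := by
  simp [dv, Function.iterate_succ_apply']

lemma dv_succ' (h : F[X]) (j : ℕ) (q : F[X]) : dv h (j+1) q = dv h j (q /ₘ h) := by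
  simp [dv, Function.iterate_succ_apply]

lemma divm_add {h : F[X]} (hm : h.Monic) (p q : F[X]) :
    (p + q) /ₘ h = p /ₘ h + q /ₘ h := by
  refine (Polynomial.div_modByMonic_unique (p /ₘ h + q /ₘ h) (p %ₘ h + q %ₘ h) hm ⟨?_, ?_⟩).1
  · have h1 := Polynomial.modByMonic_add_div p h
    have h2 := Polynomial.modByMonic_add_div q h
    linear_combination h1 + h2
  · exact lt_of_le_of_lt (Polynomial.degree_add_le _ _)
      (max_lt (Polynomial.degree_modByMonic_lt _ hm) (Polynomial.degree_modByMonic_lt _ hm))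

lemma dv_add {h : F[X]} (hm : h.Monic) (j : ℕ) (p q : F[X]) :
    dv h j (p + q) = dv h j p + dv h j q := by
  induction j with
  | zero => simp [dv]
  | succ j ih => simp only [dv_succ, ih, divm_add hm]

lemma cf_add {h : F[X]} (hm : h.Monic) (j : ℕ) (p q : F[X]) :
    cf h j (p + q) = cf h j p + cf h j q := by
  simp [cf, dv_add hm, Polynomial.add_modByMonic]

lemma cf_zero {h : F[X]} (j : ℕ) : cf h j 0 = 0 := by
  have : dv h j 0 = 0 := by
    induction j with
    | zero => simp [dv]
    | succ j ih => simp [dv_succ, ih]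
  simp [cf, this]

lemma cf_sum {h : F[X]} (hm : h.Monic) (j : ℕ) {ι : Type*} (s : Finset ι) (f : ι → F[X]) :
    cf h j (∑ i ∈ s, f i) = ∑ i ∈ s, cf h j (f i) := by
  classical
  induction s using Finset.induction_on with
  | empty => simp [cf_zero]
  | insert a s ha ih => simp [Finset.sum_insert ha, cf_add hm, ih]

lemma cf_natDegree_lt {h : F[X]} (hm : h.Monic) (hE : 0 < h.natDegree) (j : ℕ) (q : F[X]) :
    (cf h j q).natDegree < h.natDegree := by
  apply Polynomial.natDegree_modByMonic_lt _ hm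
  intro h1
  simp [h1] at hE

lemma dv_natDegree {h : F[X]} (hm : h.Monic) (j : ℕ) (q : F[X]) :
    (dv h j q).natDegree = q.natDegree - j * h.natDegree := by
  induction j with
  | zero => simp [dv]
  | succ j ih =>
    rw [dv_succ, Polynomial.natDegree_divByMonic _ hm, ih, Nat.sub_sub]; ring_nf

lemma dv_eq_zero {h : F[X]} (hm : h.Monic) (j : ℕ) (q : F[X])
    (hq : q.natDegree < j * h.natDegree) : dv h j q = 0 := by
  cases j with
  | zero => simp at hq
  | succ j =>
    rw [dv_succ, Polynomial.divByMonic_eq_zero_iff hm]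
    rw [add_mul, one_mul] at hq
    by_cases h0 : dv h j q = 0
    · rw [h0, Polynomial.degree_zero, bot_lt_iff_ne_bot]; simp [hm.ne_zero]
    rw [Polynomial.degree_eq_natDegree h0, Polynomial.degree_eq_natDegree hm.ne_zero]
    rw [dv_natDegree hm]
    have : 0 < h.natDegree ∨ h.natDegree = 0 := by omega
    norm_cast
    rcases this with h1 | h1
    · omega
    · exfalso
      simp [h1] at hq

lemma expansion {h : F[X]} (n : ℕ) (q : F[X]) :
    q = ∑ j ∈ Finset.range n, cf h j q * h ^ j + h ^ n * dv h n q := by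
  induction n with
  | zero => simp [dv]
  | succ n ih =>
    rw [Finset.sum_range_succ, dv_succ]
    have h1 := Polynomial.modByMonic_add_div (dv h n q) h
    have h2 : cf h n q = dv h n q %ₘ h := rfl
    rw [h2]
    linear_combination ih - h ^ n * h1

lemma expansion' {h : F[X]} (hm : h.Monic) (n : ℕ) (q : F[X])
    (hq : q.natDegree < n * h.natDegree) :
    q = ∑ j ∈ Finset.range n, cf h j q * h ^ j := by
  have := expansion (h := h) n q
  rw [dv_eq_zero hm _ _ hq] at this
  simpa using this

lemma dv_mul_pow {h : F[X]} (hm : h.Monic) (p : F[X]) (i j : ℕ) :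
    dv h j (p * h ^ (j + i)) = p * h ^ i := by
  induction j with
  | zero => simp [dv]
  | succ j ih =>
    rw [dv_succ']
    have : p * h ^ (j + 1 + i) = h * (p * h ^ (j + i)) := by ring
    rw [this, Polynomial.mul_divByMonic_cancel_left _ hm, ih]

lemma cf_mul_pow {h : F[X]} (hm : h.Monic) (p : F[X])
    (hp : p.natDegree < h.natDegree) (i j : ℕ) :
    cf h j (p * h ^ i) = if j = i then p else 0 := by
  have hp' : p.degree < h.degree := Polynomial.degree_lt_degree hp
  split_ifs with hij
  · subst hij
    have := dv_mul_pow hm p 0 j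
    simp at this
    rw [cf, this, (Polynomial.modByMonic_eq_self_iff hm).2 hp']
  · rcases lt_or_gt_of_ne hij with h1 | h1
    · obtain ⟨k, rfl⟩ := Nat.exists_eq_add_of_lt h1
      rw [cf, add_assoc, dv_mul_pow hm, Polynomial.modByMonic_eq_zero_iff_dvd hm, pow_succ]
      exact ⟨p * h ^ k, by ring⟩
    · rw [cf, dv_eq_zero hm]
      · simp
      · have h2 : (p * h ^ i).natDegree ≤ p.natDegree + i * h.natDegree :=
          Polynomial.natDegree_mul_le.trans (by rw [hm.natDegree_pow])
        have h3 : (i + 1) * h.natDegree ≤ j * h.natDegree := Nat.mul_le_mul_right _ h1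
        rw [add_mul] at h3
        omega

variable {Γ : Type*} [LinearOrderedCommGroupWithZero Γ]

/-- Weighted value of the `j`-th term. -/
noncomputable def wt (ν : Valuation F[X] Γ) (h q : F[X]) (j : ℕ) : Γ := ν (cf h j q) * ν h ^ j

/-- `i` is the largest index where the weighted value is attained. -/
def Dom (ν : Valuation F[X] Γ) (h q : F[X]) (i : ℕ) : Prop :=
  wt ν h q i ≠ 0 ∧ ∀ j, wt ν h q j < wt ν h q i ∨ (wt ν h q j = wt ν h q i ∧ j ≤ i)

/-- The key multiplicative property of minimal separating polynomials. -/
lemma mul_red {ν₁ ν₂ : Valuation F[X] Γ} {h : F[X]} (hm : h.Monic)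
    (hmin : ∀ p : F[X], p.natDegree < h.natDegree → ν₁ p = ν₂ p)
    (hnz : ∀ p : F[X], p.natDegree < h.natDegree → p ≠ 0 → ν₁ p ≠ 0)
    (hlt : ν₁ h < ν₂ h) (hE : 0 < h.natDegree)
    (p q : F[X]) (hp : p.natDegree < h.natDegree) (hq : q.natDegree < h.natDegree)
    (hp0 : p ≠ 0) (hq0 : q ≠ 0) :
    ν₁ ((p * q) %ₘ h) = ν₁ p * ν₁ q ∧ ν₁ ((p * q) /ₘ h) * ν₁ h < ν₁ p * ν₁ q ∧
      ((p * q) /ₘ h).natDegree < h.natDegree ∧ ((p * q) %ₘ h).natDegree < h.natDegree := by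
  have hr : ((p * q) %ₘ h).natDegree < h.natDegree := by
    apply Polynomial.natDegree_modByMonic_lt _ hm
    intro h1
    simp [h1] at hE
  have ha : ((p * q) /ₘ h).natDegree < h.natDegree := by
    rw [Polynomial.natDegree_divByMonic _ hm, Polynomial.natDegree_mul hp0 hq0]
    omega
  have hs : ν₁ p * ν₁ q ≠ 0 := mul_ne_zero (hnz p hp hp0) (hnz q hq hq0)
  have hs2 : ν₂ p * ν₂ q = ν₁ p * ν₁ q := by rw [hmin p hp, hmin q hq]
  have heq : (p * q) %ₘ h = p * q - (p * q) /ₘ h * h := by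
    have := Polynomial.modByMonic_add_div (p * q) h
    linear_combination this
  set a := (p * q) /ₘ h
  set r := (p * q) %ₘ h
  have hle : ν₂ a * ν₂ h ≤ ν₁ p * ν₁ q := by
    by_contra hcon
    push Not at hcon
    have e2 : ν₂ r = ν₂ a * ν₂ h := by
      rw [heq, Valuation.map_sub_eq_of_lt_right, map_mul]
      rw [map_mul, map_mul, hs2]; exact hcon
    have ha0 : 0 < ν₂ a := by
      rw [zero_lt_iff]; rintro h0; rw [h0, zero_mul] at hcon
      exact absurd hcon (not_lt.2 zero_le)
    have e1 : ν₁ r < ν₂ a * ν₂ h := by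
      rw [heq]
      apply Valuation.map_sub_lt
      · rwa [map_mul]
      · rw [map_mul, hmin a ha]
        exact mul_lt_mul_of_pos_left hlt ha0
    rw [hmin r hr, e2] at e1
    exact lt_irrefl _ e1
  have hlt' : ν₁ a * ν₁ h < ν₁ p * ν₁ q := by
    by_cases ha0 : ν₁ a = 0
    · rw [ha0, zero_mul]; exact zero_lt_iff.2 hs
    · refine lt_of_lt_of_le ?_ hle
      rw [← hmin a ha]
      exact mul_lt_mul_of_pos_left hlt (zero_lt_iff.2 ha0)
  refine ⟨?_, hlt', ha, hr⟩
  rw [heq, Valuation.map_sub_eq_of_lt_left, map_mul]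
  rwa [map_mul, map_mul]

end Core
end JvdK


namespace JvdK
open scoped Polynomial

section Core2
variable {F : Type*} [Field F]
variable {Γ : Type*} [LinearOrderedCommGroupWithZero Γ]

lemma wt_eq (ν : Valuation F[X] Γ) (h q : F[X]) (j : ℕ) :
    wt ν h q j = ν (cf h j q * h ^ j) := by simp [wt]

lemma exists_dom {ν : Valuation F[X] Γ} {h : F[X]} (hm : h.Monic) (hE : 0 < h.natDegree)
    (hnz : ∀ p : F[X], p.natDegree < h.natDegree → p ≠ 0 → ν p ≠ 0) (hh : ν h ≠ 0)
    (q : F[X]) (hq : q ≠ 0) : ∃ i, Dom ν h q i ∧ i * h.natDegree ≤ q.natDegree := by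
  have hbig : ∀ j, q.natDegree < j * h.natDegree → cf h j q = 0 := fun j hj => by
    rw [cf, dv_eq_zero hm _ _ hj, Polynomial.zero_modByMonic]
  set n := q.natDegree + 1
  have hn : ∀ j, n ≤ j → q.natDegree < j * h.natDegree := fun j hj => by
    have : j * 1 ≤ j * h.natDegree := Nat.mul_le_mul_left _ hE
    omega
  obtain ⟨i, hi, hmax⟩ := Finset.exists_max_image (Finset.range n)
    (fun j => toLex (wt ν h q j, j)) ⟨0, by simp [n]⟩
  have hmax' : ∀ j ∈ Finset.range n,
      wt ν h q j < wt ν h q i ∨ (wt ν h q j = wt ν h q i ∧ j ≤ i) := by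
    intro j hj
    have := hmax j hj
    rw [Prod.Lex.le_iff] at this
    simpa using this
  have hne : wt ν h q i ≠ 0 := by
    intro h0
    apply hq
    rw [expansion' hm n q (hn n le_rfl)]
    apply Finset.sum_eq_zero
    intro j hj
    have h1 : wt ν h q j = 0 := by
      rcases hmax' j hj with h2 | h2
      · rw [h0] at h2; exact absurd h2 (not_lt.2 zero_le)
      · rw [h2.1, h0]
    rw [wt] at h1
    rcases mul_eq_zero.1 h1 with h2 | h2
    · by_cases h3 : cf h j q = 0
      · rw [h3, zero_mul]
      · exact absurd h2 (hnz _ (cf_natDegree_lt hm hE _ _) h3)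
    · exact absurd h2 (pow_ne_zero _ hh)
  refine ⟨i, ⟨hne, ?_⟩, ?_⟩
  · intro j
    by_cases hj : j ∈ Finset.range n
    · exact hmax' j hj
    · left
      rw [wt, hbig j (hn j (by simpa using hj)), map_zero, zero_mul]
      exact zero_lt_iff.2 hne
  · by_contra hcon
    apply hne
    rw [wt, hbig i (by omega), map_zero, zero_mul]

lemma term_wt {ν₁ ν₂ : Valuation F[X] Γ} {h : F[X]} (hm : h.Monic)
    (hmin : ∀ p : F[X], p.natDegree < h.natDegree → ν₁ p = ν₂ p)
    (hnz : ∀ p : F[X], p.natDegree < h.natDegree → p ≠ 0 → ν₁ p ≠ 0)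
    (hlt : ν₁ h < ν₂ h) (hE : 0 < h.natDegree) (hh : ν₁ h ≠ 0)
    (p q : F[X]) (hp : p.natDegree < h.natDegree) (hq : q.natDegree < h.natDegree)
    (k n : ℕ) :
    (n = k → wt ν₁ h (p * q * h ^ k) n = ν₁ p * ν₁ q * ν₁ h ^ k) ∧
    wt ν₁ h (p * q * h ^ k) n ≤ ν₁ p * ν₁ q * ν₁ h ^ k ∧
    (n ≠ k → ν₁ p * ν₁ q * ν₁ h ^ k ≠ 0 →
      wt ν₁ h (p * q * h ^ k) n < ν₁ p * ν₁ q * ν₁ h ^ k) := by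
  by_cases hp0 : p = 0
  · subst hp0; simp [wt, cf_zero]
  by_cases hq0 : q = 0
  · subst hq0; simp [wt, cf_zero]
  obtain ⟨h1, h2, h3, h4⟩ := mul_red hm hmin hnz hlt hE p q hp hq hp0 hq0
  have hT : p * q * h ^ k = (p * q) %ₘ h * h ^ k + (p * q) /ₘ h * h ^ (k+1) := by
    have := Polynomial.modByMonic_add_div (p * q) h
    linear_combination - h ^ k * this
  have hcf : cf h n (p * q * h ^ k) =
      (if n = k then (p * q) %ₘ h else 0) + (if n = k + 1 then (p * q) /ₘ h else 0) := by
    rw [hT, cf_add hm, cf_mul_pow hm _ h4, cf_mul_pow hm _ h3]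
  have hs : ν₁ p * ν₁ q * ν₁ h ^ k ≠ 0 :=
    mul_ne_zero (mul_ne_zero (hnz p hp hp0) (hnz q hq hq0)) (pow_ne_zero _ hh)
  have A : n = k → wt ν₁ h (p * q * h ^ k) n = ν₁ p * ν₁ q * ν₁ h ^ k := by
    rintro rfl
    rw [wt, hcf]
    simp [h1]
  have B : n ≠ k → wt ν₁ h (p * q * h ^ k) n < ν₁ p * ν₁ q * ν₁ h ^ k := by
    intro hnk
    rw [wt, hcf, if_neg hnk, zero_add]
    split_ifs with h5
    · rw [h5, pow_succ', ← mul_assoc]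
      exact mul_lt_mul_of_pos_right h2 (zero_lt_iff.2 (pow_ne_zero _ hh))
    · rw [map_zero, zero_mul]; exact zero_lt_iff.2 hs
  refine ⟨A, ?_, fun h _ => B h⟩
  by_cases hnk : n = k
  · exact (A hnk).le
  · exact (B hnk).le

lemma dom_mul {ν₁ ν₂ : Valuation F[X] Γ} {h : F[X]} (hm : h.Monic)
    (hmin : ∀ p : F[X], p.natDegree < h.natDegree → ν₁ p = ν₂ p)
    (hnz : ∀ p : F[X], p.natDegree < h.natDegree → p ≠ 0 → ν₁ p ≠ 0)
    (hlt : ν₁ h < ν₂ h) (hE : 0 < h.natDegree) (hh : ν₁ h ≠ 0)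
    (q q' : F[X]) (i i' : ℕ) (hq : Dom ν₁ h q i) (hq' : Dom ν₁ h q' i') :
    wt ν₁ h (q * q') (i + i') = wt ν₁ h q i * wt ν₁ h q' i' ∧
    ∀ n, i + i' < n → wt ν₁ h (q * q') n < wt ν₁ h q i * wt ν₁ h q' i' := by
  classical
  set S := wt ν₁ h q i * wt ν₁ h q' i' with hS
  have hS0 : S ≠ 0 := mul_ne_zero hq.1 hq'.1
  set m := max (max i i' + 1) (max q.natDegree q'.natDegree + 1)
  have hm1 : m * 1 ≤ m * h.natDegree := Nat.mul_le_mul_left _ hE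
  have e1 := expansion' hm m q (by omega)
  have e2 := expansion' hm m q' (by omega)
  let T : ℕ × ℕ → F[X] := fun x => cf h x.1 q * cf h x.2 q' * h ^ (x.1 + x.2)
  have e3 : q * q' = ∑ x ∈ Finset.range m ×ˢ Finset.range m, T x := by
    conv_lhs => rw [e1, e2, Finset.sum_mul_sum, ← Finset.sum_product']
    apply Finset.sum_congr rfl
    intro x _
    simp only [T]; ring
  have hval : ∀ x : ℕ × ℕ, ν₁ (cf h x.1 q) * ν₁ (cf h x.2 q') * ν₁ h ^ (x.1 + x.2) =
      wt ν₁ h q x.1 * wt ν₁ h q' x.2 := fun x => by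
    simp only [wt, pow_add]
    rw [mul_mul_mul_comm]
  have hcfl := cf_natDegree_lt hm hE
  have key : ∀ n, i + i' ≤ n → ∀ x : ℕ × ℕ, (x ≠ (i, i') ∨ i + i' < n) →
      wt ν₁ h (T x) n < S := by
    intro n hn x hx
    obtain ⟨-, t2, t3⟩ := term_wt hm hmin hnz hlt hE hh (cf h x.1 q) (cf h x.2 q')
      (hcfl _ _) (hcfl _ _) (x.1 + x.2) n
    rw [hval] at t2 t3
    rcases hq.2 x.1 with ha | ⟨ha, ha'⟩
    · refine t2.trans_lt ?_
      rcases hq'.2 x.2 with hb | ⟨hb, -⟩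
      · exact mul_lt_mul'' ha hb zero_le zero_le
      · rw [hb]; exact mul_lt_mul_of_pos_right ha (zero_lt_iff.2 hq'.1)
    · rcases hq'.2 x.2 with hb | ⟨hb, hb'⟩
      · refine t2.trans_lt ?_
        rw [ha]; exact mul_lt_mul_of_pos_left hb (zero_lt_iff.2 hq.1)
      · rw [ha, hb] at t3
        refine t3 ?_ hS0
        rcases hx with hx | hx
        · intro h1
          apply hx
          ext <;> simp <;> omega
        · omega
  constructor
  · rw [wt_eq, e3, cf_sum hm, Finset.sum_mul,
      Valuation.map_sum_eq_of_lt ν₁ (j := (i, i'))]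
    · rw [← wt_eq]
      have := (term_wt hm hmin hnz hlt hE hh (cf h i q) (cf h i' q')
        (hcfl _ _) (hcfl _ _) (i + i') (i + i')).1 rfl
      rw [hval (i, i')] at this
      exact this
    · simp [m]
    · intro x hx
      have h1 : wt ν₁ h (T (i, i')) (i + i') = S := by
        have := (term_wt hm hmin hnz hlt hE hh (cf h i q) (cf h i' q')
          (hcfl _ _) (hcfl _ _) (i + i') (i + i')).1 rfl
        rw [hval (i, i')] at this
        exact this
      rw [← wt_eq, ← wt_eq, h1]
      refine key _ le_rfl x (Or.inl ?_)
      simp at hx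
      exact fun h => hx.2 h
  · intro n hn
    rw [wt_eq, e3, cf_sum hm, Finset.sum_mul]
    apply Valuation.map_sum_lt _ hS0
    intro x _
    rw [← wt_eq]
    exact key n hn.le x (Or.inr hn)

/-- Purity: a minimal separating polynomial with `ν₁ h < ν₂ h` has the degree of `u`. -/
lemma purity {ν₁ ν₂ : Valuation F[X] Γ} {h u : F[X]} (hm : h.Monic) (hum : u.Monic)
    (hmin : ∀ p : F[X], p.natDegree < h.natDegree → ν₁ p = ν₂ p)
    (hlt : ν₁ h < ν₂ h) (hE : 0 < h.natDegree) (hdeg : h.natDegree ≤ u.natDegree)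
    (hu : ∀ p, ν₁ p = 0 ↔ u ∣ p)
    (hχ : ∀ g, ν₁ g ≠ 0 → ∃ χ : F[X], χ.Monic ∧
      (∀ j, ν₁ (Polynomial.C (χ.coeff j)) * ν₁ g ^ j ≤ ν₁ g ^ χ.natDegree) ∧ u ∣ χ.comp g)
    (hpow : ∀ (k : ℕ) (g : F[X]), ν₂ u = ν₂ g ^ k → k = 1) :
    h.natDegree = u.natDegree := by
  by_cases hh : ν₁ h = 0
  · exact le_antisymm hdeg (Polynomial.natDegree_le_of_dvd ((hu h).1 hh) hm.ne_zero)
  have hnz : ∀ p : F[X], p.natDegree < h.natDegree → p ≠ 0 → ν₁ p ≠ 0 := by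
    intro p hp hp0 h0
    have := Polynomial.natDegree_le_of_dvd ((hu p).1 h0) hp0
    omega
  obtain ⟨χ, χm, χb, c, hc⟩ := hχ h hh
  set m := χ.natDegree with hmdef
  have hcomp0 : (χ.comp h) ≠ 0 := by
    have : (χ.comp h).Monic := χm.comp hm hE.ne'
    exact this.ne_zero
  have hc0 : c ≠ 0 := by rintro rfl; simp at hc; exact hcomp0 hc
  have hcdeg : m * h.natDegree = u.natDegree + c.natDegree := by
    rw [← Polynomial.natDegree_mul hum.ne_zero hc0, ← hc, Polynomial.natDegree_comp]
  have hcf : ∀ n, cf h n (χ.comp h) = Polynomial.C (χ.coeff n) := by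
    intro n
    have : χ.comp h = ∑ j ∈ Finset.range (m+1), Polynomial.C (χ.coeff j) * h ^ j := by
      rw [Polynomial.comp, Polynomial.eval₂_eq_sum_range]
    rw [this, cf_sum hm]
    simp_rw [fun j => cf_mul_pow hm (Polynomial.C (χ.coeff j)) (by simpa using hE) j n]
    rw [Finset.sum_ite_eq]
    split_ifs with h1
    · rfl
    · rw [Polynomial.coeff_eq_zero_of_natDegree_lt, Polynomial.C_0]
      simp at h1; omega
  obtain ⟨i, hi, hi'⟩ := exists_dom hm hE hnz hh u hum.ne_zero
  obtain ⟨i', hj, hj'⟩ := exists_dom hm hE hnz hh c hc0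
  obtain ⟨d1, d2⟩ := dom_mul hm hmin hnz hlt hE hh u c i i' hi hj
  rw [← hc] at d1 d2
  have hmI : m ≤ i + i' := by
    by_contra hcon
    push Not at hcon
    have h1 := d2 m hcon
    rw [← d1] at h1
    have h2 := χb (i + i')
    rw [wt, wt, hcf, hcf] at h1
    have h3 : χ.coeff m = 1 := χm
    rw [h3] at h1
    simp at h1
    exact absurd h2 (not_le.2 h1)
  have hiE : i * h.natDegree = u.natDegree := by
    have : m * h.natDegree ≤ (i + i') * h.natDegree := Nat.mul_le_mul_right _ hmI
    rw [add_mul] at this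
    omega
  -- the value of `u`
  have e1 := expansion' hm (i+1) u (by rw [add_mul]; omega)
  have hlead : cf h i u = 1 := by
    have e2 : dv h i u = 1 := by
      have h0 := expansion (h := h) i u
      have h1 : (dv h i u).natDegree = 0 := by rw [dv_natDegree hm]; omega
      rw [Polynomial.eq_C_of_natDegree_eq_zero h1] at h0 ⊢
      have h2 : (u).coeff (i * h.natDegree) = 1 := by rw [hiE]; exact hum
      rw [h0, Polynomial.coeff_add, Polynomial.coeff_mul_C] at h2
      have h3 : (h ^ i).coeff (i * h.natDegree) = 1 := by
        rw [← hm.natDegree_pow]; exact (hm.pow i)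
      rw [h3, Polynomial.coeff_eq_zero_of_degree_lt] at h2
      · simp at h2; rw [h2]; simp
      · by_cases hi0 : i = 0
        · exfalso; simp [hi0] at hiE; omega
        refine (Polynomial.degree_sum_le _ _).trans_lt ?_
        rw [Finset.sup_lt_iff (WithBot.bot_lt_coe _)]
        intro j hj
        apply lt_of_le_of_lt Polynomial.degree_le_natDegree
        norm_cast
        refine Polynomial.natDegree_mul_le.trans_lt ?_
        rw [hm.natDegree_pow]
        have h4 := cf_natDegree_lt hm hE j u
        have h5 : (j+1) * h.natDegree ≤ i * h.natDegree :=
          Nat.mul_le_mul_right _ (by simpa using hj)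
        rw [add_mul] at h5
        omega
    rw [cf, e2, (Polynomial.modByMonic_eq_self_iff hm).2]
    rw [Polynomial.degree_one]
    exact Polynomial.natDegree_pos_iff_degree_pos.1 hE
  have hval : ν₂ u = ν₂ h ^ i := by
    conv_lhs => rw [e1]
    rw [Valuation.map_sum_eq_of_lt ν₂ (j := i)]
    · simp [hlead]
    · simp
    · intro j hj
      simp only [Finset.mem_sdiff, Finset.mem_range, Finset.mem_singleton] at hj
      have hji : j < i := by omega
      rw [hlead, one_mul, map_mul, map_pow, map_pow, ← hmin _ (cf_natDegree_lt hm hE _ _)]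
      have h1 : wt ν₁ h u j ≤ wt ν₁ h u i := by
        rcases hi.2 j with h2 | h2
        · exact h2.le
        · exact h2.1.le
      rw [wt, wt, hlead, map_one, one_mul] at h1
      obtain ⟨k, rfl⟩ := Nat.exists_eq_add_of_lt hji
      rw [show j + k + 1 = (k + 1) + j by ring, pow_add] at h1 ⊢
      have h2 := le_of_mul_le_mul_right h1 (zero_lt_iff.2 (pow_ne_zero _ hh))
      have hpos : 0 < ν₂ h := lt_of_le_of_lt zero_le hlt
      refine mul_lt_mul_of_pos_right (h2.trans_lt ?_) (pow_pos hpos _)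
      exact pow_lt_pow_left₀ hlt zero_le (by omega)
  have := hpow i h hval
  rw [← hiE, this, one_mul]

/-- Core dichotomy. -/
lemma core (ν₁ ν₂ : Valuation F[X] Γ) (u v : F[X]) (hum : u.Monic) (hvm : v.Monic)
    (hC : ∀ c, ν₁ (Polynomial.C c) = ν₂ (Polynomial.C c))
    (hu : ∀ p, ν₁ p = 0 ↔ u ∣ p) (hv : ∀ p, ν₂ p = 0 ↔ v ∣ p)
    (hχ₁ : ∀ g, ν₁ g ≠ 0 → ∃ χ : F[X], χ.Monic ∧
      (∀ j, ν₁ (Polynomial.C (χ.coeff j)) * ν₁ g ^ j ≤ ν₁ g ^ χ.natDegree) ∧ u ∣ χ.comp g)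
    (hχ₂ : ∀ g, ν₂ g ≠ 0 → ∃ χ : F[X], χ.Monic ∧
      (∀ j, ν₂ (Polynomial.C (χ.coeff j)) * ν₂ g ^ j ≤ ν₂ g ^ χ.natDegree) ∧ v ∣ χ.comp g)
    (hu2 : ν₂ u ≠ 0) (hv1 : ν₁ v ≠ 0)
    (hpow₂ : ∀ (k : ℕ) (g : F[X]), ν₂ u = ν₂ g ^ k → k = 1)
    (hpow₁ : ∀ (k : ℕ) (g : F[X]), ν₁ v = ν₁ g ^ k → k = 1) :
    (∀ p : F[X], p.natDegree < u.natDegree → ν₁ p = ν₂ p) ∨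
    (∀ p : F[X], p.natDegree < v.natDegree → ν₁ p = ν₂ p) := by
  classical
  have hex : ∃ n, ∃ h : F[X], h.natDegree = n ∧ ν₁ h ≠ ν₂ h :=
    ⟨u.natDegree, u, rfl, by rw [(hu u).2 dvd_rfl]; exact hu2.symm⟩
  obtain ⟨h, hdeg, hne⟩ := Nat.find_spec hex
  have hmin0 : ∀ p : F[X], p.natDegree < Nat.find hex → ν₁ p = ν₂ p := by
    intro p hp
    by_contra hcon
    exact Nat.find_min hex hp ⟨p, rfl, hcon⟩
  have hleu : Nat.find hex ≤ u.natDegree :=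
    Nat.find_min' hex ⟨u, rfl, by rw [(hu u).2 dvd_rfl]; exact hu2.symm⟩
  have hlev : Nat.find hex ≤ v.natDegree :=
    Nat.find_min' hex ⟨v, rfl, by rw [(hv v).2 dvd_rfl]; exact hv1⟩
  have hh0 : h ≠ 0 := by rintro rfl; simp at hne
  set g := Polynomial.C (h.leadingCoeff)⁻¹ * h with hg
  have hgm : g.Monic := by
    rw [hg, mul_comm]; exact Polynomial.monic_mul_leadingCoeff_inv hh0
  have hl0 : (h.leadingCoeff)⁻¹ ≠ 0 := inv_ne_zero (Polynomial.leadingCoeff_ne_zero.2 hh0)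
  have hgdeg : g.natDegree = Nat.find hex := by
    rw [hg, Polynomial.natDegree_C_mul hl0, hdeg]
  have hgne : ν₁ g ≠ ν₂ g := by
    intro heq
    apply hne
    rw [hg, map_mul, map_mul, hC] at heq
    refine mul_left_cancel₀ ?_ heq
    rw [← hC]
    intro h0
    have := (hu _).1 h0
    have hud := Polynomial.natDegree_le_of_dvd this (by simpa using hl0)
    rw [Polynomial.natDegree_C] at hud
    have hu1 : u = 1 := hum.natDegree_eq_zero.1 (by omega)
    have : ν₁ v = 0 := by rw [hu, hu1]; exact one_dvd _
    exact hv1 this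
  have hE : 0 < g.natDegree := by
    by_contra hcon
    apply hgne
    rw [Polynomial.eq_C_of_natDegree_eq_zero (by omega : g.natDegree = 0), hC]
  rw [← hgdeg] at hmin0 hleu hlev
  rcases lt_or_gt_of_ne hgne with hlt | hlt
  · left
    rw [← purity hgm hum hmin0 hlt hE hleu hu hχ₁ hpow₂]
    exact hmin0
  · right
    rw [← purity (ν₁ := ν₂) (ν₂ := ν₁) hgm hvm (fun p hp => (hmin0 p hp).symm)
      hlt hE hlev hv hχ₂ hpow₁]
    exact hmin0

end Core2
end JvdK


namespace JvdK
open scoped Polynomial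

section Pkg
variable {K : Type*} [Field K]

lemma pi_C (π : K[X][X] →ₐ[K] K[X]) (p : K[X]) :
    π (Polynomial.C p) = p.comp (π (Polynomial.C Polynomial.X)) := by
  induction p using Polynomial.induction_on' with
  | add p q hp hq => simp [hp, hq]
  | monomial n a =>
    have h : (Polynomial.C (Polynomial.C a) : K[X][X]) = algebraMap K K[X][X] a := rfl
    rw [← Polynomial.C_mul_X_pow_eq_monomial, Polynomial.C_mul, Polynomial.C_pow, map_mul,
      map_pow, h, AlgHom.commutes, Polynomial.mul_comp, Polynomial.C_comp, Polynomial.pow_comp,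
      Polynomial.X_comp]
    rfl

lemma pi_eq (π : K[X][X] →ₐ[K] K[X]) (P : K[X][X]) :
    π P = P.eval₂ (Polynomial.compRingHom (π (Polynomial.C Polynomial.X))) (π Polynomial.X) := by
  induction P using Polynomial.induction_on' with
  | add p q hp hq => simp [hp, hq]
  | monomial n a =>
    rw [← Polynomial.C_mul_X_pow_eq_monomial]
    rw [map_mul, pi_C, Polynomial.eval₂_mul]
    simp

lemma L1 (π : K[X][X] →ₐ[K] K[X]) (u : K[X][X]) (hker : ∀ P, π P = 0 ↔ u ∣ P)
    (hu : 0 < u.natDegree) : 0 < (π (Polynomial.C Polynomial.X)).natDegree := by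
  by_contra hcon
  have h0 : (π (Polynomial.C Polynomial.X)).natDegree = 0 := by omega
  rw [Polynomial.natDegree_eq_zero] at h0
  obtain ⟨c, hc⟩ := h0
  have : u ∣ Polynomial.C (Polynomial.X - Polynomial.C c) := by
    rw [← hker, pi_C, ← hc]; simp
  have h := Polynomial.natDegree_le_of_dvd this (by
    rw [Ne, Polynomial.C_eq_zero]; exact Polynomial.X_sub_C_ne_zero c)
  rw [Polynomial.natDegree_C] at h
  omega

lemma comp_integral (f : K[X]) (hf : 0 < f.natDegree) (g : K[X]) :
    (Polynomial.compRingHom f).IsIntegralElem g := by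
  have hC : ∀ a : K, (Polynomial.compRingHom f).IsIntegralElem (Polynomial.C a) := fun a => by
    have : Polynomial.compRingHom f (Polynomial.C a) = Polynomial.C a := by simp
    rw [← this]; exact RingHom.isIntegralElem_map _
  have hf0 : f ≠ 0 := fun h => by simp [h] at hf
  have hX : (Polynomial.compRingHom f).IsIntegralElem Polynomial.X := by
    refine ⟨Polynomial.C (Polynomial.C f.leadingCoeff⁻¹) *
      (f.map Polynomial.C - Polynomial.C Polynomial.X), ?_, ?_⟩
    · have hd : (f.map (Polynomial.C : K →+* K[X]) -
          Polynomial.C Polynomial.X).natDegree = f.natDegree := by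
        rw [Polynomial.natDegree_sub_C,
          Polynomial.natDegree_map_eq_of_injective Polynomial.C_injective]
      rw [Polynomial.Monic, Polynomial.leadingCoeff_mul, Polynomial.leadingCoeff_C,
        ← Polynomial.coeff_natDegree (p := _ - _), hd, Polynomial.coeff_sub, Polynomial.coeff_map,
        Polynomial.coeff_C_of_ne_zero hf.ne', sub_zero, ← Polynomial.C_mul]
      rw [Polynomial.coeff_natDegree, inv_mul_cancel₀ (by simpa using hf0), Polynomial.C_1]
    · rw [Polynomial.eval₂_mul, Polynomial.eval₂_sub, Polynomial.eval₂_map]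
      have : (Polynomial.compRingHom f).comp Polynomial.C = Polynomial.C := by ext; simp
      rw [this, Polynomial.eval₂_C_X]
      simp
  induction g using Polynomial.induction_on' with
  | add p q hp hq => exact hp.add _ hq
  | monomial n a =>
    rw [← Polynomial.C_mul_X_pow_eq_monomial]
    refine (hC a).mul _ ?_
    induction n with
    | zero => rw [pow_zero]; exact hC 1
    | succ n ih => rw [pow_succ]; exact ih.mul _ hX

lemma L2 (π : K[X][X] →ₐ[K] K[X]) (u : K[X][X]) (hker : ∀ P, π P = 0 ↔ u ∣ P)
    (hu : 0 < u.natDegree) : ∃ a : K, a ≠ 0 ∧ u.leadingCoeff = Polynomial.C a := by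
  obtain ⟨P, hPm, hP⟩ := comp_integral _ (L1 π u hker hu) (π Polynomial.X)
  rw [← pi_eq, hker] at hP
  obtain ⟨q, rfl⟩ := hP
  rw [Polynomial.Monic, Polynomial.leadingCoeff_mul] at hPm
  have : IsUnit u.leadingCoeff := IsUnit.of_mul_eq_one _ hPm
  obtain ⟨a, ha, h⟩ := Polynomial.isUnit_iff.1 this
  exact ⟨a, ha.ne_zero, h.symm⟩

lemma L3 (π : K[X][X] →ₐ[K] K[X]) (hs : Function.Surjective π) (u : K[X][X])
    (hker : ∀ P, π P = 0 ↔ u ∣ P)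
    (hu : 0 < u.natDegree) : u.natDegree = (π (Polynomial.C Polynomial.X)).natDegree := by
  obtain ⟨a, ha, hlead⟩ := L2 π u hker hu
  set f := π (Polynomial.C Polynomial.X) with hf
  set u0 : K[X] := u.map (Polynomial.evalRingHom 0) with hu0
  have hu0d : u0.natDegree = u.natDegree := by
    apply Polynomial.natDegree_map_of_leadingCoeff_ne_zero
    rw [hlead]; simpa using ha
  let ι : K[X] →ₐ[K] K[X][X] := Polynomial.mapAlgHom (Algebra.ofId K K[X])
  let ψ : K[X] →ₐ[K] (K[X] ⧸ Ideal.span {f}) :=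
    (Ideal.Quotient.mkₐ K (Ideal.span {f})).comp (π.comp ι)
  -- every P is congruent to constant-coefficient polynomial mod C X
  have hcong : ∀ P : K[X][X], ∃ Q, P = ι (P.map (Polynomial.evalRingHom 0)) +
      Polynomial.C Polynomial.X * Q := fun P => by
    have : Polynomial.C Polynomial.X ∣ P - ι (P.map (Polynomial.evalRingHom 0)) := by
      rw [Polynomial.C_dvd_iff_dvd_coeff]
      intro i
      rw [Polynomial.X_dvd_iff]
      simp [ι, Algebra.ofId_apply, Polynomial.coeff_zero_eq_eval_zero]
    obtain ⟨Q, hQ⟩ := this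
    exact ⟨Q, by rw [← hQ]; ring⟩
  have hmk : ∀ P : K[X][X], Ideal.Quotient.mkₐ K (Ideal.span {f}) (π P) =
      ψ (P.map (Polynomial.evalRingHom 0)) := fun P => by
    obtain ⟨Q, hQ⟩ := hcong P
    conv_lhs => rw [hQ]
    rw [map_add, map_add, map_mul π, ← hf, map_mul]
    have : Ideal.Quotient.mkₐ K (Ideal.span {f}) f = 0 := by
      simp [Ideal.Quotient.eq_zero_iff_mem, Ideal.mem_span_singleton]
    rw [this]
    simp [ψ]
  have hι0 : ∀ p : K[X], (ι p).map (Polynomial.evalRingHom 0) = p := fun p => by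
    ext i; simp [ι, Algebra.ofId_apply]
  have hψs : Function.Surjective ψ := fun x => by
    obtain ⟨y, rfl⟩ := Ideal.Quotient.mkₐ_surjective K _ x
    obtain ⟨P, rfl⟩ := hs y
    exact ⟨_, (hmk P).symm⟩
  have hψk : RingHom.ker ψ = Ideal.span {u0} := by
    ext p
    rw [RingHom.mem_ker, Ideal.mem_span_singleton]
    constructor
    · intro h
      have h1 : f ∣ π (ι p) := by
        rw [← Ideal.mem_span_singleton, ← Ideal.Quotient.eq_zero_iff_mem]; exact h
      obtain ⟨q, hq⟩ := h1
      obtain ⟨Q, rfl⟩ := hs q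
      have : u ∣ ι p - Polynomial.C Polynomial.X * Q := by
        rw [← hker, map_sub, map_mul, hq, sub_self]
      have := Polynomial.map_dvd (Polynomial.evalRingHom 0) this
      simpa [hι0] using this
    · rintro ⟨q, rfl⟩
      have : ψ u0 = 0 := by
        rw [hu0, ← hmk, (hker u).2 dvd_rfl, map_zero]
      rw [map_mul, this, zero_mul]
  have e1 := (Ideal.quotientKerAlgEquivOfSurjective hψs).toLinearEquiv.finrank_eq
  rw [(Ideal.quotientEquivAlgOfEq K hψk).toLinearEquiv.finrank_eq,
    finrank_quotient_span_eq_natDegree, finrank_quotient_span_eq_natDegree] at e1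
  omega

/-- expansion of `q` in terms of `f`. -/
lemma decomp (f : K[X]) (hf : 0 < f.natDegree) (q : K[X]) : ∃ c : ℕ → K[X],
    q = ∑ i ∈ Finset.range f.natDegree, (c i).comp f * Polynomial.X ^ i ∧
    ∀ i, c i ≠ 0 → f.natDegree * (c i).natDegree + i ≤ q.natDegree := by
  have hf0 : f ≠ 0 := fun h => by simp [h] at hf
  induction hN : q.natDegree using Nat.strong_induction_on generalizing q with
  | _ N ih =>
  by_cases hlt : q.natDegree < f.natDegree
  · refine ⟨fun i => Polynomial.C (q.coeff i), ?_, fun i hi => ?_⟩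
    · conv_lhs => rw [q.as_sum_range' _ hlt]
      refine Finset.sum_congr rfl fun i _ => ?_
      rw [Polynomial.C_comp, Polynomial.C_mul_X_pow_eq_monomial]
    · have : q.coeff i ≠ 0 := by simpa using hi
      have := Polynomial.le_natDegree_of_ne_zero this
      simp; omega
  · have hq0 : (q / f).natDegree = q.natDegree - f.natDegree := by
      have h1 : q = f * (q / f) + q % f := (EuclideanDomain.div_add_mod q f).symm
      have hr : (q % f).natDegree < f.natDegree := Polynomial.natDegree_mod_lt _ hf.ne'
      have hne : q / f ≠ 0 := fun h => by
        rw [h, mul_zero, zero_add] at h1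
        rw [h1] at hlt; exact hlt hr
      have : q.natDegree = f.natDegree + (q / f).natDegree := by
        rw [← Polynomial.natDegree_mul hf0 hne]
        conv_lhs => rw [h1]
        apply Polynomial.natDegree_add_eq_left_of_natDegree_lt
        rw [Polynomial.natDegree_mul hf0 hne]; omega
      omega
    obtain ⟨c, hc, hc2⟩ := ih (q / f).natDegree (by omega) _ rfl
    have hr : (q % f).natDegree < f.natDegree := Polynomial.natDegree_mod_lt _ hf.ne'
    refine ⟨fun i => Polynomial.X * c i + Polynomial.C ((q % f).coeff i), ?_, fun i hi => ?_⟩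
    · have h1 : q = f * (q / f) + q % f := (EuclideanDomain.div_add_mod q f).symm
      have h2 := (q % f).as_sum_range' _ hr
      conv_lhs => rw [h1, hc, h2]
      rw [Finset.mul_sum, ← Finset.sum_add_distrib]
      refine Finset.sum_congr rfl fun i _ => ?_
      rw [Polynomial.add_comp, Polynomial.C_comp, Polynomial.mul_comp, Polynomial.X_comp,
        ← Polynomial.C_mul_X_pow_eq_monomial]
      ring
    · by_cases hci : c i = 0
      · simp only [hci, mul_zero, zero_add] at hi ⊢
        have : (q % f).coeff i ≠ 0 := by simpa using hi
        have := Polynomial.le_natDegree_of_ne_zero this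
        simp; omega
      · have := hc2 i hci
        have h3 : (Polynomial.X * c i + Polynomial.C ((q % f).coeff i)).natDegree ≤
            (c i).natDegree + 1 := by
          rw [Polynomial.natDegree_add_C, Polynomial.natDegree_X_mul hci]
        have := Nat.mul_le_mul_left f.natDegree h3
        rw [mul_add] at this
        show f.natDegree * (Polynomial.X * c i + Polynomial.C ((q % f).coeff i)).natDegree + i ≤ N
        omega

lemma integ {O L : Type*} [CommRing O] [Field L] (ρ : O →+* L) {n : ℕ} (e : Fin n → L)
    (i0 : Fin n) (he : e i0 ≠ 0) (y : L)
    (h : ∀ i, ∃ c : Fin n → O, y * e i = ∑ j, ρ (c j) * e j) : ρ.IsIntegralElem y := by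
  letI := ρ.toAlgebra
  have hne : Submodule.span O (Set.range e) ≠ ⊥ := by
    intro hb
    apply he
    have := Submodule.subset_span (R := O) (Set.mem_range_self (f := e) i0)
    rw [hb] at this
    simpa using this
  refine isIntegral_of_smul_mem_submodule (R := O) (A := L) _ hne
    (Submodule.fg_span (Set.finite_range e)) y fun m hm => ?_
  induction hm using Submodule.span_induction with
  | mem x hx =>
    obtain ⟨i, rfl⟩ := hx
    obtain ⟨c, hc⟩ := h i
    rw [smul_eq_mul, hc]
    refine Submodule.sum_mem _ fun j _ => ?_
    have : ρ (c j) * e j = c j • e j := by rw [Algebra.smul_def]; rfl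
    rw [this]
    exact Submodule.smul_mem _ _ (Submodule.subset_span (Set.mem_range_self j))
  | zero => simp
  | add a b _ _ ha hb => rw [smul_add]; exact Submodule.add_mem _ ha hb
  | smul r x _ hx => rw [smul_comm]; exact Submodule.smul_mem _ _ hx

end Pkg
end JvdK


namespace JvdK
open scoped Polynomial WithZero

section Val
variable {K : Type*} [Field K]

/-- The valuation at infinity. -/
noncomputable def vinf (K : Type*) [Field K] : Valuation (RatFunc K) ℤᵐ⁰ := by
  classical exact RatFunc.inftyValuation K

lemma vinf_of_ne {x : RatFunc K} (hx : x ≠ 0) : vinf K x = WithZero.exp x.intDegree := by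
  classical
  have := RatFunc.inftyValuation_of_nonzero K hx
  rw [← RatFunc.inftyValuation_apply] at this
  unfold vinf
  convert this

lemma vinf_poly {p : K[X]} (hp : p ≠ 0) :
    vinf K (algebraMap K[X] (RatFunc K) p) = WithZero.exp (p.natDegree : ℤ) := by
  rw [vinf_of_ne (by simpa using hp), RatFunc.intDegree_polynomial]

/-- `c ↦ c ∘ f` on rational functions. -/
noncomputable def phiF (f : K[X]) (hf : 0 < f.natDegree) : RatFunc K →+* RatFunc K :=
  IsFractionRing.lift (K := RatFunc K)
    (g := (algebraMap K[X] (RatFunc K)).comp (Polynomial.compRingHom f)) (by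
    rw [injective_iff_map_eq_zero]
    intro p hp
    have h : p.comp f = 0 := by simpa using hp
    rw [Polynomial.comp_eq_zero_iff] at h
    rcases h with h | ⟨_, h⟩
    · exact h
    · rw [h] at hf; simp at hf)

lemma phiF_alg (f : K[X]) (hf : 0 < f.natDegree) (p : K[X]) :
    phiF f hf (algebraMap K[X] (RatFunc K) p) = algebraMap K[X] (RatFunc K) (p.comp f) := by
  simp [phiF, IsFractionRing.lift_algebraMap]

lemma comp_ne {f : K[X]} (hf : 0 < f.natDegree) {p : K[X]} (hp : p ≠ 0) : p.comp f ≠ 0 := by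
  intro h
  rw [Polynomial.comp_eq_zero_iff] at h
  rcases h with h | ⟨_, h⟩
  · exact hp h
  · rw [h] at hf; simp at hf

lemma exp_pow' (a : ℤ) (n : ℕ) : (WithZero.exp a : ℤᵐ⁰) ^ n = WithZero.exp (n * a) := by
  rw [← WithZero.exp_nsmul]; simp

lemma vinf_phiF (f : K[X]) (hf : 0 < f.natDegree) (c : RatFunc K) :
    vinf K (phiF f hf c) = vinf K c ^ f.natDegree := by
  have hp : ∀ p : K[X], vinf K (phiF f hf (algebraMap K[X] (RatFunc K) p)) =
      vinf K (algebraMap K[X] (RatFunc K) p) ^ f.natDegree := fun p => by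
    by_cases h : p = 0
    · simp [h, hf.ne']
    · rw [phiF_alg, vinf_poly h, vinf_poly (comp_ne hf h), Polynomial.natDegree_comp, exp_pow']
      push_cast
      rw [mul_comm]
  conv_lhs => rw [← RatFunc.num_div_denom c]
  conv_rhs => rw [← RatFunc.num_div_denom c]
  rw [map_div₀, map_div₀, hp, hp, map_div₀, div_pow]

/-- elements with denominators in the image of `phiF`. -/
def Sset (f : K[X]) (hf : 0 < f.natDegree) (z : RatFunc K) : Prop :=
  ∃ q b : K[X], b ≠ 0 ∧ z * phiF f hf (algebraMap K[X] (RatFunc K) b) =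
    algebraMap K[X] (RatFunc K) q

lemma Sset_mul {f : K[X]} {hf : 0 < f.natDegree} {z w : RatFunc K} (hz : Sset f hf z)
    (hw : Sset f hf w) : Sset f hf (z * w) := by
  obtain ⟨q, b, hb, h⟩ := hz
  obtain ⟨q', b', hb', h'⟩ := hw
  refine ⟨q * q', b * b', mul_ne_zero hb hb', ?_⟩
  rw [map_mul, map_mul, map_mul, ← h, ← h']; ring

lemma Sset_alg {f : K[X]} {hf : 0 < f.natDegree} (q : K[X]) :
    Sset f hf (algebraMap K[X] (RatFunc K) q) := ⟨q, 1, one_ne_zero, by simp⟩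

lemma Sset_phi {f : K[X]} {hf : 0 < f.natDegree} (c : RatFunc K) :
    Sset f hf (phiF f hf c) := by
  refine ⟨c.num.comp f, c.denom, RatFunc.denom_ne_zero c, ?_⟩
  have h : c * algebraMap K[X] (RatFunc K) c.denom = algebraMap K[X] (RatFunc K) c.num := by
    rw [← eq_div_iff (by simpa using RatFunc.denom_ne_zero c), RatFunc.num_div_denom]
  rw [← phiF_alg f hf, ← map_mul, h]

lemma Sset_pow {f : K[X]} {hf : 0 < f.natDegree} {z : RatFunc K} (hz : Sset f hf z) (n : ℕ) :
    Sset f hf (z ^ n) := by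
  induction n with
  | zero => rw [pow_zero, ← map_one (algebraMap K[X] (RatFunc K))]; exact Sset_alg 1
  | succ n ih => rw [pow_succ]; exact Sset_mul ih hz

/-- correction factors -/
noncomputable def dl (K : Type*) [Field K] (i : ℕ) : RatFunc K :=
  if i = 0 then 1 else (algebraMap K[X] (RatFunc K) Polynomial.X)⁻¹

lemma dl_ne (i : ℕ) : dl K i ≠ 0 := by
  unfold dl; split_ifs <;> simp [RatFunc.X_ne_zero]

lemma vinf_dl (i : ℕ) : vinf K (dl K i) = WithZero.exp (if i = 0 then (0:ℤ) else -1) := by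
  unfold dl; split_ifs
  · simp
  · rw [map_inv₀, vinf_poly Polynomial.X_ne_zero]; simp

lemma in_span (f : K[X]) (hf : 0 < f.natDegree) (z : RatFunc K) (hz : Sset f hf z)
    (hv : vinf K z ≤ 1) : ∃ c : Fin f.natDegree → (vinf K).integer,
    z = ∑ j, ((phiF f hf).comp (vinf K).integer.subtype) (c j) *
      (algebraMap K[X] (RatFunc K) Polynomial.X ^ (j : ℕ) * phiF f hf (dl K j)) := by
  obtain ⟨q, b, hb, h⟩ := hz
  obtain ⟨c, hc, hcd⟩ := decomp f hf q
  have hb' : algebraMap K[X] (RatFunc K) b ≠ 0 := by simpa using hb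
  have hφb : phiF f hf (algebraMap K[X] (RatFunc K) b) ≠ 0 := by simpa using hb
  by_cases hq0 : q = 0
  · have : z = 0 := by simpa [hq0, hb] using h
    exact ⟨fun _ => 0, by simp [this]⟩
  have hqd : (q.natDegree : ℤ) ≤ f.natDegree * b.natDegree := by
    have h2 := congrArg (vinf K) h
    rw [map_mul, vinf_phiF, vinf_poly hb, vinf_poly hq0, exp_pow'] at h2
    rw [← WithZero.exp_le_exp (G := ℤ), ← h2]
    exact mul_le_of_le_one_left' hv
  have hmem : ∀ j, vinf K (algebraMap K[X] (RatFunc K) (c j) /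
      (algebraMap K[X] (RatFunc K) b * dl K j)) ≤ 1 := fun j => by
    by_cases hcj : c j = 0
    · simp [hcj]
    rw [map_div₀, map_mul, vinf_poly hcj, vinf_poly hb, vinf_dl, ← WithZero.exp_add,
      ← WithZero.exp_sub, ← WithZero.exp_zero, WithZero.exp_le_exp]
    have h3 := hcd j hcj
    have h4 : (f.natDegree : ℤ) * (c j).natDegree + j ≤ f.natDegree * b.natDegree := by
      refine le_trans ?_ hqd; exact_mod_cast h3
    have hf' : (0 : ℤ) < f.natDegree := by exact_mod_cast hf
    split_ifs with hj
    · subst hj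
      have : ((c 0).natDegree : ℤ) ≤ b.natDegree := by
        refine le_of_mul_le_mul_left (a := (f.natDegree : ℤ)) ?_ hf'
        simpa using h4
      linarith
    · have hj' : (0:ℤ) < j := by exact_mod_cast Nat.pos_of_ne_zero hj
      have : ((c j).natDegree : ℤ) < b.natDegree := by
        refine lt_of_mul_lt_mul_left (a := (f.natDegree : ℤ)) ?_ hf'.le
        linarith
      linarith
  refine ⟨fun j => ⟨_, hmem j⟩, ?_⟩
  apply mul_right_cancel₀ hφb
  rw [h, hc, map_sum, Finset.sum_mul, Finset.sum_range]
  refine Finset.sum_congr rfl fun j _ => ?_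
  rw [map_mul, map_pow, ← phiF_alg f hf]
  simp only [RingHom.comp_apply, Subring.subtype_apply, map_div₀, map_mul]
  have hd : phiF f hf (dl K j) ≠ 0 := by
    rw [Ne, map_eq_zero]; exact dl_ne _
  field_simp

lemma chi_exists (f : K[X]) (hf : 0 < f.natDegree) (z : RatFunc K) (hz : Sset f hf z)
    (hz0 : z ≠ 0) : ∃ χ : (RatFunc K)[X], χ.Monic ∧
      (∀ j, vinf K (phiF f hf (χ.coeff j)) * vinf K z ^ j ≤ vinf K z ^ χ.natDegree) ∧
      χ.eval₂ (phiF f hf) z = 0 := by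
  set n := f.natDegree with hn
  set d := z.intDegree
  have hvz : vinf K z = WithZero.exp d := vinf_of_ne hz0
  set x : RatFunc K := algebraMap K[X] (RatFunc K) Polynomial.X with hx
  have hx0 : x ≠ 0 := by simp [hx, RatFunc.X_ne_zero]
  have hvx : vinf K x = WithZero.exp 1 := by
    rw [hx, vinf_poly Polynomial.X_ne_zero]; simp
  have hvxd : ∀ m : ℤ, vinf K (x ^ m) = WithZero.exp m := fun m => by
    rw [map_zpow₀, hvx, ← WithZero.exp_zsmul]; simp
  set y := z ^ n * phiF f hf (x ^ (-d)) with hy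
  have hvy : vinf K y = 1 := by
    rw [hy, map_mul, map_pow, vinf_phiF, hvxd, hvz, exp_pow', exp_pow', ← WithZero.exp_add,
      ← WithZero.exp_zero]
    congr 1
    rw [← hn]; ring
  set ρ := (phiF f hf).comp (vinf K).integer.subtype with hρ
  have hyInt : ρ.IsIntegralElem y := by
    refine integ ρ (fun j : Fin n => x ^ (j : ℕ) * phiF f hf (dl K j)) ⟨0, hf⟩ ?_ y fun i => ?_
    · simp [dl]
    · refine in_span f hf _ ?_ ?_
      · refine Sset_mul (Sset_mul (Sset_pow hz _) (Sset_phi _)) (Sset_mul ?_ (Sset_phi _))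
        rw [hx, ← map_pow]; exact Sset_alg _
      · rw [map_mul, hvy, one_mul, map_mul, map_pow, hvx, vinf_phiF, vinf_dl, exp_pow', exp_pow',
          ← WithZero.exp_add, ← WithZero.exp_zero, WithZero.exp_le_exp]
        have := i.2
        split_ifs with h0
        · simp [h0]
        · have : ((i : ℕ) : ℤ) < f.natDegree := by exact_mod_cast i.2
          linarith
  obtain ⟨P, hPm, hP⟩ := hyInt
  have hPm' : (P.map (vinf K).integer.subtype).Monic := hPm.map _
  have hn0 : n ≠ 0 := hf.ne'
  set Q := (P.map (vinf K).integer.subtype).scaleRoots (x ^ d) with hQ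
  have hQm : Q.Monic := (Polynomial.monic_scaleRoots_iff _).2 hPm'
  have hQd : Q.natDegree = P.natDegree := by
    rw [hQ, Polynomial.natDegree_scaleRoots, hPm.natDegree_map]
  refine ⟨Polynomial.expand _ n Q, hQm.expand (Nat.pos_of_ne_zero hn0), fun j => ?_, ?_⟩
  · rw [Polynomial.natDegree_expand, Polynomial.coeff_expand (Nat.pos_of_ne_zero hn0)]
    split_ifs with hj
    · obtain ⟨k, rfl⟩ := hj
      rw [Nat.mul_div_cancel_left _ (Nat.pos_of_ne_zero hn0)]
      by_cases hk : P.natDegree < k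
      · rw [Polynomial.coeff_eq_zero_of_natDegree_lt (by rw [hQd]; exact hk)]
        simp [hn0]
      · push Not at hk
        rw [hQ, Polynomial.coeff_scaleRoots, hPm.natDegree_map, vinf_phiF, map_mul, map_pow, hvxd,
          Polynomial.coeff_map, ← hQ, hQd, hvz, mul_pow, exp_pow', exp_pow', exp_pow', exp_pow',
          mul_assoc, ← WithZero.exp_add]
        refine (mul_le_of_le_one_left' ?_).trans (le_of_eq ?_)
        · exact pow_le_one' (P.coeff k).2 _
        · congr 1
          rw [← hn]
          push_cast [Nat.cast_sub hk]
          ring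
    · simp [hn0]
  · rw [Polynomial.expand_eq_comp_X_pow, Polynomial.eval₂_comp]
    simp only [Polynomial.eval₂_pow, Polynomial.eval₂_X]
    have hzy : z ^ n = phiF f hf (x ^ d) * y := by
      rw [hy, mul_left_comm, ← map_mul, ← zpow_add₀ hx0]; simp
    rw [hzy]
    refine Polynomial.scaleRoots_eval₂_eq_zero _ ?_
    rw [Polynomial.eval₂_map]; exact hP

lemma clear_den (p : (RatFunc K)[X]) : ∃ b : K[X], b ≠ 0 ∧ ∃ P : K[X][X],
    P.map (algebraMap K[X] (RatFunc K)) =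
      Polynomial.C (algebraMap K[X] (RatFunc K) b) * p := by
  obtain ⟨b, hb, h⟩ := IsLocalization.integerNormalization_spec (nonZeroDivisors K[X]) p
  refine ⟨b, nonZeroDivisors.ne_zero hb, _, h.trans ?_⟩
  rw [← Polynomial.smul_eq_C_mul, algebraMap_smul]

lemma pkg (π : K[X][X] →ₐ[K] K[X]) (hs : Function.Surjective π) (u : K[X][X])
    (hker : ∀ P, π P = 0 ↔ u ∣ P) (hu : 0 < u.natDegree) :
    ∃ V : Valuation (RatFunc K)[X] ℤᵐ⁰,
      (∀ c, V (Polynomial.C c) = vinf K c ^ u.natDegree) ∧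
      (∀ p, V p = 0 ↔ u.map (algebraMap K[X] (RatFunc K)) ∣ p) ∧
      (∀ g, V g ≠ 0 → ∃ χ : (RatFunc K)[X], χ.Monic ∧
        (∀ j, V (Polynomial.C (χ.coeff j)) * V g ^ j ≤ V g ^ χ.natDegree) ∧
        u.map (algebraMap K[X] (RatFunc K)) ∣ χ.comp g) ∧
      (∀ P : K[X][X], V (P.map (algebraMap K[X] (RatFunc K))) =
        vinf K (algebraMap K[X] (RatFunc K) (π P))) := by
  have hd := L3 π hs u hker hu
  have hf := L1 π u hker hu
  set f := π (Polynomial.C Polynomial.X) with hfdef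
  set z : RatFunc K := algebraMap K[X] (RatFunc K) (π Polynomial.X) with hz
  set Pi1 : (RatFunc K)[X] →+* RatFunc K := Polynomial.eval₂RingHom (phiF f hf) z with hPi1
  have hPi1C : ∀ c, Pi1 (Polynomial.C c) = phiF f hf c := fun c => by simp [hPi1]
  have hPi1m : ∀ P : K[X][X], Pi1 (P.map (algebraMap K[X] (RatFunc K))) =
      algebraMap K[X] (RatFunc K) (π P) := fun P => by
    rw [hPi1, Polynomial.coe_eval₂RingHom, Polynomial.eval₂_map, pi_eq π P, Polynomial.hom_eval₂]
    congr 1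
    refine RingHom.ext fun p => ?_
    simp only [RingHom.comp_apply, phiF_alg]
    rfl
  have hk : ∀ p, Pi1 p = 0 ↔ u.map (algebraMap K[X] (RatFunc K)) ∣ p := fun p => by
    constructor
    · intro h
      obtain ⟨b, hb, P, hP⟩ := clear_den p
      have h1 := hPi1m P
      rw [hP, map_mul, h, mul_zero] at h1
      have h2 : π P = 0 := by simpa using h1.symm
      have h3 := Polynomial.map_dvd (algebraMap K[X] (RatFunc K)) ((hker P).1 h2)
      rw [hP] at h3
      refine (IsUnit.dvd_mul_left ?_).1 h3
      rw [Polynomial.isUnit_C, isUnit_iff_ne_zero]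
      simpa using hb
    · rintro ⟨q, rfl⟩
      rw [map_mul, hPi1m, (hker u).2 dvd_rfl]; simp
  have hS : ∀ p, Sset f hf (Pi1 p) := fun p => by
    obtain ⟨b, hb, P, hP⟩ := clear_den p
    refine ⟨π P, b, hb, ?_⟩
    rw [← hPi1m, hP, map_mul, hPi1C, mul_comm]
  refine ⟨(vinf K).comap Pi1, fun c => ?_, fun p => ?_, fun g hg => ?_, fun P => ?_⟩
  · rw [Valuation.comap_apply, hPi1C, vinf_phiF, hd]
  · rw [Valuation.comap_apply, map_eq_zero, hk]
  · simp only [Valuation.comap_apply, hPi1C] at hg ⊢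
    obtain ⟨χ, h1, h2, h3⟩ := chi_exists f hf (Pi1 g) (hS g) (by simpa using hg)
    refine ⟨χ, h1, h2, ?_⟩
    rw [← hk, hPi1, Polynomial.coe_eval₂RingHom, Polynomial.eval₂_comp]
    exact h3
  · rw [Valuation.comap_apply, hPi1m]

end Val
end JvdK


namespace JvdK
open scoped Polynomial WithZero

section Div
variable {K : Type*} [Field K]

lemma exists_exp {x : ℤᵐ⁰} (hx : x ≠ 0) : ∃ j : ℤ, x = WithZero.exp j :=
  ⟨_, (WithZero.exp_log hx).symm⟩

lemma vpow_arith {x : ℤᵐ⁰} {N k : ℕ} (hN : 0 < N)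
    (h : (WithZero.exp (1:ℤ) : ℤᵐ⁰) ^ N = (x ^ N) ^ k) : k = 1 := by
  by_cases hk : k = 0
  · subst hk
    rw [pow_zero, exp_pow', ← WithZero.exp_zero, WithZero.exp_inj] at h
    omega
  have hx : x ≠ 0 := by
    rintro rfl
    rw [zero_pow hN.ne', zero_pow hk] at h
    simp at h
  obtain ⟨j, rfl⟩ := exists_exp hx
  rw [exp_pow', exp_pow', exp_pow', WithZero.exp_inj] at h
  have hN' : (N : ℤ) ≠ 0 := by exact_mod_cast hN.ne'
  have h2 : (k : ℤ) * j = 1 := by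
    apply mul_left_cancel₀ hN'
    linarith
  have := Int.eq_one_or_neg_one_of_mul_eq_one h2
  omega

lemma vpow_dvd {x : ℤᵐ⁰} {N M : ℕ} (hN : 0 < N)
    (h : (WithZero.exp (1:ℤ) : ℤᵐ⁰) ^ M = x ^ N) : N ∣ M := by
  have hx : x ≠ 0 := by
    rintro rfl
    rw [zero_pow hN.ne'] at h
    simp at h
  obtain ⟨j, rfl⟩ := exists_exp hx
  rw [exp_pow', exp_pow', WithZero.exp_inj] at h
  have : (N : ℤ) ∣ M := ⟨j, by linarith⟩
  exact_mod_cast this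

/-- power of a valuation -/
def vpow {R : Type*} [CommRing R] (V : Valuation R ℤᵐ⁰) (n : ℕ) (hn : n ≠ 0) :
    Valuation R ℤᵐ⁰ :=
  V.map (powMonoidWithZeroHom hn) (fun a b h => pow_le_pow_left' h n)

lemma vpow_apply {R : Type*} [CommRing R] (V : Valuation R ℤᵐ⁰) (n : ℕ) (hn : n ≠ 0) (x : R) :
    vpow V n hn x = V x ^ n := rfl

lemma monicize (u : K[X][X]) (a : K) (ha : a ≠ 0) (hl : u.leadingCoeff = Polynomial.C a) :
    ∃ U : (RatFunc K)[X], U.Monic ∧ U.natDegree = u.natDegree ∧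
      (∀ p, U ∣ p ↔ u.map (algebraMap K[X] (RatFunc K)) ∣ p) ∧
      ∀ (V : Valuation (RatFunc K)[X] ℤᵐ⁰) (n : ℕ), (∀ c, V (Polynomial.C c) = vinf K c ^ n) →
        V U = V (u.map (algebraMap K[X] (RatFunc K))) := by
  set k := algebraMap K[X] (RatFunc K) (Polynomial.C a⁻¹) with hk
  have hCa : (Polynomial.C a⁻¹ : K[X]) ≠ 0 := by simpa using ha
  have hk0 : k ≠ 0 := by
    rw [hk, Ne, FaithfulSMul.algebraMap_eq_zero_iff]; exact hCa
  have hinj : Function.Injective (algebraMap K[X] (RatFunc K)) :=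
    FaithfulSMul.algebraMap_injective _ _
  refine ⟨Polynomial.C k * u.map (algebraMap K[X] (RatFunc K)), ?_, ?_, fun p => ?_, ?_⟩
  · rw [Polynomial.Monic, Polynomial.leadingCoeff_mul, Polynomial.leadingCoeff_C,
      Polynomial.leadingCoeff_map_of_injective hinj, hl, hk, ← map_mul, ← Polynomial.C_mul,
      inv_mul_cancel₀ ha]
    simp
  · rw [Polynomial.natDegree_C_mul hk0, Polynomial.natDegree_map_eq_of_injective hinj]
  · refine IsUnit.mul_left_dvd ?_
    rw [Polynomial.isUnit_C, isUnit_iff_ne_zero]; exact hk0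
  · intro V n h
    rw [map_mul, h, hk, vinf_poly hCa]
    simp

lemma divis (π₁ π₂ : K[X][X] →ₐ[K] K[X]) (hs₁ : Function.Surjective π₁)
    (hs₂ : Function.Surjective π₂) (u v : K[X][X]) (hk₁ : ∀ P, π₁ P = 0 ↔ u ∣ P)
    (hk₂ : ∀ P, π₂ P = 0 ↔ v ∣ P) (hu : 0 < u.natDegree) (hv : 0 < v.natDegree)
    (h₁ : π₁ v = Polynomial.X) (h₂ : π₂ u = Polynomial.X) :
    u.natDegree ∣ v.natDegree ∨ v.natDegree ∣ u.natDegree := by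
  obtain ⟨a, ha, hla⟩ := L2 π₁ u hk₁ hu
  obtain ⟨b, hb, hlb⟩ := L2 π₂ v hk₂ hv
  obtain ⟨U, hUm, hUd, hUdvd, hUv⟩ := monicize u a ha hla
  obtain ⟨W, hWm, hWd, hWdvd, hWv⟩ := monicize v b hb hlb
  obtain ⟨V₁, c₁, z₁, χ₁, m₁⟩ := pkg π₁ hs₁ u hk₁ hu
  obtain ⟨V₂, c₂, z₂, χ₂, m₂⟩ := pkg π₂ hs₂ v hk₂ hv
  have hVW : V₁ W = WithZero.exp 1 := by
    rw [hWv V₁ _ c₁, m₁, h₁, vinf_poly Polynomial.X_ne_zero]; simp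
  have hVU : V₂ U = WithZero.exp 1 := by
    rw [hUv V₂ _ c₂, m₂, h₂, vinf_poly Polynomial.X_ne_zero]; simp
  have hmodv : ∀ (V : Valuation (RatFunc K)[X] ℤᵐ⁰) (p q : (RatFunc K)[X]),
      V (p %ₘ q) = V p ∨ V q ≠ 0 := fun V p q => by
    by_cases h : V q = 0
    · left
      conv_rhs => rw [← Polynomial.modByMonic_add_div p q]
      rw [V.map_add_supp]
      simp [Valuation.mem_supp_iff, h]
    · right; exact h
  have key := core (vpow V₁ v.natDegree hv.ne') (vpow V₂ u.natDegree hu.ne') U W hUm hWm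
    (fun c => by rw [vpow_apply, vpow_apply, c₁, c₂, ← pow_mul, ← pow_mul, mul_comm])
    (fun p => by rw [vpow_apply, pow_eq_zero_iff hv.ne', z₁, hUdvd])
    (fun p => by rw [vpow_apply, pow_eq_zero_iff hu.ne', z₂, hWdvd])
    (fun g hg => by
      simp only [vpow_apply] at hg ⊢
      obtain ⟨χ, x1, x2, x3⟩ := χ₁ g (fun h => hg (by rw [h, zero_pow hv.ne']))
      refine ⟨χ, x1, fun j => ?_, (hUdvd _).2 x3⟩
      rw [pow_right_comm, pow_right_comm _ _ χ.natDegree, ← mul_pow]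
      exact pow_le_pow_left' (x2 j) _)
    (fun g hg => by
      simp only [vpow_apply] at hg ⊢
      obtain ⟨χ, x1, x2, x3⟩ := χ₂ g (fun h => hg (by rw [h, zero_pow hu.ne']))
      refine ⟨χ, x1, fun j => ?_, (hWdvd _).2 x3⟩
      rw [pow_right_comm, pow_right_comm _ _ χ.natDegree, ← mul_pow]
      exact pow_le_pow_left' (x2 j) _)
    (by rw [vpow_apply, hVU]; exact pow_ne_zero _ WithZero.exp_ne_zero)
    (by rw [vpow_apply, hVW]; exact pow_ne_zero _ WithZero.exp_ne_zero)
    (fun k g h => by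
      rw [vpow_apply, vpow_apply, hVU] at h
      exact vpow_arith hu h)
    (fun k g h => by
      rw [vpow_apply, vpow_apply, hVW] at h
      exact vpow_arith hv h)
  rcases key with key | key
  · left
    have h := key (W %ₘ U) (Polynomial.natDegree_modByMonic_lt _ hUm (fun h1 => by
      rw [h1] at hUd; simp at hUd; omega))
    rw [vpow_apply, vpow_apply, (hmodv V₁ W U).resolve_right (by
      rw [not_not, z₁, ← hUdvd]), hVW] at h
    exact vpow_dvd hu h
  · right
    have h := key (U %ₘ W) (Polynomial.natDegree_modByMonic_lt _ hWm (fun h1 => by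
      rw [h1] at hWd; simp at hWd; omega))
    rw [vpow_apply, vpow_apply, (hmodv V₂ U W).resolve_right (by
      rw [not_not, z₂, ← hWdvd]), hVU] at h
    exact vpow_dvd hv h.symm

end Div
end JvdK

namespace JvdK
open scoped Polynomial

section Main
variable {K : Type*} [Field K]

/-- Identification of `K[x,y]` with `K[y][x]`. -/
noncomputable def Psi (K : Type*) [Field K] : MvPolynomial (Fin 2) K ≃ₐ[K] K[X][X] :=
  (finSuccEquiv K 1).trans (Polynomial.mapAlgEquiv (MvPolynomial.uniqueAlgEquiv K (Fin 1)))

lemma Psi_X0 : Psi K (X 0) = Polynomial.X := by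
  simp [Psi, finSuccEquiv_X_zero]

lemma Psi_X1 : Psi K (X 1) = Polynomial.C Polynomial.X := by
  have : (1 : Fin 2) = Fin.succ 0 := rfl
  rw [Psi, this, AlgEquiv.trans_apply, finSuccEquiv_X_succ]
  simp

lemma Psi_C (a : K) : Psi K (C a) = Polynomial.C (Polynomial.C a) := (Psi K).commutes a

lemma Psi_aeval (p : K[X]) : Psi K (Polynomial.aeval (X 1) p) = Polynomial.C p := by
  induction p using Polynomial.induction_on' with
  | add p q hp hq => simp [hp, hq]
  | monomial n a =>
    rw [Polynomial.aeval_monomial, map_mul, map_pow, Psi_X1, AlgEquiv.commutes,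
      ← Polynomial.C_mul_X_pow_eq_monomial]
    rw [Polynomial.C_mul, Polynomial.C_pow]
    rfl

/-- The elementary shear. -/
noncomputable def shear (c : K) (β : ℕ) :
    MvPolynomial (Fin 2) K ≃ₐ[K] MvPolynomial (Fin 2) K :=
  AlgEquiv.ofAlgHom (aeval ![X 0 - C c * X 1 ^ β, X 1]) (aeval ![X 0 + C c * X 1 ^ β, X 1])
    (by ext i; fin_cases i <;> simp [algHom_C])
    (by ext i; fin_cases i <;> simp [algHom_C])

lemma shear_X0 (c : K) (β : ℕ) : shear c β (X 0) = X 0 - C c * X 1 ^ β := by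
  simp [shear]

lemma shear_X1 (c : K) (β : ℕ) : shear c β (X 1) = X 1 := by
  simp [shear]

/-- The swap. -/
noncomputable def swp (K : Type*) [Field K] :
    MvPolynomial (Fin 2) K ≃ₐ[K] MvPolynomial (Fin 2) K :=
  renameEquiv K (Equiv.swap 0 1)

lemma swp_X0 : swp K (X 0) = X 1 := by simp [swp]
lemma swp_X1 : swp K (X 1) = X 0 := by simp [swp]

/-- The tame group. -/
noncomputable def tame (K : Type*) [Field K] : Subgroup (MvPolynomial (Fin 2) K ≃ₐ[K] MvPolynomial (Fin 2) K) :=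
  Subgroup.closure {τ | IsAffineAut K τ ∨ IsElementaryAut K τ}

lemma swp_mem : swp K ∈ tame K := by
  refine Subgroup.subset_closure (Or.inl ⟨0, 1, 0, 1, 0, 0, by simp, ?_, ?_⟩)
  · simp [swp_X0]
  · simp [swp_X1]

lemma shear_mem (c : K) (β : ℕ) : shear c β ∈ tame K := by
  refine Subgroup.subset_closure (Or.inr ⟨1, 1, 0, -(Polynomial.C c * Polynomial.X ^ β),
    one_ne_zero, one_ne_zero, ?_, ?_⟩)
  · rw [shear_X0, map_neg, map_mul, Polynomial.aeval_C, map_pow, Polynomial.aeval_X]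
    simp [sub_eq_add_neg, algebraMap_eq]
  · simp [shear_X1]

lemma mem_of_mul {σ τ : MvPolynomial (Fin 2) K ≃ₐ[K] MvPolynomial (Fin 2) K}
    (hτ : τ ∈ tame K) (h : σ * τ ∈ tame K) : σ ∈ tame K :=
  (Subgroup.mul_mem_cancel_right _ hτ).1 h

/-- evaluation killing `x_i` -/
noncomputable def ev (i : Fin 2) : MvPolynomial (Fin 2) K →ₐ[K] K[X] :=
  aeval (fun j => if j = i then 0 else Polynomial.X)

lemma ev_ker (i : Fin 2) (P : MvPolynomial (Fin 2) K) : ev i P = 0 ↔ X i ∣ P := by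
  constructor
  · intro h
    have : ∀ P : MvPolynomial (Fin 2) K, X i ∣ P - Polynomial.aeval (X (1 - i)) (ev i P) := by
      intro P
      induction P using MvPolynomial.induction_on with
      | C a => simp [ev, algebraMap_eq]
      | add p q hp hq =>
        rw [map_add, map_add, add_sub_add_comm]; exact dvd_add hp hq
      | mul_X p j hp =>
        rw [map_mul, map_mul]
        by_cases hj : j = i
        · subst hj; simp [ev]
        · have hj2 : j = 1 - i := by omega
          have : ev (K := K) i (X j) = Polynomial.X := by simp [ev, hj]
          rw [this, Polynomial.aeval_X, hj2, ← sub_mul]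
          exact Dvd.dvd.mul_right hp _
    have := this P
    rwa [h, map_zero, sub_zero] at this
  · rintro ⟨q, rfl⟩
    simp [ev]

lemma ev_surj (i : Fin 2) : Function.Surjective (ev (K := K) i) := by
  intro p
  refine ⟨Polynomial.aeval (X (1 - i)) p, ?_⟩
  rw [← Polynomial.aeval_algHom_apply]
  have : ev (K := K) i (X (1 - i)) = Polynomial.X := by
    fin_cases i <;> simp [ev]
  rw [this, Polynomial.aeval_X_left_apply]

/-- The parametrization killing `σ x_i`. -/
noncomputable def pim (σ : MvPolynomial (Fin 2) K ≃ₐ[K] MvPolynomial (Fin 2) K) (i : Fin 2) :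
    K[X][X] →ₐ[K] K[X] :=
  (ev i).comp ((σ.symm : MvPolynomial (Fin 2) K →ₐ[K] MvPolynomial (Fin 2) K).comp
    ((Psi K).symm : K[X][X] →ₐ[K] MvPolynomial (Fin 2) K))

lemma pim_apply (σ : MvPolynomial (Fin 2) K ≃ₐ[K] MvPolynomial (Fin 2) K) (i : Fin 2)
    (P : K[X][X]) : pim σ i P = ev i (σ.symm ((Psi K).symm P)) := rfl

lemma pim_Psi (σ : MvPolynomial (Fin 2) K ≃ₐ[K] MvPolynomial (Fin 2) K) (i : Fin 2)
    (q : MvPolynomial (Fin 2) K) : pim σ i (Psi K (σ q)) = ev i q := by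
  simp [pim_apply]

lemma pim_surj (σ : MvPolynomial (Fin 2) K ≃ₐ[K] MvPolynomial (Fin 2) K) (i : Fin 2) :
    Function.Surjective (pim σ i) := by
  intro p
  obtain ⟨q, rfl⟩ := ev_surj i p
  exact ⟨_, pim_Psi σ i q⟩

lemma pim_ker (σ : MvPolynomial (Fin 2) K ≃ₐ[K] MvPolynomial (Fin 2) K) (i : Fin 2)
    (P : K[X][X]) : pim σ i P = 0 ↔ Psi K (σ (X i)) ∣ P := by
  obtain ⟨q, rfl⟩ := (Psi K).surjective P
  obtain ⟨q, rfl⟩ := σ.surjective q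
  rw [pim_Psi, ev_ker, map_dvd_iff, map_dvd_iff]

lemma base (σ : MvPolynomial (Fin 2) K ≃ₐ[K] MvPolynomial (Fin 2) K)
    (h : (Psi K (σ (X 0))).natDegree = 0) : σ ∈ tame K := by
  set v := Psi K (σ (X 1)) with hv
  obtain ⟨p, hp⟩ := Polynomial.natDegree_eq_zero.1 h
  have hsur : ∀ w : MvPolynomial (Fin 2) K, ∃ G : K[X][X],
      (G.map (Polynomial.compRingHom p)).comp v = Psi K (σ w) := by
    intro w
    induction w using MvPolynomial.induction_on with
    | C a =>
      refine ⟨Polynomial.C (Polynomial.C a), ?_⟩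
      have : σ (C a) = C a := σ.commutes a
      simp [this, Psi_C]
    | add a b ha hb =>
      obtain ⟨G, hG⟩ := ha
      obtain ⟨H, hH⟩ := hb
      exact ⟨G + H, by simp [hG, hH]⟩
    | mul_X a j ha =>
      obtain ⟨G, hG⟩ := ha
      fin_cases j
      · exact ⟨G * Polynomial.C Polynomial.X, by simp [hG, ← hp]⟩
      · exact ⟨G * Polynomial.X, by simp [hG, ← hv]⟩
  have hsur' : ∀ w : K[X][X], ∃ G : K[X][X],
      (G.map (Polynomial.compRingHom p)).comp v = w := by
    intro w
    obtain ⟨q, rfl⟩ := (Psi K).surjective w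
    obtain ⟨q, rfl⟩ := σ.surjective q
    exact hsur q
  obtain ⟨G, hG⟩ := hsur' Polynomial.X
  have hd := congrArg Polynomial.natDegree hG
  rw [Polynomial.natDegree_comp, Polynomial.natDegree_X] at hd
  have hv1 : v.natDegree = 1 := Nat.eq_one_of_mul_eq_one_left hd
  have hl := congrArg Polynomial.leadingCoeff hG
  rw [Polynomial.leadingCoeff_comp (by omega), Polynomial.leadingCoeff_X,
    Nat.eq_one_of_mul_eq_one_right hd, pow_one] at hl
  have hunit : IsUnit v.leadingCoeff := IsUnit.of_mul_eq_one_right _ hl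
  obtain ⟨c, hc, hcv⟩ := Polynomial.isUnit_iff.1 hunit
  have hvform : v = Polynomial.C (Polynomial.C c) * Polynomial.X + Polynomial.C (v.coeff 0) := by
    have := Polynomial.eq_X_add_C_of_natDegree_le_one hv1.le
    rw [hcv, Polynomial.leadingCoeff, hv1]
    exact this
  obtain ⟨H, hH⟩ := hsur' (Polynomial.C Polynomial.X)
  have hd2 := congrArg Polynomial.natDegree hH
  rw [Polynomial.natDegree_comp, Polynomial.natDegree_C, hv1, mul_one] at hd2
  rw [Polynomial.eq_C_of_natDegree_eq_zero hd2, Polynomial.C_comp, Polynomial.C_inj,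
    Polynomial.coeff_map] at hH
  have hd3 := congrArg Polynomial.natDegree hH
  rw [Polynomial.coe_compRingHom_apply, Polynomial.natDegree_comp, Polynomial.natDegree_X] at hd3
  have hp1 : p.natDegree = 1 := Nat.eq_one_of_mul_eq_one_left hd3
  have hpform := Polynomial.eq_X_add_C_of_natDegree_le_one hp1.le
  have hpc : p.coeff 1 ≠ 0 := by
    rw [← hp1, Polynomial.coeff_natDegree, Polynomial.leadingCoeff_ne_zero]
    rintro rfl
    simp at hp1
  refine mem_of_mul swp_mem (Subgroup.subset_closure (Or.inr
    ⟨c, p.coeff 1, p.coeff 0, v.coeff 0, hc.ne_zero, hpc, ?_, ?_⟩))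
  · rw [AlgEquiv.mul_apply, swp_X0]
    apply (Psi K).injective
    rw [← hv, map_add, map_mul, Psi_C, Psi_X0, Psi_aeval]
    exact hvform
  · rw [AlgEquiv.mul_apply, swp_X1]
    apply (Psi K).injective
    rw [← hp, map_add, map_mul, Psi_C, Psi_X1, Psi_C, ← Polynomial.C_mul, ← Polynomial.C_add]
    exact congrArg _ hpform

/-- total degree in the outer variable. -/
noncomputable def siz (σ : MvPolynomial (Fin 2) K ≃ₐ[K] MvPolynomial (Fin 2) K) : ℕ :=
  (Psi K (σ (X 0))).natDegree + (Psi K (σ (X 1))).natDegree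

lemma step (σ : MvPolynomial (Fin 2) K ≃ₐ[K] MvPolynomial (Fin 2) K)
    (ih : ∀ τ : MvPolynomial (Fin 2) K ≃ₐ[K] MvPolynomial (Fin 2) K,
      siz τ < siz σ → τ ∈ tame K)
    (hu : 0 < (Psi K (σ (X 0))).natDegree) (hv : 0 < (Psi K (σ (X 1))).natDegree)
    (hd : (Psi K (σ (X 1))).natDegree ∣ (Psi K (σ (X 0))).natDegree) : σ ∈ tame K := by
  obtain ⟨a, ha, hla⟩ := L2 _ _ (pim_ker σ 0) hu
  obtain ⟨b, hb, hlb⟩ := L2 _ _ (pim_ker σ 1) hv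
  obtain ⟨β, hβ⟩ := hd
  set u := Psi K (σ (X 0)) with hu'
  set v := Psi K (σ (X 1)) with hv'
  set c := a / b ^ β with hc
  have hc0 : c ≠ 0 := div_ne_zero ha (pow_ne_zero _ hb)
  refine mem_of_mul (shear_mem c β) (ih _ ?_)
  have e1 : Psi K ((σ * shear c β) (X 1)) = v := by
    rw [AlgEquiv.mul_apply, shear_X1]
  have e0 : Psi K ((σ * shear c β) (X 0)) = u - Polynomial.C (Polynomial.C c) * v ^ β := by
    have : σ (C c) = C c := σ.commutes c
    rw [AlgEquiv.mul_apply, shear_X0]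
    simp only [map_sub, map_mul, map_pow, this, Psi_C, ← hu', ← hv']
  unfold siz
  rw [e0, e1, ← hu', ← hv']
  have hCc : (Polynomial.C c : K[X]) ≠ 0 := by simpa using hc0
  have hu0 : u ≠ 0 := fun h => by simp [h] at hu
  have hv0 : v ≠ 0 := fun h => by simp [h] at hv
  have hw0 : Polynomial.C (Polynomial.C c) * v ^ β ≠ 0 :=
    mul_ne_zero (by rw [Ne, Polynomial.C_eq_zero]; exact hCc) (pow_ne_zero _ hv0)
  have hwd : (Polynomial.C (Polynomial.C c) * v ^ β).natDegree = u.natDegree := by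
    rw [Polynomial.natDegree_C_mul hCc, Polynomial.natDegree_pow, hβ, mul_comm]
  have hlt : (u - Polynomial.C (Polynomial.C c) * v ^ β).degree < u.degree := by
    refine Polynomial.degree_sub_lt_left ?_ hu0 ?_
    · rw [Polynomial.degree_eq_natDegree hu0, Polynomial.degree_eq_natDegree hw0, hwd]
    · rw [Polynomial.leadingCoeff_mul, Polynomial.leadingCoeff_C, Polynomial.leadingCoeff_pow,
        hla, hlb, ← Polynomial.C_pow, ← Polynomial.C_mul, hc,
        div_mul_cancel₀ _ (pow_ne_zero _ hb)]
  have : (u - Polynomial.C (Polynomial.C c) * v ^ β).natDegree < u.natDegree := by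
    by_cases h0 : u - Polynomial.C (Polynomial.C c) * v ^ β = 0
    · rw [h0]; simpa using hu
    · exact Polynomial.natDegree_lt_natDegree h0 hlt
  omega

lemma siz_swp (σ : MvPolynomial (Fin 2) K ≃ₐ[K] MvPolynomial (Fin 2) K) :
    siz (σ * swp K) = siz σ := by
  simp only [siz, AlgEquiv.mul_apply, swp_X0, swp_X1]
  rw [add_comm]

lemma main (n : ℕ) : ∀ σ : MvPolynomial (Fin 2) K ≃ₐ[K] MvPolynomial (Fin 2) K,
    siz σ = n → σ ∈ tame K := by
  induction n using Nat.strong_induction_on with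
  | _ n ih =>
  intro σ hσ
  by_cases hu : (Psi K (σ (X 0))).natDegree = 0
  · exact base σ hu
  by_cases hv : (Psi K (σ (X 1))).natDegree = 0
  · refine mem_of_mul swp_mem (base _ ?_)
    rw [AlgEquiv.mul_apply, swp_X0]; exact hv
  have hu' := Nat.pos_of_ne_zero hu
  have hv' := Nat.pos_of_ne_zero hv
  have ih' : ∀ τ : MvPolynomial (Fin 2) K ≃ₐ[K] MvPolynomial (Fin 2) K,
      siz τ < siz σ → τ ∈ tame K := fun τ hτ => ih _ (hσ ▸ hτ) τ rfl
  rcases divis (pim σ 0) (pim σ 1) (pim_surj σ 0) (pim_surj σ 1) _ _ (pim_ker σ 0)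
    (pim_ker σ 1) hu' hv' (by rw [pim_Psi]; simp [ev]) (by rw [pim_Psi]; simp [ev]) with hd | hd
  · refine mem_of_mul swp_mem (step _ (fun τ hτ => ih' τ (by rwa [siz_swp] at hτ)) ?_ ?_ ?_)
    · rw [AlgEquiv.mul_apply, swp_X0]; exact hv'
    · rw [AlgEquiv.mul_apply, swp_X1]; exact hu'
    · rw [AlgEquiv.mul_apply, AlgEquiv.mul_apply, swp_X1, swp_X0]; exact hd
  · exact step σ ih' hu' hv' hd

end Main
end JvdK

/-- Jung–van der Kulk: the group `GA₂(K)` of `K`-algebra automorphisms of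
`K[x,y]` is generated by the affine and the elementary automorphisms. -/
theorem stmt13 (K : Type*) [Field K]
    (σ : MvPolynomial (Fin 2) K ≃ₐ[K] MvPolynomial (Fin 2) K) :
    σ ∈ Subgroup.closure
      {τ : MvPolynomial (Fin 2) K ≃ₐ[K] MvPolynomial (Fin 2) K |
        IsAffineAut K τ ∨ IsElementaryAut K τ} := by
  exact JvdK.main _ σ rfl
end

section
/- Let x₀ ∈ {0,1}^ℤ be the characteristic function of the square-free integers (x₀(n) = 1 if |n| is square-free, and 0 otherwise), and let X ⊆ {0,1}^ℤ be the orbit closure of x₀ under the shift S, (Sx)_n = x_{n+1}. Then the subshift X has trivial (minimal) centraliser: every homeomorphism G of X with G∘S = S∘G is a power of the shift, so S(X) = ⟨S⟩ ≅ ℤ. -/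
open scoped Classical

instance homeoGroup (X : Type*) [TopologicalSpace X] : Group (X ≃ₜ X) where
  mul f g := g.trans f
  one := Homeomorph.refl X
  inv := Homeomorph.symm
  mul_assoc _ _ _ := rfl
  one_mul _ := Homeomorph.ext fun _ => rfl
  mul_one _ := Homeomorph.ext fun _ => rfl
  inv_mul_cancel := Homeomorph.self_trans_symm

/-- The characteristic function of the square-free integers, as a point of the
full shift `{0,1}^ℤ` (realised as `ℤ → Bool`). -/
noncomputable def sqfPoint : ℤ → Bool := fun n => if Squarefree n.natAbs then true else false

/-- The orbit closure of the square-free point under the shift. -/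
noncomputable def sqfShift : Set (ℤ → Bool) :=
  closure {y : ℤ → Bool | ∃ k : ℤ, y = fun n => sqfPoint (n + k)}

/-- Union bound sieve. -/
lemma sq_sieve (A : Finset ℕ) (Q Y : ℕ) (hA : ∀ b ∈ A, 0 < b) (hY : 4 * (A.card + 1) ≤ Y) :
    ∃ j : ℕ, ∀ b ∈ A, ∀ p : ℕ, Y ≤ p → p.Coprime Q → ¬ p * p ∣ b + Q * j := by
  classical
  set a := A.card with ha
  set B := ∑ b ∈ A, b with hB
  set J := 4 * a ^ 2 * (Q + B) + 4 * a ^ 2 * 1 + 4 * a + 1 with hJ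
  set D := Nat.sqrt (B + Q * J) with hD
  by_contra hcon
  push Not at hcon
  let bad : ℕ → ℕ → Finset ℕ := fun b p =>
    (Finset.range J).filter (fun j => p.Coprime Q ∧ p * p ∣ b + Q * j)
  have hcover : Finset.range J ⊆ A.biUnion (fun b => (Finset.Ioo (Y - 1) (D + 1)).biUnion (bad b)) := by
    intro j hj
    obtain ⟨b, hb, p, hp, hc, hd⟩ := hcon j
    have h1 : b ≤ B := Finset.single_le_sum (f := fun b => b) (fun _ _ => Nat.zero_le _) hb
    have h2 : p * p ≤ B + Q * J := by
      have := Nat.le_of_dvd (by have := hA b hb; omega) hd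
      have h3 : Q * j ≤ Q * J := Nat.mul_le_mul_left _ (Finset.mem_range.1 hj).le
      omega
    have h3 : p ≤ D := Nat.le_sqrt.2 h2
    simp only [Finset.mem_biUnion, Finset.mem_Ioo]
    refine ⟨b, hb, p, ⟨by omega, by omega⟩, ?_⟩
    simp only [bad, Finset.mem_filter]
    exact ⟨hj, hc, hd⟩
  have hbad : ∀ b p, 0 < p → (bad b p).card ≤ J / (p * p) + 1 := by
    intro b p hp
    rw [← Finset.card_range (J / (p * p) + 1)]
    apply Finset.card_le_card_of_injOn (fun j => j / (p * p))
    · intro j hj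
      simp only [bad, Finset.coe_filter, Finset.mem_range, Set.mem_ofPred_eq] at hj
      simp only [Finset.coe_range, Set.mem_Iio]
      exact Nat.lt_succ_of_le (Nat.div_le_div_right hj.1.le)
    · intro i hi j hj hij
      simp only [bad, Finset.coe_filter, Finset.mem_range, Set.mem_ofPred_eq] at hi hj
      have hmod : i % (p * p) = j % (p * p) := by
        have h1 : b + Q * i ≡ b + Q * j [MOD p * p] :=
          ((Nat.modEq_zero_iff_dvd).2 hi.2.2).trans ((Nat.modEq_zero_iff_dvd).2 hj.2.2).symm
        have h2 := Nat.ModEq.add_left_cancel' b h1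
        exact Nat.ModEq.cancel_left_of_coprime
          (Nat.Coprime.mul_left hi.2.1 hi.2.1) h2
      simp only at hij
      rw [← Nat.div_add_mod i (p * p), ← Nat.div_add_mod j (p * p), hij, hmod]
  have hcard : (J : ℝ) ≤ a * (J * (2 / Y) + D) := by
    have h1 : J ≤ ∑ b ∈ A, ∑ p ∈ Finset.Ioo (Y - 1) (D + 1), (J / (p * p) + 1) := by
      calc J = (Finset.range J).card := (Finset.card_range J).symm
        _ ≤ _ := Finset.card_le_card hcover
        _ ≤ ∑ b ∈ A, ((Finset.Ioo (Y - 1) (D + 1)).biUnion (bad b)).card := Finset.card_biUnion_le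
        _ ≤ _ := Finset.sum_le_sum fun b _ => Finset.card_biUnion_le.trans
          (Finset.sum_le_sum fun p hp => hbad b p (by simp only [Finset.mem_Ioo] at hp; omega))
    rw [Finset.sum_const, smul_eq_mul] at h1
    have h2 : ((∑ p ∈ Finset.Ioo (Y - 1) (D + 1), (J / (p * p) + 1) : ℕ) : ℝ) ≤ J * (2 / Y) + D := by
      push_cast
      rw [Finset.sum_add_distrib]
      have h3 := sum_Ioo_inv_sq_le (α := ℝ) (Y - 1) (D + 1)
      have hY1 : ((Y - 1 : ℕ) : ℝ) + 1 = Y := by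
        have : 1 ≤ Y := by omega
        push_cast [this]; ring
      rw [hY1] at h3
      gcongr ?_ + ?_
      · calc _ ≤ ∑ p ∈ Finset.Ioo (Y - 1) (D + 1), (J : ℝ) * ((p : ℝ) ^ 2)⁻¹ := by
              apply Finset.sum_le_sum
              intro p _
              refine (Nat.cast_div_le).trans ?_
              push_cast
              rw [div_eq_mul_inv, sq]
          _ = J * ∑ p ∈ Finset.Ioo (Y - 1) (D + 1), ((p : ℝ) ^ 2)⁻¹ := by rw [Finset.mul_sum]
          _ ≤ _ := by gcongr
      · simp only [Finset.sum_const, nsmul_eq_mul, mul_one]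
        have : (Finset.Ioo (Y - 1) (D + 1)).card ≤ D := by rw [Nat.card_Ioo]; omega
        exact_mod_cast this
    calc (J : ℝ) ≤ a * ((∑ p ∈ Finset.Ioo (Y - 1) (D + 1), (J / (p * p) + 1) : ℕ) : ℝ) := by
          rw [← Nat.cast_mul]; exact Nat.cast_le.2 h1
      _ ≤ _ := by gcongr
  have hJpos : (0 : ℝ) < J := by exact_mod_cast (by omega : 0 < J)
  have h4 : (a : ℝ) * (J * (2 / Y)) ≤ J / 2 := by
    have hYpos : (0 : ℝ) < Y := by exact_mod_cast (by omega : 0 < Y)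
    have : (4 : ℝ) * (a + 1) ≤ Y := by exact_mod_cast hY
    rw [show (a : ℝ) * (J * (2 / Y)) = (2 * a * J) / Y by ring, div_le_iff₀ hYpos]
    nlinarith
  have h5 : (J : ℝ) ≤ 2 * a * D := by linarith
  have h6 : J ≤ 2 * a * D := by exact_mod_cast h5
  have h7 : D * D ≤ B + Q * J := Nat.sqrt_le _
  have h8 : J * J ≤ 4 * a ^ 2 * (B + Q * J) := by
    calc J * J ≤ (2 * a * D) * (2 * a * D) := Nat.mul_le_mul h6 h6
      _ = 4 * a ^ 2 * (D * D) := by ring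
      _ ≤ _ := Nat.mul_le_mul_left _ h7
  have h9 : 4 * a ^ 2 * (B + Q * J) < J * J := by
    have hJ1 : 1 ≤ J := by omega
    calc 4 * a ^ 2 * (B + Q * J) ≤ 4 * a ^ 2 * (B * J + Q * J) := by
          gcongr; nlinarith
      _ = (4 * a ^ 2 * (Q + B)) * J := by ring
      _ < J * J := by
          apply Nat.mul_lt_mul_of_pos_right _ hJ1
          omega
  omega

/-- Admissibility of a finite set of integers. -/
def SqAdm (A : Finset ℤ) : Prop :=
  ∀ p : ℕ, p.Prime → ∃ r : ℤ, ∀ a ∈ A, ¬ (p : ℤ) ^ 2 ∣ a - r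

lemma SqAdm.mono {A B : Finset ℤ} (h : SqAdm B) (hAB : A ⊆ B) : SqAdm A := fun p hp => by
  obtain ⟨r, hr⟩ := h p hp
  exact ⟨r, fun a ha => hr a (hAB ha)⟩

lemma sq_dvd_natAbs (p : ℕ) (m : ℤ) : p * p ∣ m.natAbs ↔ (p : ℤ) ^ 2 ∣ m := by
  rw [← Int.natCast_dvd, sq]; push_cast; rfl

lemma sq_realize_aux (A : Finset ℤ) (hA : SqAdm A) (N : ℕ) (hN : ∀ a ∈ A, |a| ≤ N) :
    ∃ k : ℤ, ∀ n : ℤ, |n| ≤ N → (Squarefree (n + k).natAbs ↔ n ∈ A) := by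
  classical
  let f : ℤ → ℕ := fun n => Nat.nth Nat.Prime ((n + N).toNat + 2 * N + 1)
  have hfp : ∀ n, (f n).Prime := fun n => Nat.prime_nth_prime _
  have hfinj : ∀ n m : ℤ, |n| ≤ N → |m| ≤ N → f n = f m → n = m := by
    intro n m hn hm h
    have := Nat.nth_injective Nat.infinite_setOfPred_prime h
    rw [abs_le] at hn hm
    omega
  have hflarge : ∀ n, 2 * N + 1 < f n := by
    intro n
    have := Nat.add_two_le_nth_prime ((n + N).toNat + 2 * N + 1)
    simp only [f]; omega
  have hfle : ∀ n : ℤ, |n| ≤ N → f n ≤ f N := by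
    intro n hn
    rw [abs_le] at hn
    apply Nat.nth_monotone Nat.infinite_setOfPred_prime
    omega
  have hloc : ∀ q : ℕ, ∃ ρ : ℤ, q.Prime → (∀ a ∈ A, ¬ (q : ℤ) ^ 2 ∣ a + ρ) ∧
      (∀ n : ℤ, |n| ≤ N → n ∉ A → f n = q → (q : ℤ) ^ 2 ∣ n + ρ) := by
    intro q
    by_cases hq : q.Prime
    swap
    · exact ⟨0, fun h => absurd h hq⟩
    by_cases h : ∃ n : ℤ, |n| ≤ N ∧ n ∉ A ∧ f n = q
    · obtain ⟨n, hn, hnA, hfn⟩ := h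
      refine ⟨-n, fun _ => ⟨?_, ?_⟩⟩
      · intro a ha hd
        have haN := hN a ha
        have hne : a + -n ≠ 0 := by
          intro h0
          have : a = n := by omega
          exact hnA (this ▸ ha)
        have h1 := Int.le_of_dvd (abs_pos.2 hne) ((dvd_abs _ _).2 hd)
        have h2 := hflarge n
        rw [hfn] at h2
        have h3 : |a + -n| ≤ 2 * N := by
          rw [abs_le] at *
          omega
        have h4 : (2 * N + 1 : ℤ) < q := by exact_mod_cast h2
        nlinarith
      · intro m hm _ hfm
        have := hfinj n m hn hm (hfn.trans hfm.symm)
        subst this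
        simp
    · obtain ⟨r, hr⟩ := hA q hq
      refine ⟨-r, fun _ => ⟨fun a ha => by simpa [sub_eq_add_neg] using hr a ha, ?_⟩⟩
      intro n hn hnA hfn
      exact absurd ⟨n, hn, hnA, hfn⟩ h
  choose ρ hρ using hloc
  set Y := f N + 1 + 4 * (A.card + 1) with hY
  set T := (Finset.range Y).filter Nat.Prime with hT
  obtain ⟨k0, hk0⟩ := Nat.chineseRemainderOfFinset (fun q => (ρ q % (q : ℤ) ^ 2).toNat)
    (fun q => q ^ 2) T (by
      intro q hq
      have := (Finset.mem_filter.1 hq).2.pos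
      positivity) (by
      intro p hp q hq hpq
      have hp' := (Finset.mem_filter.1 hp).2
      have hq' := (Finset.mem_filter.1 hq).2
      exact Nat.Coprime.pow _ _ ((Nat.coprime_primes hp' hq').2 hpq))
  have hk0' : ∀ q ∈ T, (q : ℤ) ^ 2 ∣ k0 - ρ q := by
    intro q hq
    have h1 := hk0 q hq
    have hqpos : (0 : ℤ) < (q : ℤ) ^ 2 := by
      have := (Finset.mem_filter.1 hq).2.pos
      positivity
    have h2 := (Int.natCast_modEq_iff.2 h1)
    simp only [Int.toNat_of_nonneg (Int.emod_nonneg _ hqpos.ne')] at h2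
    push_cast at h2
    have h3 : (k0 : ℤ) ≡ ρ q [ZMOD (q : ℤ) ^ 2] := h2.trans (Int.mod_modEq _ _)
    exact h3.symm.dvd
  set Q := ∏ q ∈ T, q ^ 2 with hQ
  have hQpos : 0 < Q := Finset.prod_pos fun q hq => by
    have := (Finset.mem_filter.1 hq).2.pos
    positivity
  set k1 : ℕ := k0 + Q * (N + 1) with hk1
  have hk1N : N + 1 ≤ k1 := by
    have : N + 1 ≤ Q * (N + 1) := Nat.le_mul_of_pos_left _ hQpos
    omega
  obtain ⟨j, hj⟩ := sq_sieve (A.image fun a : ℤ => (a + k1).toNat) Q Y (by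
    intro b hb
    obtain ⟨a, ha, rfl⟩ := Finset.mem_image.1 hb
    have := hN a ha
    rw [abs_le] at this
    omega) (by
    have : (A.image fun a : ℤ => (a + k1).toNat).card ≤ A.card := Finset.card_image_le
    omega)
  have hkey : ∀ q ∈ T, (q : ℤ) ^ 2 ∣ ((k1 + Q * j : ℕ) : ℤ) - ρ q := by
    intro q hq
    have h1 : (q : ℤ) ^ 2 ∣ (Q : ℤ) := by
      have : q ^ 2 ∣ Q := Finset.dvd_prod_of_mem _ hq
      exact_mod_cast this
    have h2 : ((k1 + Q * j : ℕ) : ℤ) - ρ q = (k0 - ρ q) + Q * (N + 1 + j) := by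
      rw [hk1]; push_cast; ring
    rw [h2]
    exact dvd_add (hk0' q hq) (Dvd.dvd.mul_right h1 _)
  refine ⟨((k1 + Q * j : ℕ) : ℤ), fun n hn => ?_⟩
  constructor
  · intro hs
    by_contra hnA
    have hmem : f n ∈ T := by
      rw [hT, Finset.mem_filter, Finset.mem_range]
      have := hfle n hn
      exact ⟨by omega, hfp n⟩
    rw [Nat.squarefree_iff_prime_squarefree] at hs
    apply hs (f n) (hfp n)
    rw [sq_dvd_natAbs]
    have h1 := (hρ (f n) (hfp n)).2 n hn hnA rfl
    have h2 := hkey _ hmem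
    rw [show n + ((k1 + Q * j : ℕ) : ℤ) = (n + ρ (f n)) + (((k1 + Q * j : ℕ) : ℤ) - ρ (f n)) by ring]
    exact dvd_add h1 h2
  · intro hnA
    rw [Nat.squarefree_iff_prime_squarefree]
    intro p hp hd
    by_cases hpY : p < Y
    · have hmem : p ∈ T := by
        rw [hT, Finset.mem_filter, Finset.mem_range]; exact ⟨hpY, hp⟩
      apply (hρ p hp).1 n hnA
      rw [sq_dvd_natAbs] at hd
      rw [show n + ρ p = (n + ((k1 + Q * j : ℕ) : ℤ)) - (((k1 + Q * j : ℕ) : ℤ) - ρ p) by ring]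
      exact dvd_sub hd (hkey _ hmem)
    · apply hj _ (Finset.mem_image_of_mem _ hnA) p (by omega)
      · apply Nat.Coprime.prod_right
        intro q hq
        apply Nat.Coprime.pow_right
        rw [Nat.coprime_primes hp (Finset.mem_filter.1 hq).2]
        rintro rfl
        exact hpY (Finset.mem_range.1 (Finset.mem_filter.1 hq).1)
      · convert hd using 2
        rw [abs_le] at hn
        push_cast
        have : (0 : ℤ) ≤ Q * j := by positivity
        zify
        rw [Int.toNat_of_nonneg (by omega), abs_of_nonneg (by omega)]
        ring

lemma sq_realize (A : Finset ℤ) (hA : SqAdm A) (N : ℕ) :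
    ∃ k : ℤ, ∀ n : ℤ, |n| ≤ N → (Squarefree (n + k).natAbs ↔ n ∈ A) := by
  classical
  obtain ⟨k, hk⟩ := sq_realize_aux (A.filter fun a => |a| ≤ N)
    (hA.mono (Finset.filter_subset _ _)) N (fun a ha => (Finset.mem_filter.1 ha).2)
  refine ⟨k, fun n hn => ?_⟩
  rw [hk n hn, Finset.mem_filter]
  exact ⟨fun h => h.1, fun h => ⟨h, hn⟩⟩

/-- Indicator point of a finite set. -/
def sqInd (A : Finset ℤ) : ℤ → Bool := fun n => decide (n ∈ A)

lemma sqInd_true {A : Finset ℤ} {n : ℤ} : sqInd A n = true ↔ n ∈ A := by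
  simp [sqInd]

lemma sqfPoint_true {n : ℤ} : sqfPoint n = true ↔ Squarefree n.natAbs := by
  simp [sqfPoint]

lemma sqInd_mem {A : Finset ℤ} (hA : SqAdm A) : sqInd A ∈ sqfShift := by
  choose k hk using sq_realize A hA
  refine mem_closure_of_tendsto (f := fun N : ℕ => fun n : ℤ => sqfPoint (n + k N))
    (b := Filter.atTop) ?_ (Filter.Eventually.of_forall fun N => ⟨k N, rfl⟩)
  rw [tendsto_pi_nhds]
  intro n
  apply tendsto_const_nhds.congr'
  filter_upwards [Filter.eventually_ge_atTop n.natAbs] with N hN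
  rw [Bool.eq_iff_iff, sqInd_true, sqfPoint_true, hk N n (by rw [abs_le]; omega)]

lemma sqAdm_of_mem {x : ℤ → Bool} (hx : x ∈ sqfShift) (C : Finset ℤ)
    (hC : ∀ c ∈ C, x c = true) : SqAdm C := by
  have hopen : IsOpen {y : ℤ → Bool | ∀ c ∈ C, y c = true} := by
    have : {y : ℤ → Bool | ∀ c ∈ C, y c = true} = ⋂ c ∈ C, {y : ℤ → Bool | y c = true} := by
      ext y; simp
    rw [this]
    apply isOpen_biInter_finset
    intro c _
    have h : IsOpen ((fun y : ℤ → Bool => y c) ⁻¹' {true}) :=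
      (isOpen_discrete _).preimage (continuous_apply c)
    exact h
  obtain ⟨y, hy, k, rfl⟩ := mem_closure_iff.1 hx _ hopen hC
  intro p hp
  refine ⟨-k, fun c hc hd => ?_⟩
  have h1 := hy c hc
  rw [sqfPoint_true, Nat.squarefree_iff_prime_squarefree] at h1
  apply h1 p hp
  rw [sq_dvd_natAbs]
  simpa using hd

lemma sqShift_mem (k : ℤ) {x : ℤ → Bool} (hx : x ∈ sqfShift) :
    (fun n => x (n + k)) ∈ sqfShift := by
  have hc : Continuous (fun (x : ℤ → Bool) (n : ℤ) => x (n + k)) :=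
    continuous_pi fun n => continuous_apply (n + k)
  refine map_mem_closure hc hx ?_
  rintro _ ⟨l, rfl⟩
  exact ⟨k + l, by funext n; simp only [add_assoc]⟩

lemma sqSh_cont (k : ℤ) : Continuous
    (fun x : sqfShift => (⟨fun n => x.1 (n + k), sqShift_mem k x.2⟩ : sqfShift)) := by
  apply Continuous.subtype_mk
  apply continuous_pi
  intro n
  exact (continuous_apply (n + k)).comp continuous_subtype_val

/-- The shift by `k` as a self-homeomorphism. -/
def sqSh (k : ℤ) : sqfShift ≃ₜ sqfShift where
  toFun x := ⟨fun n => x.1 (n + k), sqShift_mem k x.2⟩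
  invFun x := ⟨fun n => x.1 (n + -k), sqShift_mem (-k) x.2⟩
  left_inv x := by ext n; simp
  right_inv x := by ext n; simp
  continuous_toFun := sqSh_cont k
  continuous_invFun := sqSh_cont (-k)

lemma sqSh_apply (k : ℤ) (x : sqfShift) (n : ℤ) : (sqSh k x).1 n = x.1 (n + k) := rfl

lemma sq_mul_apply (f g : sqfShift ≃ₜ sqfShift) (x : sqfShift) : (f * g) x = f (g x) := rfl

lemma sqSh_add (a b : ℤ) : sqSh (a + b) = sqSh a * sqSh b := by
  ext x n
  rw [sq_mul_apply, sqSh_apply, sqSh_apply, sqSh_apply, add_assoc]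

lemma sqSh_zpow (k : ℤ) : sqSh 1 ^ k = sqSh k := by
  have h0 : sqSh 0 = 1 := by
    ext x n
    change x.1 (n + 0) = x.1 n
    rw [add_zero]
  have hneg : (sqSh 1)⁻¹ = sqSh (-1) := by
    rw [inv_eq_iff_mul_eq_one, ← sqSh_add]
    exact h0
  induction k using Int.induction_on with
  | zero => rw [zpow_zero, h0]
  | succ i ih => rw [zpow_add_one, ih, ← sqSh_add]
  | pred i ih => rw [zpow_sub_one, ih, hneg, ← sqSh_add]; rfl

/-- Locality of a map with radius `R`. -/
def SqLocal (g : sqfShift → sqfShift) (R : ℕ) : Prop :=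
  ∀ (x y : sqfShift) (n : ℤ), (∀ m : ℤ, |m - n| ≤ R → x.1 m = y.1 m) → (g x).1 n = (g y).1 n

lemma sq_tendsto (x : sqfShift) (y : ℕ → sqfShift)
    (h : ∀ N : ℕ, ∀ m : ℤ, |m| ≤ N → (y N).1 m = x.1 m) :
    Filter.Tendsto y Filter.atTop (nhds x) := by
  rw [tendsto_subtype_rng, tendsto_pi_nhds]
  intro n
  apply tendsto_const_nhds.congr'
  filter_upwards [Filter.eventually_ge_atTop n.natAbs] with N hN
  exact (h N n (by rw [abs_le]; omega)).symm

lemma sq_local (g : sqfShift → sqfShift) (hg : Continuous g)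
    (hcomm : ∀ k x, g (sqSh k x) = sqSh k (g x)) : ∃ R, SqLocal g R := by
  classical
  have hφ : Continuous (fun x => (g x).1 0) :=
    (continuous_apply (0 : ℤ)).comp (continuous_subtype_val.comp hg)
  have h1 : ∀ x : sqfShift, ∃ N : ℕ, ∀ y : sqfShift,
      (∀ m : ℤ, |m| ≤ N → y.1 m = x.1 m) → (g y).1 0 = (g x).1 0 := by
    intro x
    by_contra hcon
    push Not at hcon
    choose y hy hne using hcon
    have ht := (hφ.tendsto x).comp (sq_tendsto x y hy)
    rw [nhds_discrete, Filter.tendsto_pure] at ht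
    obtain ⟨N, hN⟩ := ht.exists
    exact hne N hN
  choose N hN using h1
  let U : sqfShift → Set sqfShift := fun x => {y | ∀ m ∈ Finset.Icc (-(N x : ℤ)) (N x), y.1 m = x.1 m}
  have hU : ∀ x, U x ∈ nhds x := by
    intro x
    apply IsOpen.mem_nhds
    · have : U x = ⋂ m ∈ Finset.Icc (-(N x : ℤ)) (N x), {y : sqfShift | y.1 m = x.1 m} := by
        ext y; simp [U]
      rw [this]
      apply isOpen_biInter_finset
      intro m _
      have hc : Continuous (fun y : sqfShift => y.1 m) :=
        (continuous_apply m).comp continuous_subtype_val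
      have h : IsOpen ((fun y : sqfShift => y.1 m) ⁻¹' {x.1 m}) :=
        (isOpen_discrete _).preimage hc
      exact h
    · intro m _; rfl
  have : CompactSpace sqfShift := isCompact_iff_compactSpace.1 isClosed_closure.isCompact
  obtain ⟨t, -, ht⟩ := (isCompact_univ (X := sqfShift)).elim_nhds_subcover U (fun x _ => hU x)
  have h0 : ∀ x y : sqfShift, (∀ m : ℤ, |m| ≤ (t.sup N : ℕ) → x.1 m = y.1 m) →
      (g x).1 0 = (g y).1 0 := by
    intro x y hxy
    have hx := ht (Set.mem_univ x)
    simp only [Set.mem_iUnion] at hx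
    obtain ⟨z, hz, hxz⟩ := hx
    have hle : N z ≤ t.sup N := Finset.le_sup hz
    have h2 : ∀ m : ℤ, |m| ≤ N z → x.1 m = z.1 m := fun m hm =>
      hxz m (Finset.mem_Icc.2 (abs_le.1 hm))
    rw [hN z x h2, hN z y (fun m hm => by
      rw [← h2 m hm]; exact (hxy m (hm.trans (by exact_mod_cast hle))).symm)]
  refine ⟨t.sup N, fun x y n hxy => ?_⟩
  have h3 := h0 (sqSh n x) (sqSh n y) (fun m hm => hxy (m + n) (by simpa using hm))
  rw [hcomm, hcomm, sqSh_apply, sqSh_apply, zero_add] at h3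
  exact h3

lemma sq_extend (A : Finset ℤ) (hA : SqAdm A) (a0 : ℤ) (ha0 : a0 ∈ A) (n : ℤ) (p : ℕ)
    (hp : p.Prime) (hpA : ∀ a ∈ A, ¬ (p : ℤ) ^ 2 ∣ a - n) (L : ℕ) :
    ∃ C : Finset ℤ, SqAdm (A ∪ C) ∧ (∀ c ∈ C, (L : ℤ) < c) ∧
      (∀ c ∈ C, ∀ d ∈ C, c ≠ d → (L : ℤ) < |c - d|) ∧
      (∀ t : ℤ, ¬ (p : ℤ) ^ 2 ∣ t - n → ∃ c ∈ C, (p : ℤ) ^ 2 ∣ t - c) := by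
  classical
  set B : ℕ := A.card + p ^ 2 with hB
  set T := (Finset.range (B + 1)).filter (fun q => q.Prime ∧ q ≠ p) with hT
  set M : ℕ := ∏ q ∈ T, q ^ 2 with hM
  have hppos : (0 : ℤ) < (p : ℤ) ^ 2 := by have := hp.pos; positivity
  have hMpos : (1 : ℤ) ≤ M := by
    have : 0 < M := Finset.prod_pos fun q hq => by
      have := (Finset.mem_filter.1 hq).2.1.pos
      positivity
    exact_mod_cast this
  have hcop : Nat.Coprime M (p ^ 2) := by
    apply Nat.Coprime.prod_left
    intro q hq
    have := (Finset.mem_filter.1 hq).2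
    exact Nat.Coprime.pow _ _ ((Nat.coprime_primes this.1 hp).2 this.2)
  obtain ⟨u, v, huv⟩ := Nat.isCoprime_iff_coprime.2 hcop
  push_cast at huv
  let e : ℕ → ℤ := fun j => ((n + j - a0) * u) % (p : ℤ) ^ 2
  let c : ℕ → ℤ := fun j => a0 + M * e j + M * (p : ℤ) ^ 2 * ((L + 2 + |a0|) * (j + 1))
  have he0 : ∀ j, 0 ≤ e j := fun j => Int.emod_nonneg _ hppos.ne'
  have he1 : ∀ j, e j < (p : ℤ) ^ 2 := fun j => Int.emod_lt_of_pos _ hppos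
  have hcp : ∀ j : ℕ, (p : ℤ) ^ 2 ∣ c j - (n + j) := by
    intro j
    have h1 : (p : ℤ) ^ 2 ∣ (n + j - a0) * u - e j := Int.dvd_self_sub_emod
    obtain ⟨w, hw⟩ := h1
    refine ⟨-M * w - v * (n + j - a0) + M * ((L + 2 + |a0|) * (j + 1)), ?_⟩
    simp only [c]
    have : e j = (n + j - a0) * u - (p : ℤ) ^ 2 * w := by linarith
    rw [this]
    linear_combination (n + j - a0) * huv
  have hcq : ∀ q ∈ T, ∀ j, (q : ℤ) ^ 2 ∣ c j - a0 := by
    intro q hq j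
    have h1 : (q : ℤ) ^ 2 ∣ (M : ℤ) := by
      have : q ^ 2 ∣ M := Finset.dvd_prod_of_mem _ hq
      exact_mod_cast this
    have : c j - a0 = M * (e j + (p : ℤ) ^ 2 * ((L + 2 + |a0|) * (j + 1))) := by
      simp only [c]; ring
    rw [this]
    exact h1.mul_right _
  have hMp : 1 ≤ M * (p : ℤ) ^ 2 := by nlinarith
  have hgap : ∀ i j : ℕ, i < j → (L : ℤ) < c j - c i := by
    intro i j hij
    have h1 : c j - c i = M * (e j - e i) + M * (p : ℤ) ^ 2 * ((L + 2 + |a0|) * (j - i)) := by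
      simp only [c]; ring
    have h2 : (1 : ℤ) ≤ j - i := by omega
    have h3 : (L + 2 : ℤ) ≤ (L + 2 + |a0|) * (j - i) := by
      have := abs_nonneg a0
      nlinarith
    have h4 : - (M * (p : ℤ) ^ 2) ≤ M * (e j - e i) := by
      have := he0 j
      have := he1 i
      nlinarith
    have h5 : (L : ℤ) + 1 ≤ M * (p : ℤ) ^ 2 * ((L + 2 + |a0|) * (j - i) - 1) := by nlinarith
    rw [h1]
    linarith
  refine ⟨(Finset.Ico 1 (p ^ 2)).image c, ?_, ?_, ?_, ?_⟩
  · intro q hq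
    by_cases hqp : q = p
    · subst hqp
      refine ⟨n, fun a ha => ?_⟩
      rcases Finset.mem_union.1 ha with ha | ha
      · exact hpA a ha
      · obtain ⟨j, hj, rfl⟩ := Finset.mem_image.1 ha
        intro hd
        have h1 := dvd_sub hd (hcp j)
        rw [show c j - n - (c j - (n + j)) = (j : ℤ) by ring] at h1
        rw [Finset.mem_Ico] at hj
        have h2 : q ^ 2 ∣ j := by exact_mod_cast h1
        have := Nat.le_of_dvd (by omega) h2
        omega
    by_cases hqB : q ≤ B
    · have hqT : q ∈ T := by
        rw [hT, Finset.mem_filter, Finset.mem_range]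
        exact ⟨by omega, hq, hqp⟩
      obtain ⟨r, hr⟩ := hA q hq
      refine ⟨r, fun a ha => ?_⟩
      rcases Finset.mem_union.1 ha with ha | ha
      · exact hr a ha
      · obtain ⟨j, hj, rfl⟩ := Finset.mem_image.1 ha
        intro hd
        apply hr a0 ha0
        have := dvd_sub hd (hcq q hqT j)
        rwa [show c j - r - (c j - a0) = a0 - r by ring] at this
    · set E := A ∪ (Finset.Ico 1 (p ^ 2)).image c with hE
      have hqpos : (0 : ℤ) < (q : ℤ) ^ 2 := by have := hq.pos; positivity
      have hcard : (E.image (fun a => a % (q : ℤ) ^ 2)).card < (Finset.Ico (0 : ℤ) ((q : ℤ) ^ 2)).card := by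
        have h1 : (E.image (fun a => a % (q : ℤ) ^ 2)).card ≤ E.card := Finset.card_image_le
        have h2 : E.card ≤ A.card + ((Finset.Ico 1 (p ^ 2)).image c).card := Finset.card_union_le _ _
        have h3 : ((Finset.Ico 1 (p ^ 2)).image c).card ≤ (Finset.Ico 1 (p ^ 2)).card :=
          Finset.card_image_le
        rw [Nat.card_Ico] at h3
        rw [Int.card_Ico]
        have h4 : ((q : ℤ) ^ 2 - 0).toNat = q ^ 2 := by
          rw [sub_zero, ← Nat.cast_pow, Int.toNat_natCast]
        rw [h4]
        have h5 : q ≤ q ^ 2 := Nat.le_self_pow (by norm_num) q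
        omega
      obtain ⟨r, hr1, hr2⟩ := Finset.exists_mem_notMem_of_card_lt_card hcard
      refine ⟨r, fun a ha hd => hr2 (Finset.mem_image.2 ⟨a, ha, ?_⟩)⟩
      rw [Finset.mem_Ico] at hr1
      rw [Int.emod_eq_emod_iff_emod_sub_eq_zero.2 (Int.emod_eq_zero_of_dvd hd)]
      exact Int.emod_eq_of_lt hr1.1 hr1.2
  · intro d hd
    obtain ⟨j, hj, rfl⟩ := Finset.mem_image.1 hd
    have h1 : (L + 2 + |a0| : ℤ) ≤ M * (p : ℤ) ^ 2 * ((L + 2 + |a0|) * (j + 1)) := by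
      have h2 : (L + 2 + |a0| : ℤ) ≤ (L + 2 + |a0|) * (j + 1) := by
        have := abs_nonneg a0
        have : (0 : ℤ) ≤ j := by positivity
        nlinarith
      have := abs_nonneg a0
      nlinarith
    have h3 : 0 ≤ M * e j := mul_nonneg (by positivity) (he0 j)
    have h4 := neg_abs_le a0
    simp only [c]
    linarith
  · intro d hd d' hd' hne
    obtain ⟨i, hi, rfl⟩ := Finset.mem_image.1 hd
    obtain ⟨j, hj, rfl⟩ := Finset.mem_image.1 hd'
    rcases lt_trichotomy i j with h | h | h
    · rw [abs_sub_comm]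
      exact (hgap i j h).trans_le (le_abs_self _)
    · exact absurd (by rw [h]) hne
    · exact (hgap j i h).trans_le (le_abs_self _)
  · intro t ht
    have h0 := Int.emod_nonneg (t - n) hppos.ne'
    have h1 := Int.emod_lt_of_pos (t - n) hppos
    have h2 : (t - n) % (p : ℤ) ^ 2 ≠ 0 := fun h => ht (Int.dvd_of_emod_eq_zero h)
    set j := ((t - n) % (p : ℤ) ^ 2).toNat with hj
    have hjc : (j : ℤ) = (t - n) % (p : ℤ) ^ 2 := Int.toNat_of_nonneg h0
    refine ⟨c j, Finset.mem_image_of_mem _ ?_, ?_⟩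
    · rw [Finset.mem_Ico]
      refine ⟨by omega, ?_⟩
      zify
      omega
    · have h3 : (p : ℤ) ^ 2 ∣ (t - n) - j := by rw [hjc]; exact Int.dvd_self_sub_emod
      have := dvd_sub h3 (hcp j)
      rwa [show t - n - j - (c j - (n + j)) = t - c j by ring] at this

lemma sq_not_adm (x : sqfShift) (p : ℕ) (hp : p.Prime) (C : Finset ℤ)
    (hC : ∀ c ∈ C, x.1 c = true) (h : ∀ t : ℤ, ∃ c ∈ C, (p : ℤ) ^ 2 ∣ t - c) : False := by
  obtain ⟨r, hr⟩ := sqAdm_of_mem x.2 C hC p hp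
  obtain ⟨c, hc, hd⟩ := h r
  exact hr c hc ((dvd_sub_comm).1 hd)

lemma sqAdm_singleton (a : ℤ) : SqAdm {a} := by
  intro p hp
  refine ⟨a + 1, fun b hb hd => ?_⟩
  rw [Finset.mem_singleton] at hb
  subst hb
  have h1 : (p : ℤ) ^ 2 ∣ 1 := by
    have := (dvd_neg).2 hd
    simpa using this
  have h2 : p ^ 2 ∣ 1 := by exact_mod_cast h1
  have h3 := Nat.le_of_dvd one_pos h2
  have := hp.two_le
  nlinarith

/-- Point of the shift given by a finite admissible set. -/
def sqPt (A : Finset ℤ) (hA : SqAdm A) : sqfShift := ⟨sqInd A, sqInd_mem hA⟩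

lemma sqPt_true {A : Finset ℤ} {hA : SqAdm A} {n : ℤ} : (sqPt A hA).1 n = true ↔ n ∈ A :=
  sqInd_true

lemma sqAdm_empty : SqAdm ∅ := (sqAdm_singleton 0).mono (Finset.empty_subset _)

lemma sq_exists_prime (B : ℤ) : ∃ p : ℕ, p.Prime ∧ ∀ m : ℤ, m ≠ 0 → |m| ≤ B → ¬ (p : ℤ) ^ 2 ∣ m := by
  obtain ⟨p, hpB, hp⟩ := Nat.exists_infinite_primes (B.toNat + 1)
  refine ⟨p, hp, fun m hm hmB hd => ?_⟩
  have h1 := Int.le_of_dvd (abs_pos.2 hm) ((dvd_abs _ _).2 hd)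
  have h2 : B < p := by omega
  have h3 : (1 : ℤ) ≤ p := by exact_mod_cast hp.pos
  nlinarith

lemma sq_subset (g : sqfShift → sqfShift) (R : ℕ) (hR : SqLocal g R)
    (h0 : g (sqPt ∅ sqAdm_empty) = sqPt ∅ sqAdm_empty)
    (h1 : ∀ c, g (sqPt {c} (sqAdm_singleton c)) = sqPt {c} (sqAdm_singleton c))
    (A : Finset ℤ) (hA : SqAdm A) (n : ℤ) (hn : (g (sqPt A hA)).1 n = true) : n ∈ A := by
  classical
  by_contra hnA
  rcases A.eq_empty_or_nonempty with rfl | ⟨a0, ha0⟩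
  · rw [h0, sqPt_true] at hn
    exact hnA hn
  set K : ℕ := ∑ a ∈ A, (a - n).natAbs with hK
  have hKA : ∀ a ∈ A, |a - n| ≤ K := by
    intro a ha
    have : (a - n).natAbs ≤ K :=
      Finset.single_le_sum (f := fun a => (a - n).natAbs) (fun _ _ => Nat.zero_le _) ha
    rw [abs_le]
    omega
  obtain ⟨p, hp, hpK⟩ := sq_exists_prime K
  obtain ⟨C, hC1, hC2, hC3, hC4⟩ := sq_extend A hA a0 ha0 n p hp
    (fun a ha => hpK _ (fun h => hnA (by rwa [← sub_eq_zero.1 h])) (hKA a ha))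
    (2 * R + K + n.natAbs + 1)
  push_cast at hC2 hC3
  have hnn := abs_le.1 (le_refl |n|)
  refine sq_not_adm (g (sqPt (A ∪ C) hC1)) p hp (insert n C) ?_ ?_
  · intro c hc
    rcases Finset.mem_insert.1 hc with rfl | hc
    · rw [← hn]
      apply hR
      intro m hm
      rw [Bool.eq_iff_iff, sqPt_true, sqPt_true, Finset.mem_union]
      refine ⟨fun h => h.resolve_right fun hmC => ?_, Or.inl⟩
      have := hC2 m hmC
      rw [abs_le] at hm
      omega
    · have h2 : (g (sqPt {c} (sqAdm_singleton c))).1 c = true := by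
        rw [h1, sqPt_true]; exact Finset.mem_singleton_self c
      rw [← h2]
      apply hR
      intro m hm
      rw [Bool.eq_iff_iff, sqPt_true, sqPt_true, Finset.mem_union, Finset.mem_singleton]
      constructor
      · rintro (h | h)
        · exfalso
          have h3 := hC2 c hc
          have h4 := hKA m h
          rw [abs_le] at hm h4
          omega
        · by_contra hne
          have h3 := hC3 m h c hc hne
          have := abs_nonneg n
          omega
      · rintro rfl
        exact Or.inr hc
  · intro t
    by_cases ht : (p : ℤ) ^ 2 ∣ t - n
    · exact ⟨n, Finset.mem_insert_self _ _, ht⟩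
    · obtain ⟨c, hc, hd⟩ := hC4 t ht
      exact ⟨c, Finset.mem_insert_of_mem hc, hd⟩

lemma sq_single (g : sqfShift → sqfShift) (R : ℕ) (hR : SqLocal g R)
    (hcomm : ∀ k x, g (sqSh k x) = sqSh k (g x))
    (h0 : g (sqPt ∅ sqAdm_empty) = sqPt ∅ sqAdm_empty) (u v : ℤ)
    (hu : (g (sqPt {0} (sqAdm_singleton 0))).1 u = true)
    (hv : (g (sqPt {0} (sqAdm_singleton 0))).1 v = true) : u = v := by
  classical
  by_contra huv
  have hbd : ∀ w : ℤ, (g (sqPt {0} (sqAdm_singleton 0))).1 w = true → |w| ≤ R := by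
    intro w hw
    by_contra hlt
    have h1 := hR (sqPt {0} (sqAdm_singleton 0)) (sqPt ∅ sqAdm_empty) w (by
      intro m hm
      rw [Bool.eq_iff_iff, sqPt_true, sqPt_true, Finset.mem_singleton]
      simp only [Finset.notMem_empty, iff_false]
      rintro rfl
      rw [zero_sub, abs_neg] at hm
      exact hlt hm)
    rw [hw, h0] at h1
    exact absurd (sqPt_true.1 h1.symm) (Finset.notMem_empty _)
  obtain ⟨p, hp, hpK⟩ := sq_exists_prime (|u - v| + 1)
  obtain ⟨C, hC1, -, hC3, hC4⟩ := sq_extend {1} (sqAdm_singleton 1) 1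
    (Finset.mem_singleton_self _) 0 p hp
    (fun a ha => by
      rw [Finset.mem_singleton] at ha
      subst ha
      exact hpK _ (by norm_num) (by have := abs_nonneg (u - v); norm_num))
    (2 * R)
  have hC : SqAdm C := hC1.mono Finset.subset_union_right
  push_cast at hC3
  have hval : ∀ w : ℤ, (g (sqPt {0} (sqAdm_singleton 0))).1 w = true → ∀ c ∈ C,
      (g (sqPt C hC)).1 (c + w) = true := by
    intro w hw c hc
    have hwR := hbd w hw
    have h2 : (g (sqSh (-c) (sqPt {0} (sqAdm_singleton 0)))).1 (c + w) = true := by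
      rw [hcomm, sqSh_apply, show c + w + -c = w by ring, hw]
    rw [← h2]
    apply hR
    intro m hm
    rw [Bool.eq_iff_iff, sqSh_apply, sqPt_true, sqPt_true, Finset.mem_singleton]
    constructor
    · intro hmC
      by_contra hne
      have h3 := hC3 m hmC c hc (fun h => hne (by omega))
      have h4 : |m - c| ≤ 2 * R := by
        rw [abs_le] at *
        omega
      omega
    · intro h
      rwa [show m = c by omega]
  refine sq_not_adm (g (sqPt C hC)) p hp (C.image (· + u) ∪ C.image (· + v)) ?_ ?_
  · intro c hc
    rcases Finset.mem_union.1 hc with hc | hc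
    · obtain ⟨d, hd, rfl⟩ := Finset.mem_image.1 hc
      exact hval u hu d hd
    · obtain ⟨d, hd, rfl⟩ := Finset.mem_image.1 hc
      exact hval v hv d hd
  · intro t
    by_cases ht : (p : ℤ) ^ 2 ∣ (t - u) - 0
    · have ht' : ¬ (p : ℤ) ^ 2 ∣ (t - v) - 0 := by
        intro h
        have := dvd_sub h ht
        rw [show t - v - 0 - (t - u - 0) = u - v by ring] at this
        exact hpK _ (sub_ne_zero.2 huv) (by omega) this
      obtain ⟨c, hc, hd⟩ := hC4 _ ht'
      exact ⟨c + v, Finset.mem_union_right _ (Finset.mem_image_of_mem _ hc),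
        by rwa [show t - (c + v) = t - v - c by ring]⟩
    · obtain ⟨c, hc, hd⟩ := hC4 _ ht
      exact ⟨c + u, Finset.mem_union_left _ (Finset.mem_image_of_mem _ hc),
        by rwa [show t - (c + u) = t - u - c by ring]⟩

lemma sq_zero (g : sqfShift → sqfShift) (hcomm : ∀ k x, g (sqSh k x) = sqSh k (g x)) :
    g (sqPt ∅ sqAdm_empty) = sqPt ∅ sqAdm_empty := by
  classical
  set z := sqPt ∅ sqAdm_empty with hz
  have hzero : ∀ n, z.1 n = false := fun n => by
    rw [← Bool.not_eq_true, sqPt_true]; exact Finset.notMem_empty _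
  have hfix : ∀ k, sqSh k z = z := by
    intro k
    ext n
    rw [sqSh_apply, hzero, hzero]
  have hconst : ∀ k, (g z).1 k = (g z).1 0 := by
    intro k
    have := hcomm k z
    rw [hfix] at this
    have h2 := congrArg (fun x : sqfShift => x.1 0) this
    simp only [sqSh_apply, zero_add] at h2
    exact h2.symm
  have hf : (g z).1 0 = false := by
    rw [← Bool.not_eq_true]
    intro ht
    refine sq_not_adm (g z) 2 Nat.prime_two {0, 1, 2, 3} (fun c _ => by rw [hconst, ht]) ?_
    intro t
    have h4 : ((2 : ℕ) : ℤ) ^ 2 = 4 := by norm_num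
    rw [h4]
    have : t % 4 = 0 ∨ t % 4 = 1 ∨ t % 4 = 2 ∨ t % 4 = 3 := by omega
    rcases this with h | h | h | h
    · exact ⟨0, by simp, by omega⟩
    · exact ⟨1, by simp, by omega⟩
    · exact ⟨2, by simp, by omega⟩
    · exact ⟨3, by simp, by omega⟩
  ext n
  rw [hconst, hf, hzero]

lemma sq_fix (H : sqfShift ≃ₜ sqfShift) (hcomm : ∀ k x, H (sqSh k x) = sqSh k (H x))
    (h1 : H (sqPt {0} (sqAdm_singleton 0)) = sqPt {0} (sqAdm_singleton 0)) : ∀ x, H x = x := by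
  classical
  have hcomm' : ∀ k x, H.symm (sqSh k x) = sqSh k (H.symm x) := by
    intro k x
    apply H.injective
    rw [hcomm, H.apply_symm_apply, H.apply_symm_apply]
  obtain ⟨R, hR⟩ := sq_local H H.continuous hcomm
  obtain ⟨R', hR'⟩ := sq_local H.symm H.symm.continuous hcomm'
  have hs : ∀ c, H (sqPt {c} (sqAdm_singleton c)) = sqPt {c} (sqAdm_singleton c) := by
    intro c
    have : sqPt {c} (sqAdm_singleton c) = sqSh (-c) (sqPt {0} (sqAdm_singleton 0)) := by
      ext n
      rw [Bool.eq_iff_iff, sqSh_apply, sqPt_true, sqPt_true, Finset.mem_singleton,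
        Finset.mem_singleton]
      omega
    rw [this, hcomm, h1]
  have hs' : ∀ c, H.symm (sqPt {c} (sqAdm_singleton c)) = sqPt {c} (sqAdm_singleton c) := by
    intro c
    rw [H.symm_apply_eq, hs]
  have hsub := sq_subset H R hR (sq_zero H hcomm) hs
  have hsub' := sq_subset H.symm R' hR' (sq_zero H.symm hcomm') hs'
  have hfin : ∀ A hA, H (sqPt A hA) = sqPt A hA := by
    intro A hA
    set B := A.filter (fun n => (H (sqPt A hA)).1 n = true) with hB
    have hBA : B ⊆ A := Finset.filter_subset _ _
    have hBad : SqAdm B := hA.mono hBA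
    have hHB : H (sqPt A hA) = sqPt B hBad := by
      ext n
      rw [Bool.eq_iff_iff, sqPt_true, hB, Finset.mem_filter]
      exact ⟨fun h => ⟨hsub A hA n h, h⟩, fun h => h.2⟩
    have hAB : A ⊆ B := by
      intro n hn
      apply hsub' B hBad n
      rw [← hHB, H.symm_apply_apply, sqPt_true]
      exact hn
    rw [hHB]
    ext n
    rw [Bool.eq_iff_iff, sqPt_true, sqPt_true]
    exact ⟨fun h => hBA h, fun h => hAB h⟩
  intro x
  ext n
  set A := (Finset.Icc (n - R) (n + R)).filter (fun m => x.1 m = true) with hAdef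
  have hA : SqAdm A := sqAdm_of_mem x.2 A (fun c hc => (Finset.mem_filter.1 hc).2)
  have hag : ∀ m : ℤ, |m - n| ≤ R → x.1 m = (sqPt A hA).1 m := by
    intro m hm
    rw [Bool.eq_iff_iff, sqPt_true, hAdef, Finset.mem_filter, Finset.mem_Icc]
    rw [abs_le] at hm
    exact ⟨fun h => ⟨by omega, h⟩, fun h => h.2⟩
  rw [hR x (sqPt A hA) n hag, hfin, hag n (by simp)]

/-- The square-free subshift has trivial (minimal) centraliser: the shift `S`
restricts to a homeomorphism `SX` of the orbit closure `X` of the square-free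
point, and every self-homeomorphism of `X` commuting with `SX` is a power of
`SX`; i.e. `S(X) = ⟨S⟩ ≅ ℤ`. -/
theorem stmt16 :
    ∃ SX : sqfShift ≃ₜ sqfShift,
      (∀ (x : sqfShift) (n : ℤ), (SX x : ℤ → Bool) n = (x : ℤ → Bool) (n + 1)) ∧
      ∀ G : sqfShift ≃ₜ sqfShift, G * SX = SX * G → ∃ k : ℤ, G = SX ^ k := by
  refine ⟨sqSh 1, fun x n => rfl, fun G hG => ?_⟩
  have hcommG : ∀ k x, G (sqSh k x) = sqSh k (G x) := by
    intro k x
    have h1 : Commute G (sqSh 1) := hG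
    have h2 := (h1.zpow_right k).eq
    rw [sqSh_zpow] at h2
    exact congrArg (fun F : sqfShift ≃ₜ sqfShift => F x) h2
  obtain ⟨R, hR⟩ := sq_local G G.continuous hcommG
  have hz := sq_zero G hcommG
  have hex : ∃ u, (G (sqPt {0} (sqAdm_singleton 0))).1 u = true := by
    by_contra hcon
    push Not at hcon
    have h1 : G (sqPt {0} (sqAdm_singleton 0)) = G (sqPt ∅ sqAdm_empty) := by
      rw [hz]
      ext n
      rw [Bool.eq_iff_iff, sqPt_true]
      exact ⟨fun h => absurd h (hcon n), fun h => absurd h (Finset.notMem_empty _)⟩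
    have h2 := G.injective h1
    have h3 : (sqPt {0} (sqAdm_singleton 0)).1 0 = true :=
      sqPt_true.2 (Finset.mem_singleton_self _)
    rw [h2, sqPt_true] at h3
    exact absurd h3 (Finset.notMem_empty _)
  obtain ⟨u, hu⟩ := hex
  have huniq := fun v hv => sq_single G R hR hcommG hz v u hv hu
  have hfix := sq_fix (sqSh u * G) (by
    intro k x
    rw [sq_mul_apply, sq_mul_apply, hcommG]
    ext n
    simp only [sqSh_apply]
    rw [add_right_comm]) (by
    ext n
    rw [Bool.eq_iff_iff, sqPt_true, sq_mul_apply, sqSh_apply, Finset.mem_singleton]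
    constructor
    · intro h
      have := huniq _ h
      omega
    · rintro rfl
      rw [zero_add, hu])
  refine ⟨-u, ?_⟩
  have h1 : sqSh u * G = 1 := Homeomorph.ext hfix
  rw [zpow_neg, sqSh_zpow]
  exact (inv_eq_of_mul_eq_one_right h1).symm
end
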